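/- arXiv:math/0301293 — 3 statements merged into one kernel-verified Lean document; each statement's English description precedes it below -/
import Mathlib

section
/- Let f : X → Y be a perfect 0-dimensional surjective map between metrizable spaces with dim Y = m, let p ≥ 1 and set l = ⌊m/p⌋ + 1. Then the set of maps g ∈ C*(X, ℝ^p) such that f×g : X → Y × ℝ^p is at most l-to-1 (i.e., |(f×g)⁻¹(z)| ≤ l for all z ∈ Y × ℝ^p) contains a dense G_δ-subset of C*(X, ℝ^p) with respect to the source limitation topology. -/
open Set Topology Metric BoundedContinuousFunction

noncomputable section

/-- Covering dimension at most `n` (for a natural number `n`): every finite open cover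
has an open refinement covering the space such that every point belongs to at most
`n + 1` members of the refinement. -/
def CovDimLENat (X : Type*) [TopologicalSpace X] (n : ℕ) : Prop :=
  ∀ 𝒰 : Set (Set X), 𝒰.Finite → (∀ U ∈ 𝒰, IsOpen U) → ⋃₀ 𝒰 = Set.univ →
    ∃ 𝒱 : Set (Set X), (∀ V ∈ 𝒱, IsOpen V) ∧ ⋃₀ 𝒱 = Set.univ ∧
      (∀ V ∈ 𝒱, ∃ U ∈ 𝒰, V ⊆ U) ∧
      ∀ x : X, {V ∈ 𝒱 | x ∈ V}.Finite ∧ {V ∈ 𝒱 | x ∈ V}.ncard ≤ n + 1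

/-- Covering dimension at most `n` for an integer `n`; negative bounds mean the space
is empty (`dim ∅ = -1`). -/
def CovDimLE (X : Type*) [TopologicalSpace X] (n : ℤ) : Prop :=
  IsEmpty X ∨ ∃ k : ℕ, (k : ℤ) ≤ n ∧ CovDimLENat X k

/-- A space is finite-dimensional if its covering dimension is at most `n` for some `n`. -/
def FiniteDimSpace (X : Type*) [TopologicalSpace X] : Prop :=
  ∃ n : ℕ, CovDimLENat X n

/-- A perfect map: continuous, closed, with compact fibers. -/
def IsPerfectMap {X Y : Type*} [TopologicalSpace X] [TopologicalSpace Y] (f : X → Y) : Prop :=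
  Continuous f ∧ IsClosedMap f ∧ ∀ y : Y, IsCompact (f ⁻¹' {y})

/-- A σ-perfect map: `X` is a countable union of closed sets `A i` whose images are
closed and on which `f` restricts to a perfect map onto its image. -/
def IsSigmaPerfectMap {X Y : Type*} [TopologicalSpace X] [TopologicalSpace Y] (f : X → Y) :
    Prop :=
  Continuous f ∧ ∃ A : ℕ → Set X, (⋃ i, A i) = Set.univ ∧
    ∀ i, IsClosed (A i) ∧ IsClosed (f '' A i) ∧
      IsPerfectMap (Set.MapsTo.restrict f (A i) (f '' A i) (Set.mapsTo_image f (A i)))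

/-- `dim f ≤ k`: every fiber of `f` has covering dimension at most `k`. -/
def DimMapLE {X Y : Type*} [TopologicalSpace X] [TopologicalSpace Y] (f : X → Y) (k : ℤ) :
    Prop :=
  ∀ y : Y, CovDimLE (f ⁻¹' {y}) k

/-- `B_n(h)`: the set of points of the codomain having at least `n` preimages. -/
def BranchSet {X Z : Type*} (h : X → Z) (n : ℕ) : Set Z :=
  {z | ∃ S : Finset X, n ≤ S.card ∧ ∀ x ∈ S, h x = z}

/-- The source limitation topology on the space of bounded continuous maps. -/
def sourceLimitation (X E : Type*) [TopologicalSpace X] [PseudoMetricSpace E] :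
    TopologicalSpace (X →ᵇ E) where
  IsOpen U := ∀ g ∈ U, ∃ α : X → ℝ, Continuous α ∧ (∀ x, 0 < α x) ∧
    ∀ h : X →ᵇ E, (∀ x, dist (h x) (g x) ≤ α x) → h ∈ U
  isOpen_univ := fun g _ =>
    ⟨fun _ => 1, continuous_const, fun _ => one_pos, fun _ _ => trivial⟩
  isOpen_inter := by
    rintro U V hU hV g ⟨hgU, hgV⟩
    obtain ⟨α, hαc, hαp, hα⟩ := hU g hgU
    obtain ⟨β, hβc, hβp, hβ⟩ := hV g hgV
    exact ⟨fun x => min (α x) (β x), hαc.min hβc, fun x => lt_min (hαp x) (hβp x),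
      fun h hh => ⟨hα h fun x => (hh x).trans (min_le_left _ _),
        hβ h fun x => (hh x).trans (min_le_right _ _)⟩⟩
  isOpen_sUnion := by
    rintro S hS g ⟨U, hU, hgU⟩
    obtain ⟨α, hc, hp, h⟩ := hS U hU g hgU
    exact ⟨α, hc, hp, fun h' hh' => ⟨U, hU, h h' hh'⟩⟩

/-- A C-space. -/
def IsCSpace (Y : Type*) [TopologicalSpace Y] : Prop :=
  ∀ 𝒰 : ℕ → Set (Set Y), (∀ n, (∀ U ∈ 𝒰 n, IsOpen U) ∧ ⋃₀ 𝒰 n = Set.univ) →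
    ∃ 𝒱 : ℕ → Set (Set Y),
      (∀ n, (∀ V ∈ 𝒱 n, IsOpen V) ∧ (∀ V ∈ 𝒱 n, ∃ U ∈ 𝒰 n, V ⊆ U) ∧
        (𝒱 n).Pairwise (Disjoint · ·)) ∧
      ⋃₀ (⋃ n, 𝒱 n) = Set.univ

/-- `F` is a `Z_m`-set in `M`: `F` is closed and the maps from the `m`-cube avoiding `F`
are dense in `C(𝕀^m, M)` (uniform convergence topology). -/
def IsZmSet (m : ℕ) {M : Type*} [TopologicalSpace M] (F : Set M) : Prop :=
  IsClosed F ∧ Dense {u : C((Fin m → unitInterval), M) | ∀ z, u z ∉ F}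

/-- `F` is a `Z`-set in `M` if it is a `Z_m`-set for all `m`. -/
def IsZSet {M : Type*} [TopologicalSpace M] (F : Set M) : Prop :=
  ∀ m : ℕ, IsZmSet m F

end

set_option linter.unusedSimpArgs false

universe u

theorem aux_dim_finite {Y : Type*} [TopologicalSpace Y] {m : ℕ} (hY : CovDimLENat Y m)
    {ι : Type*} [Finite ι] (W : ι → Set Y) (hWo : ∀ i, IsOpen (W i)) (hW : ∀ y, ∃ i, y ∈ W i) :
    ∃ V : ι → Set Y, (∀ i, IsOpen (V i)) ∧ (∀ i, V i ⊆ W i) ∧ (∀ y, ∃ i, y ∈ V i) ∧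
      ∀ y, ∀ J : Finset ι, (∀ i ∈ J, y ∈ V i) → J.card ≤ m + 1 := by
  obtain ⟨𝒱, ho, hcov, href, hord⟩ := hY (Set.range W) (Set.finite_range W)
    (by rintro _ ⟨i, rfl⟩; exact hWo i)
    (by
      apply Set.eq_univ_of_forall
      intro y
      obtain ⟨i, hi⟩ := hW y
      exact ⟨W i, ⟨i, rfl⟩, hi⟩)
  have href' : ∀ V : 𝒱, ∃ i, V.1 ⊆ W i := by
    rintro ⟨V, hV⟩
    obtain ⟨_, ⟨i, rfl⟩, hi⟩ := href V hV
    exact ⟨i, hi⟩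
  choose u hu using href'
  refine ⟨fun i => ⋃ V : {V : 𝒱 // u V = i}, V.1.1, ?_, ?_, ?_, ?_⟩
  · intro i
    exact isOpen_iUnion fun V => ho _ V.1.2
  · intro i
    refine Set.iUnion_subset ?_
    rintro ⟨V, rfl⟩
    exact hu V
  · intro y
    have : y ∈ ⋃₀ 𝒱 := by rw [hcov]; trivial
    obtain ⟨V, hV, hy⟩ := this
    exact ⟨u ⟨V, hV⟩, Set.mem_iUnion.2 ⟨⟨⟨V, hV⟩, rfl⟩, hy⟩⟩
  · intro y J hJ
    obtain ⟨hfin, hcard⟩ := hord y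
    have h1 : ∀ i : J, ∃ V : 𝒱, u V = i ∧ y ∈ V.1 := by
      rintro ⟨i, hi⟩
      obtain ⟨⟨V, hV⟩, hy⟩ := Set.mem_iUnion.1 (hJ i hi)
      exact ⟨V, hV, hy⟩
    choose w hw1 hw2 using h1
    have hinj : Function.Injective (fun i : J => (w i).1) := by
      intro i j hij
      have : w i = w j := Subtype.ext hij
      apply Subtype.ext
      rw [← hw1 i, ← hw1 j, this]
    have : (Set.range fun i : J => (w i).1).ncard ≤ {V ∈ 𝒱 | y ∈ V}.ncard := by
      apply Set.ncard_le_ncard _ hfin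
      rintro _ ⟨i, rfl⟩
      exact ⟨(w i).2, hw2 i⟩
    rw [Set.ncard_range_of_injective hinj] at this
    simp at this
    omega

theorem aux_dim_step {Y : Type*} [TopologicalSpace Y] {m : ℕ} (hY : CovDimLENat Y m)
    (W : ℕ → Set Y) (hWo : ∀ i, IsOpen (W i)) (A : Set Y) (hA : IsClosed A) (N : ℕ)
    (hW : ∀ y ∈ A, ∃ n ≤ N, y ∈ W n) :
    ∃ V : ℕ → Set Y, (∀ i, IsOpen (V i)) ∧ (∀ i, V i ⊆ W i) ∧
      (∀ y ∈ A, ∃ n ≤ N, y ∈ V n) ∧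
      (∀ y, y ∉ A → ∀ n, (y ∈ V n ↔ y ∈ W n)) ∧
      ∀ y ∈ A, ∀ J : Finset ℕ, (∀ i ∈ J, y ∈ V i) → J.card ≤ m + 1 := by
  classical
  obtain ⟨T, hTo, hTW, hTc, hTord⟩ := aux_dim_finite hY (ι := Option (Fin (N + 1)))
    (fun o => o.elim Aᶜ (fun i => W i))
    (by rintro (_ | i); exacts [hA.isOpen_compl, hWo i])
    (by
      intro y
      by_cases hy : y ∈ A
      · obtain ⟨n, hn, hy⟩ := hW y hy
        exact ⟨some ⟨n, by omega⟩, hy⟩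
      · exact ⟨none, hy⟩)
  refine ⟨fun n => (W n \ A) ∪ (if h : n < N + 1 then T (some ⟨n, h⟩) else ∅), ?_, ?_, ?_, ?_, ?_⟩
  · intro n
    refine ((hWo n).sdiff hA).union ?_
    split_ifs
    exacts [hTo _, isOpen_empty]
  · intro n
    refine Set.union_subset Set.sdiff_subset ?_
    split_ifs with h
    · exact hTW (some ⟨n, h⟩)
    · exact Set.empty_subset _
  · intro y hy
    obtain ⟨o, ho⟩ := hTc y
    rcases o with _ | ⟨n, hn⟩
    · exact absurd hy (hTW none ho)
    · refine ⟨n, by omega, Or.inr ?_⟩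
      rwa [dif_pos hn]
  · intro y hy n
    constructor
    · rintro (h | h)
      · exact h.1
      · split_ifs at h with hn
        · exact hTW (some ⟨n, hn⟩) h
        · exact h.elim
    · intro h
      exact Or.inl ⟨h, hy⟩
  · intro y hy J hJ
    have h1 : ∀ i : J, ∃ h : i.1 < N + 1, y ∈ T (some ⟨i, h⟩) := by
      rintro ⟨i, hi⟩
      rcases hJ i hi with h | h
      · exact absurd hy h.2
      · split_ifs at h with hn
        · exact ⟨hn, h⟩
        · exact h.elim
    choose h1 h2 using h1
    let e : J → Option (Fin (N + 1)) := fun i => some ⟨i, h1 i⟩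
    have he : Function.Injective e := by
      intro i j hij
      have h3 := congrArg Fin.val (Option.some.inj hij)
      exact Subtype.ext h3
    have := hTord y (Finset.univ.image e) (by
      intro o ho
      simp only [Finset.mem_image, Finset.mem_univ, true_and] at ho
      obtain ⟨i, rfl⟩ := ho
      exact h2 i)
    rw [Finset.card_image_of_injective _ he] at this
    simpa using this

theorem aux_dim_countable {Y : Type*} [TopologicalSpace Y] [NormalSpace Y] [ParacompactSpace Y]
    {m : ℕ} (hY : CovDimLENat Y m)
    (W : ℕ → Set Y) (hWo : ∀ i, IsOpen (W i)) (hW : ∀ y, ∃ i, y ∈ W i) :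
    ∃ V : ℕ → Set Y, (∀ i, IsOpen (V i)) ∧ (∀ i, V i ⊆ W i) ∧ (∀ y, ∃ i, y ∈ V i) ∧
      ∀ y, ∀ J : Finset ℕ, (∀ i ∈ J, y ∈ V i) → J.card ≤ m + 1 := by
  obtain ⟨τ, hτ⟩ := exists_continuous_forall_mem_convex_of_local_const (X := Y) (E := ℝ)
    (t := fun y => {t : ℝ | ∃ n : ℕ, (n : ℝ) ≤ t ∧ y ∈ W n})
    (by
      intro y a ha b hb s t hs ht hst
      obtain ⟨n, hn, hn'⟩ := ha
      obtain ⟨k, hk, hk'⟩ := hb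
      rcases le_total a b with h | h
      · refine ⟨n, ?_, hn'⟩
        simp only [smul_eq_mul]
        have : s = 1 - t := by linarith
        subst this
        nlinarith
      · refine ⟨k, ?_, hk'⟩
        simp only [smul_eq_mul]
        have : t = 1 - s := by linarith
        subst this
        nlinarith)
    (by
      intro y
      obtain ⟨n, hn⟩ := hW y
      refine ⟨n, ?_⟩
      filter_upwards [(hWo n).mem_nhds hn] with z hz
      exact ⟨n, le_rfl, hz⟩)
  have hτ0 : ∀ y, 0 ≤ τ y := by
    intro y
    obtain ⟨n, hn, -⟩ := hτ y
    exact (Nat.cast_nonneg n).trans hn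
  let P : ℕ → (ℕ → Set Y) → Prop := fun k V => (∀ n, IsOpen (V n)) ∧ (∀ n, V n ⊆ W n) ∧
    (∀ y, ∃ n, y ∈ V n) ∧ ∀ y, (k : ℝ) ≤ τ y → ∃ n : ℕ, (n : ℝ) ≤ τ y ∧ y ∈ V n
  have step : ∀ k (V : {V // P k V}), ∃ V' : {V // P (k + 1) V},
      (∀ y, (k + 1 : ℝ) < τ y ∨ τ y < k → ∀ n, (y ∈ V'.1 n ↔ y ∈ V.1 n)) ∧
      ∀ y, (k : ℝ) ≤ τ y → τ y ≤ k + 1 →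
        ∀ J : Finset ℕ, (∀ i ∈ J, y ∈ V'.1 i) → J.card ≤ m + 1 := by
    rintro k ⟨V, hVo, hVW, hVc, hVk⟩
    obtain ⟨T, hTo, hTV, hTA, hTn, hTord⟩ := aux_dim_step hY V hVo (τ ⁻¹' (Set.Icc (k : ℝ) (k + 1)))
      (isClosed_Icc.preimage τ.continuous) (k + 1) (by
        rintro y ⟨h1, h2⟩
        obtain ⟨n, hn, hn'⟩ := hVk y h1
        refine ⟨n, ?_, hn'⟩
        have : (n : ℝ) ≤ (k + 1 : ℕ) := by push_cast; linarith
        exact_mod_cast this)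
    refine ⟨⟨T, hTo, fun n => (hTV n).trans (hVW n), ?_, ?_⟩, ?_, ?_⟩
    · intro y
      by_cases hy : y ∈ τ ⁻¹' (Set.Icc (k : ℝ) (k + 1))
      · obtain ⟨n, -, hn⟩ := hTA y hy
        exact ⟨n, hn⟩
      · obtain ⟨n, hn⟩ := hVc y
        exact ⟨n, (hTn y hy n).2 hn⟩
    · intro y hy
      push_cast at hy
      rcases hy.eq_or_lt with h | h
      · obtain ⟨n, hn, hn'⟩ := hTA y ⟨by linarith, h.ge⟩
        refine ⟨n, ?_, hn'⟩
        rw [← h]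
        exact_mod_cast hn
      · obtain ⟨n, hn, hn'⟩ := hVk y (by linarith)
        exact ⟨n, hn, (hTn y (fun hh => absurd hh.2 (not_le.2 h)) n).2 hn'⟩
    · intro y hy
      apply hTn
      rintro ⟨h1, h2⟩
      rcases hy with h | h <;> linarith
    · intro y h1 h2
      exact hTord y ⟨h1, h2⟩
  choose S hS1 hS2 using step
  let F : ∀ k, {V // P k V} := fun k => Nat.rec (motive := fun k => {V // P k V})
    ⟨W, hWo, fun _ => subset_rfl, hW, fun y _ => hτ y⟩ (fun k V => S k V) k
  have hF : ∀ k, F (k + 1) = S k (F k) := fun k => rfl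
  have hstab : ∀ y (K : ℕ), τ y < K → ∀ n, (y ∈ (F K).1 n ↔ y ∈ (F (⌊τ y⌋₊ + 1)).1 n) := by
    intro y K hK n
    have h0 : ⌊τ y⌋₊ + 1 ≤ K := (Nat.floor_lt (hτ0 y)).2 hK
    induction K, h0 using Nat.le_induction with
    | base => rfl
    | succ K hKK ih =>
      have h3 : τ y < K := (Nat.floor_lt (hτ0 y)).1 hKK
      rw [hF]
      exact (hS1 K (F K) y (Or.inr h3) n).trans (ih h3)
  refine ⟨fun n => {y | y ∈ (F (⌊τ y⌋₊ + 1)).1 n}, ?_, ?_, ?_, ?_⟩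
  · intro n
    rw [isOpen_iff_mem_nhds]
    intro y hy
    have h1 : τ y < (⌊τ y⌋₊ + 1 : ℕ) := by
      push_cast
      exact Nat.lt_floor_add_one _
    filter_upwards [((F (⌊τ y⌋₊ + 1)).2.1 n).mem_nhds hy,
      (isOpen_Iio.preimage τ.continuous).mem_nhds h1] with z hz1 hz2
    exact (hstab z _ hz2 n).1 hz1
  · intro n y hy
    exact (F (⌊τ y⌋₊ + 1)).2.2.1 n hy
  · intro y
    exact (F (⌊τ y⌋₊ + 1)).2.2.2.1 y
  · intro y J hJ
    exact hS2 ⌊τ y⌋₊ (F _) y (Nat.floor_le (hτ0 y)) (Nat.lt_floor_add_one _).le J hJ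

theorem aux_barycentric {Y : Type u} [TopologicalSpace Y] [NormalSpace Y] [ParacompactSpace Y]
    (Good : Set Y → Prop) (hsub : ∀ U V, Good V → IsOpen U → U ⊆ V → Good U)
    (hun : ∀ {κ : Type u} (U : κ → Set Y), (∀ i, IsOpen (U i)) → (∀ i, Good (U i)) →
      (∀ i j y, y ∈ U i → y ∈ U j → i = j) → Good (⋃ i, U i))
    {ι : Type u} (W : ι → Set Y) (hWo : ∀ i, IsOpen (W i)) (hWg : ∀ i, Good (W i))
    (hW : ∀ y, ∃ i, y ∈ W i) :
    ∃ G : ℕ → Set Y, (∀ n, IsOpen (G n)) ∧ (∀ n, Good (G n)) ∧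
      ∀ y, ∃ n, ∃ J : Finset ι, J.card = n + 1 ∧ y ∈ G n ∧ ∀ i ∈ J, y ∈ W i := by
  classical
  obtain ⟨ρ, hρ⟩ := PartitionOfUnity.exists_isSubordinate isClosed_univ W hWo
    (fun y _ => Set.mem_iUnion.2 (hW y))
  have hρW : ∀ i y, 0 < ρ i y → y ∈ W i := fun i y h =>
    hρ i (subset_tsupport _ (Function.mem_support.2 h.ne'))
  let U : Finset ι → Set Y := fun J => {y | ∀ j ∈ J, 0 < ρ j y ∧ ∀ k, k ∉ J → ρ k y < ρ j y}
  have hUo : ∀ J, IsOpen (U J) := by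
    intro J
    rw [isOpen_iff_mem_nhds]
    intro y hy
    obtain ⟨I, hI⟩ := ρ.exists_finset_nhds y
    have h1 : ∀ j ∈ J, ∀ᶠ z in 𝓝 y, 0 < ρ j z := fun j hj =>
      (isOpen_Ioi.preimage (ρ j).continuous).mem_nhds (hy j hj).1
    have h2 : ∀ j ∈ J, ∀ k ∈ I, ∀ᶠ z in 𝓝 y, k ∉ J → ρ k z < ρ j z := by
      intro j hj k hk
      by_cases hkJ : k ∈ J
      · simp [hkJ]
      · filter_upwards [(isOpen_lt (ρ k).continuous (ρ j).continuous).mem_nhds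
          ((hy j hj).2 k hkJ)] with z hz _ using hz
    have h1' := (Filter.eventually_all_finset J).2 h1
    have h2' := (Filter.eventually_all_finset J).2
      (fun j hj => (Filter.eventually_all_finset I).2 (h2 j hj))
    filter_upwards [h1', h2', hI] with z hz1 hz2 hz3
    intro j hj
    refine ⟨hz1 j hj, fun k hk => ?_⟩
    by_cases hkI : k ∈ I
    · exact hz2 j hj k hkI hk
    · have : ρ k z = 0 := by
        by_contra h
        exact hkI (hz3.2 h)
      rw [this]
      exact hz1 j hj
  have hUdisj : ∀ J J' : Finset ι, J.card = J'.card → ∀ y, y ∈ U J → y ∈ U J' → J = J' := by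
    intro J J' hc y hy hy'
    by_contra hne
    have h1 : ¬ J ⊆ J' := fun h => hne (Finset.eq_of_subset_of_card_le h hc.ge)
    have h2 : ¬ J' ⊆ J := fun h => hne (Finset.eq_of_subset_of_card_le h hc.le).symm
    obtain ⟨a, ha, ha'⟩ := Finset.not_subset.1 h1
    obtain ⟨b, hb, hb'⟩ := Finset.not_subset.1 h2
    exact lt_asymm ((hy a ha).2 b hb') ((hy' b hb).2 a ha')
  refine ⟨fun n => ⋃ J : {J : Finset ι // J.card = n + 1}, U J.1, ?_, ?_, ?_⟩
  · exact fun n => isOpen_iUnion fun J => hUo _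
  · intro n
    refine hun (fun J : {J : Finset ι // J.card = n + 1} => U J.1) (fun J => hUo _) ?_ ?_
    · rintro ⟨J, hJ⟩
      obtain ⟨j, hj⟩ := Finset.card_pos.1 (by omega : 0 < J.card)
      exact hsub _ _ (hWg j) (hUo _) fun y hy => hρW j y (hy j hj).1
    · rintro ⟨J, hJ⟩ ⟨J', hJ'⟩ y hy hy'
      exact Subtype.ext (hUdisj J J' (hJ.trans hJ'.symm) y hy hy')
  · intro y
    obtain ⟨i0, hi0⟩ := ρ.exists_pos (Set.mem_univ y)
    have hne : (ρ.finsupport y).Nonempty := ⟨i0, by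
      rw [PartitionOfUnity.mem_finsupport]; exact hi0.ne'⟩
    obtain ⟨a, ha, hmax⟩ := Finset.exists_max_image _ (fun i => ρ i y) hne
    have hapos : 0 < ρ a y := lt_of_lt_of_le hi0 (hmax i0 (by
      rw [PartitionOfUnity.mem_finsupport]; exact hi0.ne'))
    let J := (ρ.finsupport y).filter (fun i => ρ i y = ρ a y)
    have haJ : a ∈ J := Finset.mem_filter.2 ⟨ha, rfl⟩
    have hJpos : 0 < J.card := Finset.card_pos.2 ⟨a, haJ⟩
    have hJU : y ∈ U J := by
      intro j hj
      have hj' := (Finset.mem_filter.1 hj).2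
      refine ⟨by rw [hj']; exact hapos, fun k hk => ?_⟩
      rw [hj']
      by_cases hks : k ∈ ρ.finsupport y
      · refine lt_of_le_of_ne (hmax k hks) fun h => hk (Finset.mem_filter.2 ⟨hks, h⟩)
      · rw [PartitionOfUnity.mem_finsupport, Function.mem_support, not_not] at hks
        rw [hks]
        exact hapos
    refine ⟨J.card - 1, J, by omega, Set.mem_iUnion.2 ⟨⟨J, by omega⟩, hJU⟩, ?_⟩
    intro i hi
    exact hρW i y (hJU i hi).1

theorem aux_good_cover {Y : Type u} [TopologicalSpace Y] [NormalSpace Y] [ParacompactSpace Y]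
    {m : ℕ} (hY : CovDimLENat Y m)
    (Good : Set Y → Prop) (hsub : ∀ U V, Good V → IsOpen U → U ⊆ V → Good U)
    (hun : ∀ {κ : Type u} (U : κ → Set Y), (∀ i, IsOpen (U i)) → (∀ i, Good (U i)) →
      (∀ i j y, y ∈ U i → y ∈ U j → i = j) → Good (⋃ i, U i))
    (hloc : ∀ y, ∃ U, IsOpen U ∧ y ∈ U ∧ Good U) :
    ∃ G : Fin (m + 1) → Set Y, (∀ n, IsOpen (G n)) ∧ (∀ n, Good (G n)) ∧ ∀ y, ∃ n, y ∈ G n := by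
  choose U hUo hUy hUg using hloc
  obtain ⟨G, hGo, hGg, hGc⟩ := aux_barycentric Good hsub hun U hUo hUg (fun y => ⟨y, hUy y⟩)
  obtain ⟨V, hVo, hVG, hVc, hVord⟩ := aux_dim_countable hY G hGo
    (fun y => by obtain ⟨n, J, -, h, -⟩ := hGc y; exact ⟨n, h⟩)
  obtain ⟨H, hHo, hHg, hHc⟩ := aux_barycentric Good hsub hun (fun n : ULift.{u} ℕ => V n.down)
    (fun n => hVo _)
    (fun n => hsub _ _ (hGg n.down) (hVo _) (hVG _)) (fun y => by
      obtain ⟨n, hn⟩ := hVc y; exact ⟨⟨n⟩, hn⟩)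
  refine ⟨fun n => H n, fun n => hHo _, fun n => hHg _, fun y => ?_⟩
  obtain ⟨n, J, hJ, hy, hJV⟩ := hHc y
  have := hVord y (J.map ⟨ULift.down, ULift.down_injective⟩) (by
    intro i hi
    obtain ⟨j, hj, rfl⟩ := Finset.mem_map.1 hi
    exact hJV j hj)
  rw [Finset.card_map] at this
  exact ⟨⟨n, by omega⟩, hy⟩

theorem aux_exists_algInd (I : Type) [Countable I] :
    ∃ x : I → ℝ, AlgebraicIndependent ℚ x := by
  obtain ⟨ι, x, hx⟩ := exists_isTranscendenceBasis' ℚ ℝ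
  have hne : Infinite ι := by
    by_contra hfin
    rw [not_infinite_iff_finite] at hfin
    have h1 : Cardinal.mk ℝ ≤ Cardinal.aleph0 := by
      rcases isEmpty_or_nonempty ι with he | he
      · have := hx.isEmpty_iff_isAlgebraic.1 he
        have := Algebra.IsAlgebraic.cardinalMk_le_max ℚ ℝ
        simpa using this
      · have := hx.lift_cardinalMk_eq_max_lift
        simp only [Cardinal.lift_id, Cardinal.lift_uzero] at this
        rw [this]
        have := Cardinal.mk_le_aleph0 (α := ι)
        simp
    rw [Cardinal.mk_real] at h1
    exact absurd h1 (not_le.2 Cardinal.aleph0_lt_continuum)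
  obtain ⟨e, he⟩ := Countable.exists_injective_nat I
  let j := Infinite.natEmbedding ι
  exact ⟨fun i => x (j (e i)), hx.1.comp (fun i => j (e i)) (j.injective.comp he)⟩

theorem aux_algInd_affine {I : Type} {x : I → ℝ} (hx : AlgebraicIndependent ℚ x)
    (r q : I → ℚ) (hr : ∀ i, r i ≠ 0) :
    AlgebraicIndependent ℚ (fun i => (r i : ℝ) * x i + q i) := by
  let φ : MvPolynomial I ℚ →ₐ[ℚ] MvPolynomial I ℚ :=
    MvPolynomial.aeval (fun i => MvPolynomial.C (r i) * MvPolynomial.X i + MvPolynomial.C (q i))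
  let ψ : MvPolynomial I ℚ →ₐ[ℚ] MvPolynomial I ℚ :=
    MvPolynomial.aeval (fun i => MvPolynomial.C (r i)⁻¹ * (MvPolynomial.X i - MvPolynomial.C (q i)))
  have h1 : ψ.comp φ = AlgHom.id ℚ _ := by
    ext i : 1
    simp only [φ, ψ, AlgHom.comp_apply, MvPolynomial.aeval_X, map_add, map_mul,
      MvPolynomial.algHom_C, AlgHom.id_apply, MvPolynomial.algebraMap_eq]
    rw [← mul_assoc, ← map_mul, mul_inv_cancel₀ (hr i)]
    simp
  have h2 : Function.Injective φ := by
    intro a b hab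
    have := congrArg ψ hab
    rwa [← AlgHom.comp_apply, ← AlgHom.comp_apply, h1] at this
  have h3 : MvPolynomial.aeval (fun i => (r i : ℝ) * x i + q i)
      = (MvPolynomial.aeval (R := ℚ) x).comp φ := by
    ext i
    simp [φ]
  unfold AlgebraicIndependent
  rw [h3]
  intro a b hab
  exact h2 (hx hab)

theorem aux_generic (m p l : ℕ) (hml : m + 1 ≤ l * p) :
    ∃ d : Fin (m + 1) → ℕ × ℕ → EuclideanSpace ℝ (Fin p),
      (∀ c n, ∀ v : EuclideanSpace ℝ (Fin p), ∀ δ > 0, ∃ k, dist (d c (n, k)) v < δ) ∧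
      ∀ i : Fin (m + 1) → Fin (l + 1) → ℕ × ℕ, (∀ c, Function.Injective (i c)) →
        ∀ μ : Fin (m + 1) → ℝ,
          (∀ a, ∑ c, μ c • d c (i c a) = ∑ c, μ c • d c (i c 0)) → μ = 0 := by
  obtain ⟨x, hx⟩ := aux_exists_algInd (Fin (m + 1) × (ℕ × ℕ) × Fin p)
  obtain ⟨e, he⟩ := exists_surjective_nat ((Fin p → ℚ) × ℕ)
  have hr : ∀ i : Fin (m + 1) × (ℕ × ℕ) × Fin p, ∃ r : ℚ, r ≠ 0 ∧
      |(r : ℝ) * x i| < 1 / ((e i.2.1.2).2 + 1 : ℝ) := by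
    intro i
    have hpos : (0 : ℝ) < 1 / ((e i.2.1.2).2 + 1 : ℝ) / (|x i| + 1) := by positivity
    obtain ⟨r, hr0, hr1⟩ := exists_rat_btwn hpos
    refine ⟨r, by exact_mod_cast hr0.ne', ?_⟩
    rw [abs_mul, abs_of_pos hr0]
    rw [lt_div_iff₀ (by positivity)] at hr1
    nlinarith [abs_nonneg (x i)]
  choose r hr0 hr1 using hr
  have hy := aux_algInd_affine hx r (fun i => (e i.2.1.2).1 i.2.2) hr0
  set y : Fin (m + 1) × (ℕ × ℕ) × Fin p → ℝ :=
    fun i => (r i : ℝ) * x i + ((e i.2.1.2).1 i.2.2 : ℚ) with hydef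
  refine ⟨fun c j => WithLp.toLp 2 (fun t => y (c, j, t)), ?_, ?_⟩
  · intro c n v δ hδ
    -- continuity of toLp
    have hc : Continuous (fun w : Fin p → ℝ => (WithLp.toLp 2 w : EuclideanSpace ℝ (Fin p))) :=
      PiLp.continuous_toLp 2 _
    obtain ⟨η, hη, hη'⟩ := Metric.continuous_iff.1 hc v.ofLp δ hδ
    have hq : ∀ t, ∃ q : ℚ, |(q : ℝ) - v.ofLp t| < η / 3 := by
      intro t
      obtain ⟨q, hq1, hq2⟩ := exists_rat_btwn (show v.ofLp t < v.ofLp t + η / 3 by linarith)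
      exact ⟨q, by rw [abs_lt]; constructor <;> linarith⟩
    choose q hq using hq
    obtain ⟨N, hN⟩ := exists_nat_one_div_lt (show 0 < η / 3 by linarith)
    obtain ⟨k, hk⟩ := he (q, N)
    refine ⟨k, hη' _ ?_⟩
    refine (dist_pi_lt_iff hη).2 fun t => ?_
    have h1 := hr1 (c, (n, k), t)
    have h2 := hq t
    simp only [hydef, hk, Real.dist_eq] at h1 ⊢
    rw [abs_lt] at *
    constructor <;> linarith
  · intro i hi μ hμ
    obtain ⟨em⟩ : Nonempty (Fin (m + 1) ↪ Fin l × Fin p) :=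
      Function.Embedding.nonempty_of_card_le (by simpa using hml)
    let P : Matrix (Fin (m + 1)) (Fin (m + 1)) (MvPolynomial (Fin (m + 1) × (ℕ × ℕ) × Fin p) ℚ) :=
      Matrix.of fun c c' => MvPolynomial.X (c, i c (Fin.succ (em c').1), (em c').2)
        - MvPolynomial.X (c, i c 0, (em c').2)
    let z : Fin (m + 1) × (ℕ × ℕ) × Fin p → ℚ := fun w =>
      if w.2.1 = i w.1 (Fin.succ (em w.1).1) ∧ w.2.2 = (em w.1).2 then 1 else 0
    have hP1 : (MvPolynomial.eval z).mapMatrix P = 1 := by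
      ext c c'
      have h0 : i c 0 ≠ i c (Fin.succ (em c).1) := fun h => (Fin.succ_ne_zero _ (hi c h).symm)
      simp only [RingHom.mapMatrix_apply, Matrix.map_apply, P, Matrix.of_apply, map_sub, MvPolynomial.eval_X, z, h0,
        false_and, if_false, sub_zero, Matrix.one_apply]
      congr 1
      rw [(hi c).eq_iff, Fin.succ_inj, ← Prod.ext_iff, em.injective.eq_iff]
      exact propext eq_comm
    have hP : P.det ≠ 0 := by
      intro h
      have := RingHom.map_det (MvPolynomial.eval z) P
      rw [hP1, h] at this
      simp at this
    have hM : ((MvPolynomial.aeval (R := ℚ) y).mapMatrix P).det ≠ 0 := by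
      rw [← AlgHom.map_det]
      intro h
      exact hP (hy (by simpa using h))
    refine Matrix.eq_zero_of_vecMul_eq_zero hM ?_
    ext c'
    have := congrArg (fun w : EuclideanSpace ℝ (Fin p) => w.ofLp (em c').2)
      (hμ (Fin.succ (em c').1))
    simp only [WithLp.ofLp_sum, WithLp.ofLp_smul, Finset.sum_apply, Pi.smul_apply,
      smul_eq_mul] at this
    simp only [Matrix.vecMul, dotProduct, AlgHom.mapMatrix_apply, Matrix.map_apply, P, Matrix.of_apply, map_sub,
      MvPolynomial.aeval_X, mul_sub, Finset.sum_sub_distrib, this, sub_self, Pi.zero_apply]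

/-- Locally constant labelling over an open set `U` of the base. -/
def AuxGood {X Y E : Type*} [MetricSpace X] [PseudoMetricSpace E] (f : X → Y) (g : X → E)
    (α : X → ℝ) (ε : ℝ) (d : ℕ × ℕ → E) (U : Set Y) : Prop :=
  ∃ i : X → ℕ × ℕ, ∀ x, f x ∈ U → (∀ᶠ x' in 𝓝 x, i x' = i x) ∧ dist (d (i x)) (g x) ≤ α x ∧
    ∀ x', f x' = f x → i x' = i x → dist x' x < ε

theorem aux_fiber_label {X Y : Type*} [MetricSpace X] [TopologicalSpace Y] (f : X → Y)
    (hfdim : DimMapLE f 0) (y : Y) {ι : Type*} [Finite ι] (B : ι → Set X)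
    (hBo : ∀ i, IsOpen (B i)) (hB : f ⁻¹' {y} ⊆ ⋃ i, B i) :
    ∃ σ : (f ⁻¹' {y} : Set X) → ι, IsLocallyConstant σ ∧ ∀ x, x.1 ∈ B (σ x) := by
  rcases hfdim y with he | ⟨k, hk, hK⟩
  · exact ⟨fun x => he.elim x, IsLocallyConstant.of_constant _ (fun x => he.elim x),
      fun x => he.elim x⟩
  · obtain rfl : k = 0 := by omega
    classical
    obtain ⟨V, hVo, hVB, hVc, hVord⟩ := aux_dim_finite hK (fun i => Subtype.val ⁻¹' (B i))
      (fun i => (hBo i).preimage continuous_subtype_val)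
      (fun x => by
        obtain ⟨i, hi⟩ := Set.mem_iUnion.1 (hB x.2)
        exact ⟨i, hi⟩)
    choose σ hσ using hVc
    have huniq : ∀ x i j, x ∈ V i → x ∈ V j → i = j := by
      intro x i j hi hj
      by_contra hne
      have := hVord x {i, j} (by simp [hi, hj])
      rw [Finset.card_pair hne] at this
      omega
    refine ⟨σ, (IsLocallyConstant.iff_eventually_eq σ).2 fun x => ?_, fun x => hVB _ (hσ x)⟩
    filter_upwards [(hVo (σ x)).mem_nhds (hσ x)] with z hz
    exact huniq z _ _ (hσ z) hz

theorem aux_local {X Y E : Type*} [MetricSpace X] [TopologicalSpace Y] [T1Space Y]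
    [PseudoMetricSpace E]
    (f : X → Y) (hf : IsPerfectMap f) (hfdim : DimMapLE f 0) (g : X → E) (hg : Continuous g)
    (α : X → ℝ) (hα : Continuous α) (hα0 : ∀ x, 0 < α x) (ε : ℝ) (hε : 0 < ε) (d : ℕ × ℕ → E)
    (hd : ∀ n, ∀ v : E, ∀ δ > 0, ∃ k, dist (d (n, k)) v < δ) (y : Y) :
    ∃ U, IsOpen U ∧ y ∈ U ∧ AuxGood f g α ε d U := by
  classical
  obtain ⟨hfc, hfcl, hfK⟩ := hf
  let B : X → Set X := fun x => {z | dist z x < ε / 2 ∧ dist (g z) (g x) < α x / 4 ∧ α x / 2 < α z}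
  have hBo : ∀ x, IsOpen (B x) := fun x => by
    have h1 : IsOpen {z | dist z x < ε / 2} := isOpen_lt (by fun_prop) (by fun_prop)
    have h2 : IsOpen {z | dist (g z) (g x) < α x / 4} := isOpen_lt (by fun_prop) (by fun_prop)
    have h3 : IsOpen {z | α x / 2 < α z} := isOpen_lt (by fun_prop) (by fun_prop)
    exact h1.inter (h2.inter h3)
  have hBx : ∀ x, x ∈ B x := fun x => by
    have := hα0 x
    refine ⟨?_, ?_, ?_⟩ <;> simp <;> linarith
  obtain ⟨t, -, ht⟩ := (hfK y).elim_nhds_subcover B (fun x _ => (hBo x).mem_nhds (hBx x))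
  obtain ⟨σ, hσ, hσB⟩ := aux_fiber_label f hfdim y (fun s : t => B s) (fun s => hBo _) (by
    intro x hx
    obtain ⟨s, hs, hxs⟩ := Set.mem_iUnion₂.1 (ht hx)
    exact Set.mem_iUnion.2 ⟨⟨s, hs⟩, hxs⟩)
  obtain ⟨ν, hν⟩ := Countable.exists_injective_nat t
  have hKc : IsClosed (f ⁻¹' {y}) := isClosed_singleton.preimage hfc
  let φ : C((f ⁻¹' {y} : Set X), ℝ) :=
    ⟨fun x => (ν (σ x) : ℝ), (hσ.comp (fun s => (ν s : ℝ))).continuous⟩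
  obtain ⟨J, hJ⟩ := φ.exists_restrict_eq hKc
  have hJ' : ∀ x : (f ⁻¹' {y} : Set X), J x = ν (σ x) := fun x => by
    have := DFunLike.congr_fun hJ x
    simpa [φ] using this
  let O : t → Set X := fun s => J ⁻¹' (Metric.ball (ν s : ℝ) (1 / 2)) ∩ B s
  have hOo : ∀ s, IsOpen (O s) := fun s =>
    (Metric.isOpen_ball.preimage J.continuous).inter (hBo _)
  have hOd : ∀ s s' x, x ∈ O s → x ∈ O s' → s = s' := by
    intro s s' x hx hx'
    apply hν
    have h1 : dist (J x) (ν s : ℝ) < 1 / 2 := hx.1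
    have h2 : dist (J x) (ν s' : ℝ) < 1 / 2 := hx'.1
    have h3 : dist (ν s : ℝ) (ν s' : ℝ) < 1 := by
      have := dist_triangle_left (ν s : ℝ) (ν s' : ℝ) (J x)
      linarith
    rw [Real.dist_eq] at h3
    have h4 : |(ν s : ℤ) - (ν s' : ℤ)| < 1 := by exact_mod_cast h3
    have := Int.abs_lt_one_iff.1 h4
    omega
  choose k hk using fun s : t => hd (ν s) (g s) (α s / 4) (by have := hα0 s; linarith)
  refine ⟨(f '' (⋃ s, O s)ᶜ)ᶜ, (hfcl _ (isOpen_iUnion hOo).isClosed_compl).isOpen_compl, ?_, ?_⟩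
  · rintro ⟨x, hx, hxy⟩
    apply hx
    have hxK : x ∈ f ⁻¹' {y} := hxy
    refine Set.mem_iUnion.2 ⟨σ ⟨x, hxK⟩, ?_, hσB ⟨x, hxK⟩⟩
    show dist _ _ < _
    rw [hJ' ⟨x, hxK⟩]
    simp
  · let i : X → ℕ × ℕ := fun x =>
      if h : ∃ s, x ∈ O s then (ν h.choose, k h.choose) else (0, 0)
    have hi : ∀ x s, x ∈ O s → i x = (ν s, k s) := by
      intro x s hx
      have h : ∃ s, x ∈ O s := ⟨s, hx⟩
      have h2 : h.choose = s := hOd _ _ x h.choose_spec hx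
      simp only [i, dif_pos h, h2]
    have hO : ∀ x, f x ∈ (f '' (⋃ s, O s)ᶜ)ᶜ → ∃ s, x ∈ O s := by
      intro x hx
      by_contra hcon
      apply hx
      exact ⟨x, fun h => hcon (Set.mem_iUnion.1 h), rfl⟩
    refine ⟨i, fun x hx => ?_⟩
    obtain ⟨s, hs⟩ := hO x hx
    refine ⟨?_, ?_, ?_⟩
    · filter_upwards [(hOo s).mem_nhds hs] with z hz
      rw [hi z s hz, hi x s hs]
    · rw [hi x s hs]
      have h1 := hk s
      obtain ⟨-, h2, h3⟩ := hs.2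
      have := dist_triangle_right (d (ν s, k s)) (g x) (g s)
      linarith
    · intro x' hfx hix
      obtain ⟨s', hs'⟩ := hO x' (by rw [hfx]; exact hx)
      rw [hi x s hs, hi x' s' hs', Prod.mk.injEq] at hix
      obtain rfl := hν hix.1
      have h1 := hs.2.1
      have h2 := hs'.2.1
      have := dist_triangle_right x' x s'
      linarith

/-- Maps for which no `l + 1` points that are `ε`-apart lie in one fibre of `f × h`. -/
def AuxU {X Y E : Type*} [MetricSpace X] [PseudoMetricSpace E] (f : X → Y) (l : ℕ)
    (ε : ℝ) : Set (X →ᵇ E) :=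
  {h | ∀ s : Fin (l + 1) → X, (∀ a, f (s a) = f (s 0)) → (∀ a, h (s a) = h (s 0)) →
    ∃ a b, a ≠ b ∧ dist (s a) (s b) < ε}

theorem aux_dense {X : Type*} {Y : Type u} [MetricSpace X] [TopologicalSpace Y] [T1Space Y]
    [NormalSpace Y] [ParacompactSpace Y] (m p l : ℕ) (hml : m + 1 ≤ l * p)
    (hY : CovDimLENat Y m)
    (f : X → Y) (hf : IsPerfectMap f) (hfdim : DimMapLE f 0)
    (g : X →ᵇ EuclideanSpace ℝ (Fin p))
    (α : X → ℝ) (hα : Continuous α) (hα0 : ∀ x, 0 < α x) (ε : ℝ) (hε : 0 < ε) :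
    ∃ h ∈ AuxU (E := EuclideanSpace ℝ (Fin p)) f l ε, ∀ x, dist (h x) (g x) ≤ α x := by
  classical
  wlog hα1 : ∀ x, α x ≤ 1 generalizing α
  · obtain ⟨h, hh, hh'⟩ := this (fun x => min (α x) 1) (hα.min continuous_const)
      (fun x => lt_min (hα0 x) one_pos) (fun x => min_le_right _ _)
    exact ⟨h, hh, fun x => (hh' x).trans (min_le_left _ _)⟩
  obtain ⟨d, hd, hgen⟩ := aux_generic m p l hml
  have hfc := hf.1
  obtain ⟨G, hGo, hGg, hGc⟩ := aux_good_cover hY (fun U => ∀ c, AuxGood f g α ε (d c) U)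
    (by
      intro U V hV _ hUV c
      obtain ⟨i, hi⟩ := hV c
      exact ⟨i, fun x hx => hi x (hUV hx)⟩)
    (by
      intro κ U hUo hUg hUd c
      choose i hi using fun j => hUg j c
      let i' : X → ℕ × ℕ := fun x => if h : ∃ j, f x ∈ U j then i h.choose x else (0, 0)
      have hi' : ∀ x j, f x ∈ U j → i' x = i j x := by
        intro x j hx
        have h : ∃ j, f x ∈ U j := ⟨j, hx⟩
        have h2 : h.choose = j := hUd _ _ _ h.choose_spec hx
        simp only [i', dif_pos h, h2]
      refine ⟨i', fun x hx => ?_⟩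
      obtain ⟨j, hj⟩ := Set.mem_iUnion.1 hx
      obtain ⟨h1, h2, h3⟩ := hi j x hj
      refine ⟨?_, ?_, ?_⟩
      · filter_upwards [h1, ((hUo j).preimage hfc).mem_nhds hj] with z hz hzU
        rw [hi' x j hj, hi' z j hzU, hz]
      · rwa [hi' x j hj]
      · intro x' hfx hix
        rw [hi' x j hj, hi' x' j (by rw [hfx]; exact hj)] at hix
        exact h3 x' hfx hix)
    (by
      intro y
      choose U hUo hUy hUg using fun c =>
        aux_local f hf hfdim g g.continuous α hα hα0 ε hε (d c) (hd c) y
      refine ⟨⋂ c, U c, isOpen_iInter_of_finite hUo, Set.mem_iInter.2 hUy, fun c => ?_⟩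
      obtain ⟨i, hi⟩ := hUg c
      exact ⟨i, fun x hx => hi x (Set.mem_iInter.1 hx c)⟩)
  obtain ⟨μ, hμ⟩ := PartitionOfUnity.exists_isSubordinate isClosed_univ G hGo
    (fun y _ => Set.mem_iUnion.2 (hGc y))
  have hμG : ∀ c y, μ c y ≠ 0 → y ∈ G c := fun c y h =>
    hμ c (subset_tsupport _ (Function.mem_support.2 h))
  choose i hi using fun c => hGg c c
  let h0 : X → EuclideanSpace ℝ (Fin p) := fun x => ∑ c, μ c (f x) • d c (i c x)
  have hh0 : Continuous h0 := by
    refine continuous_finsetSum _ fun c _ => ?_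
    rw [continuous_iff_continuousAt]
    intro x
    by_cases hx : f x ∈ G c
    · have h1 : ContinuousAt (fun z => d c (i c z)) x := by
        refine (continuousAt_const (y := d c (i c x))).congr ?_
        filter_upwards [(hi c x hx).1] with z hz
        rw [hz]
      exact ((μ c).continuous.comp hfc).continuousAt.smul h1
    · have h1 : f x ∉ tsupport (μ c) := fun h => hx (hμ c h)
      refine (continuousAt_const (y := (0 : EuclideanSpace ℝ (Fin p)))).congr ?_
      filter_upwards [((isClosed_tsupport (μ c)).isOpen_compl.preimage hfc).mem_nhds h1] with z hz
      rw [image_eq_zero_of_notMem_tsupport hz, zero_smul]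
  have hdist : ∀ x, dist (h0 x) (g x) ≤ α x := by
    intro x
    have h1 := (convex_closedBall (g x) (α x)).finsum_mem (w := fun c => μ c (f x))
      (z := fun c => d c (i c x)) (fun c => μ.nonneg c _) (μ.sum_eq_one (Set.mem_univ _))
      (fun c hc => Metric.mem_closedBall.2 (hi c x (hμG c _ hc)).2.1)
    rw [finsum_eq_sum_of_fintype] at h1
    exact Metric.mem_closedBall.1 h1
  refine ⟨BoundedContinuousFunction.ofNormedAddCommGroup h0 hh0 (1 + ‖g‖) ?_, ?_, hdist⟩
  · intro x
    have h1 := (hdist x).trans (hα1 x)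
    rw [dist_eq_norm] at h1
    have h2 := g.norm_coe_le_norm x
    have h3 := norm_add_le (h0 x - g x) (g x)
    rw [sub_add_cancel] at h3
    linarith
  · intro s hsf hsh
    by_contra hcon
    push Not at hcon
    have hfin := hgen
      (fun c a => if μ c (f (s 0)) = 0 then ((a : ℕ), 0) else i c (s a))
      (by
        intro c a b hab
        by_cases h : μ c (f (s 0)) = 0
        · simp only [h, if_true, Prod.mk.injEq, and_true] at hab
          exact Fin.ext hab
        · simp only [h, if_false] at hab
          by_contra hne
          have h1 : f (s b) ∈ G c := by rw [hsf b]; exact hμG c _ h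
          have h2 := (hi c (s b) h1).2.2 (s a) (by rw [hsf a, hsf b]) hab
          exact absurd h2 (not_lt.2 (hcon a b hne)))
      (fun c => μ c (f (s 0)))
      (by
        have key : ∀ a : Fin (l + 1), ∑ c, μ c (f (s 0)) •
            d c (if μ c (f (s 0)) = 0 then ((a : ℕ), 0) else i c (s a)) = h0 (s a) := by
          intro a
          refine Finset.sum_congr rfl fun c _ => ?_
          rw [hsf a]
          split_ifs with h
          · rw [h, zero_smul, zero_smul]
          · rfl
        intro a
        rw [key a, key 0]
        exact hsh a)
    have h1 := μ.sum_eq_one (Set.mem_univ (f (s 0)))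
    have h2 : ∀ c, μ c (f (s 0)) = 0 := fun c => congrFun hfin c
    simp [h2] at h1

theorem aux_open {X Y E : Type*} [MetricSpace X] [TopologicalSpace Y] [T2Space Y]
    [NormalSpace Y] [ParacompactSpace Y] [MetricSpace E] (l : ℕ)
    (f : X → Y) (hf : IsPerfectMap f) (ε : ℝ)
    (g : X →ᵇ E) (hg : g ∈ AuxU (E := E) f l ε) :
    ∃ α : X → ℝ, Continuous α ∧ (∀ x, 0 < α x) ∧
      ∀ h : X →ᵇ E, (∀ x, dist (h x) (g x) ≤ α x) → h ∈ AuxU (E := E) f l ε := by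
  have hprop : IsProperMap f := isProperMap_iff_isClosedMap_and_compact_fibers.2 hf
  have hpi : IsProperMap (fun (s : Fin (l + 1) → X) a => f (s a)) :=
    IsProperMap.pi_map (fun _ => hprop)
  let ψ : (Fin (l + 1) → X) → ℝ := fun s => dist (fun a => g (s a)) (fun _ => g (s 0))
  have hψ : Continuous ψ := by
    have := g.continuous
    fun_prop
  let Q : Set (Fin (l + 1) → X) := {s | ∀ a b, a ≠ b → ε ≤ dist (s a) (s b)}
  have hQ : IsClosed Q := by
    simp only [Q, Set.ofPred_forall]
    refine isClosed_iInter fun a => isClosed_iInter fun b => isClosed_iInter fun _ => ?_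
    exact isClosed_le (by fun_prop) (by fun_prop)
  obtain ⟨η, hη⟩ := exists_continuous_forall_mem_convex_of_local_const (X := Y) (E := ℝ)
    (t := fun y => {η : ℝ | 0 < η ∧ ∀ s ∈ Q, (∀ a, f (s a) = y) → η < ψ s})
    (by
      intro y a ha b hb s t hs ht hst
      have hle : s • a + t • b ≤ max a b := by
        have h1 := le_max_left a b
        have h2 := le_max_right a b
        simp only [smul_eq_mul]
        have : s = 1 - t := by linarith
        subst this
        nlinarith
      refine ⟨?_, fun x hx hxy => hle.trans_lt (max_lt (ha.2 x hx hxy) (hb.2 x hx hxy))⟩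
      have h1 : min a b ≤ s • a + t • b := by
        have h1 := min_le_left a b
        have h2 := min_le_right a b
        simp only [smul_eq_mul]
        have : s = 1 - t := by linarith
        subst this
        nlinarith
      exact (lt_min ha.1 hb.1).trans_le h1)
    (by
      intro y
      let K : Set (Fin (l + 1) → X) := (fun (s : Fin (l + 1) → X) a => f (s a)) ⁻¹' {fun _ => y} ∩ Q
      have hK : IsCompact K := (hpi.isCompact_preimage isCompact_singleton).inter_right hQ
      have hpos : ∀ s ∈ K, 0 < ψ s := by
        intro s hs
        have hsy : ∀ a, f (s a) = y := fun a => congrFun hs.1 a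
        refine dist_pos.2 fun heq => ?_
        obtain ⟨a, b, hab, hlt⟩ := hg s (fun a => by rw [hsy, hsy]) (fun a => congrFun heq a)
        exact absurd hlt (not_lt.2 (hs.2 a b hab))
      obtain ⟨η, hη0, hη⟩ : ∃ η > 0, ∀ s ∈ K, η < ψ s := by
        rcases K.eq_empty_or_nonempty with he | hne
        · exact ⟨1, one_pos, by simp [he]⟩
        · obtain ⟨s0, hs0, hmin⟩ := hK.exists_isMinOn hne hψ.continuousOn
          have := hpos s0 hs0
          refine ⟨ψ s0 / 2, by linarith, fun s hs => ?_⟩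
          have h2 : ψ s0 ≤ ψ s := hmin hs
          linarith
      refine ⟨η, ?_⟩
      have hC : IsClosed ((fun (s : Fin (l + 1) → X) a => f (s a)) '' (Q ∩ {s | ψ s ≤ η})) :=
        hpi.isClosedMap _ (hQ.inter (isClosed_le hψ continuous_const))
      have hdiag : Continuous (fun (y' : Y) (_ : Fin (l + 1)) => y') := by fun_prop
      have hmem := (hC.isOpen_compl.preimage hdiag).mem_nhds (x := y) (by
        rintro ⟨s, ⟨hsQ, hsη⟩, hsy⟩
        exact absurd (hη s ⟨hsy, hsQ⟩) (not_lt.2 hsη))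
      filter_upwards [hmem] with y' hy'
      refine ⟨hη0, fun s hsQ hsy => ?_⟩
      by_contra hcon
      exact hy' ⟨s, ⟨hsQ, not_lt.1 hcon⟩, funext hsy⟩)
  refine ⟨fun x => η (f x) / 2, (η.continuous.comp hf.1).div_const 2,
    fun x => half_pos (hη (f x)).1, fun h hh s hsf hsh => ?_⟩
  by_contra hcon
  push Not at hcon
  have h1 := (hη (f (s 0))).2 s hcon hsf
  refine absurd h1 (not_lt.2 ?_)
  refine (dist_pi_le_iff (hη (f (s 0))).1.le).2 fun a => ?_
  have h2 : dist (h (s a)) (g (s a)) ≤ η (f (s a)) / 2 := hh (s a)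
  have h3 : dist (h (s 0)) (g (s 0)) ≤ η (f (s 0)) / 2 := hh (s 0)
  rw [hsf a, hsh a] at h2
  have := dist_triangle_left (g (s a)) (g (s 0)) (h (s 0))
  linarith

theorem aux_baire {X E : Type*} [TopologicalSpace X] [MetricSpace E] [CompleteSpace E]
    (U : ℕ → Set (X →ᵇ E))
    (hUo : ∀ n, ∀ g ∈ U n, ∃ α : X → ℝ, Continuous α ∧ (∀ x, 0 < α x) ∧
      ∀ h : X →ᵇ E, (∀ x, dist (h x) (g x) ≤ α x) → h ∈ U n)
    (hUd : ∀ n (g : X →ᵇ E) (α : X → ℝ), Continuous α → (∀ x, 0 < α x) →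
      ∃ h ∈ U n, ∀ x, dist (h x) (g x) ≤ α x)
    (g : X →ᵇ E) (α : X → ℝ) (hα : Continuous α) (hα0 : ∀ x, 0 < α x) :
    ∃ h : X →ᵇ E, (∀ n, h ∈ U n) ∧ ∀ x, dist (h x) (g x) ≤ α x := by
  let T := {q : (X →ᵇ E) × (X → ℝ) // Continuous q.2 ∧ ∀ x, 0 < q.2 x}
  have step : ∀ (n : ℕ) (q : T), ∃ q' : T, (∀ x, dist (q'.1.1 x) (q.1.1 x) ≤ q.1.2 x / 2) ∧
      (∀ x, q'.1.2 x ≤ q.1.2 x / 2) ∧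
      ∀ h : X →ᵇ E, (∀ x, dist (h x) (q'.1.1 x) ≤ q'.1.2 x) → h ∈ U n := by
    rintro n ⟨⟨g, α⟩, hα, hα0⟩
    obtain ⟨h, hhU, hh⟩ := hUd n g (fun x => α x / 2) (hα.div_const 2) (fun x => half_pos (hα0 x))
    obtain ⟨β, hβ, hβ0, hβU⟩ := hUo n h hhU
    refine ⟨⟨(h, fun x => min (β x) (α x / 2)), hβ.min (hα.div_const 2),
      fun x => lt_min (hβ0 x) (half_pos (hα0 x))⟩, hh, fun x => min_le_right _ _, ?_⟩
    intro k hk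
    exact hβU k fun x => (hk x).trans (min_le_left _ _)
  choose S hS1 hS2 hS3 using step
  let q0 : T := ⟨(g, fun x => min (α x) 1), hα.min continuous_const,
    fun x => lt_min (hα0 x) one_pos⟩
  let F : ℕ → T := fun n => Nat.rec q0 (fun n q => S n q) n
  have hF : ∀ n, F (n + 1) = S n (F n) := fun n => rfl
  have hpos : ∀ n x, 0 < (F n).1.2 x := fun n => (F n).2.2
  have hle1 : ∀ n x, (F n).1.2 x ≤ (1 / 2) ^ n := by
    intro n x
    induction n with
    | zero => rw [pow_zero]; exact min_le_right (α x) 1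
    | succ n ih =>
      have := hS2 n (F n) x
      rw [hF, pow_succ]
      linarith
  have hdist : ∀ n k x, dist ((F (n + k)).1.1 x) ((F n).1.1 x) ≤ (F n).1.2 x - (F (n + k)).1.2 x := by
    intro n k x
    induction k with
    | zero => simp
    | succ k ih =>
      have h1 := hS1 (n + k) (F (n + k)) x
      have h2 := hS2 (n + k) (F (n + k)) x
      rw [← hF] at h1 h2
      have h3 := dist_triangle ((F (n + k + 1)).1.1 x) ((F (n + k)).1.1 x) ((F n).1.1 x)
      rw [← add_assoc]
      linarith
  have hcau : CauchySeq (fun n => (F n).1.1) := by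
    refine cauchySeq_of_le_geometric (1 / 2) 1 (by norm_num) fun n => ?_
    rw [one_mul, dist_comm]
    refine (BoundedContinuousFunction.dist_le (by positivity)).2 fun x => ?_
    have h1 := hdist n 1 x
    have h2 := hle1 n x
    have h3 := hpos (n + 1) x
    linarith
  obtain ⟨h, hh⟩ := cauchySeq_tendsto_of_complete hcau
  have hlim : ∀ x, Filter.Tendsto (fun n => (F n).1.1 x) Filter.atTop (𝓝 (h x)) := fun x =>
    ((BoundedContinuousFunction.tendsto_iff_tendstoUniformly.1 hh).tendsto_at x)
  have hball : ∀ n x, dist (h x) ((F n).1.1 x) ≤ (F n).1.2 x := by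
    intro n x
    refine le_of_tendsto ((hlim x).dist tendsto_const_nhds) ?_
    filter_upwards [Filter.eventually_ge_atTop n] with j hj
    obtain ⟨k, rfl⟩ := Nat.exists_eq_add_of_le hj
    have h1 := hdist n k x
    have h2 := hpos (n + k) x
    linarith
  refine ⟨h, fun n => ?_, fun x => (hball 0 x).trans (min_le_left _ _)⟩
  exact hS3 n (F n) h (hball (n + 1))

/-- For a perfect 0-dimensional surjective map `f : X → Y` with
`dim Y = m` and `p ≥ 1`, the maps `g` such that `f × g` is at most `l`-to-one, where
`l = ⌊m/p⌋ + 1`, contain a dense `G_δ`-subset of `C*(X, ℝ^p)` (source limitation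
topology). -/
theorem statement13 {X Y : Type*} [TopologicalSpace X] [TopologicalSpace.MetrizableSpace X]
    [TopologicalSpace Y] [TopologicalSpace.MetrizableSpace Y]
    (m p : ℕ) (hp : 1 ≤ p) (f : X → Y) (hf : IsPerfectMap f)
    (hfsurj : Function.Surjective f) (hfdim : DimMapLE f 0)
    (hdimY : CovDimLE Y m) (hdimY' : ¬ CovDimLE Y ((m : ℤ) - 1)) :
    ∃ G : Set (X →ᵇ EuclideanSpace ℝ (Fin p)),
      @Dense _ (sourceLimitation X (EuclideanSpace ℝ (Fin p))) G ∧
      @IsGδ _ (sourceLimitation X (EuclideanSpace ℝ (Fin p))) G ∧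
      ∀ g ∈ G, ∀ z : Y × EuclideanSpace ℝ (Fin p),
        ∀ S : Finset X, (∀ x ∈ S, (f x, g x) = z) → S.card ≤ m / p + 1 := by
  classical
  letI : MetricSpace X := TopologicalSpace.metrizableSpaceMetric X
  letI : MetricSpace Y := TopologicalSpace.metrizableSpaceMetric Y
  have hY : CovDimLENat Y m := by
    rcases hdimY with he | ⟨k, hk, hY⟩
    · exact absurd (Or.inl he) hdimY'
    · intro 𝒰 h1 h2 h3
      obtain ⟨𝒱, a, b, c, e⟩ := hY 𝒰 h1 h2 h3
      exact ⟨𝒱, a, b, c, fun x => ⟨(e x).1, (e x).2.trans (by omega)⟩⟩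
  have hml : m + 1 ≤ (m / p + 1) * p := by
    have h1 := Nat.div_add_mod m p
    have h2 := Nat.mod_lt m (by omega : 0 < p)
    nlinarith
  let U : ℕ → Set (X →ᵇ EuclideanSpace ℝ (Fin p)) := fun n =>
    AuxU f (m / p + 1) (1 / ((n : ℝ) + 1))
  have hUo : ∀ n, ∀ g ∈ U n, ∃ α : X → ℝ, Continuous α ∧ (∀ x, 0 < α x) ∧
      ∀ h : X →ᵇ EuclideanSpace ℝ (Fin p), (∀ x, dist (h x) (g x) ≤ α x) → h ∈ U n :=
    fun n g hg => aux_open (m / p + 1) f hf _ g hg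
  refine ⟨⋂ n, U n, ?_, ?_, ?_⟩
  · rw [@dense_iff_inter_open _ (sourceLimitation X (EuclideanSpace ℝ (Fin p)))]
    rintro W hW ⟨g, hg⟩
    obtain ⟨α, hα, hα0, hαW⟩ := hW g hg
    obtain ⟨h, hhU, hh⟩ := aux_baire U hUo
      (fun n g α hα hα0 => aux_dense m p (m / p + 1) hml hY f hf hfdim g α hα hα0 _
        (by positivity)) g α hα hα0
    exact ⟨h, hαW h hh, Set.mem_iInter.2 hhU⟩
  · exact @IsGδ.iInter_of_isOpen _ _ (sourceLimitation X (EuclideanSpace ℝ (Fin p))) _ U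
      (fun n => hUo n)
  · intro g hg z S hS
    by_contra hcon
    push Not at hcon
    obtain ⟨e⟩ : Nonempty (Fin (m / p + 1 + 1) ↪ S) :=
      Function.Embedding.nonempty_of_card_le (by simpa using hcon)
    let s : Fin (m / p + 1 + 1) → X := fun a => (e a).1
    have hs : Function.Injective s := Subtype.val_injective.comp e.injective
    have hε : ∃ δ > 0, ∀ a b, a ≠ b → δ ≤ dist (s a) (s b) := by
      have hfin : (Set.range fun ab : {ab : Fin (m / p + 1 + 1) × Fin (m / p + 1 + 1) //
          ab.1 ≠ ab.2} => dist (s ab.1.1) (s ab.1.2)).Finite := Set.finite_range _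
      have hne : (Set.range fun ab : {ab : Fin (m / p + 1 + 1) × Fin (m / p + 1 + 1) //
          ab.1 ≠ ab.2} => dist (s ab.1.1) (s ab.1.2)).Nonempty :=
        ⟨_, ⟨⟨(0, 1), by simp⟩, rfl⟩⟩
      obtain ⟨δ, ⟨⟨ab, hab⟩, rfl⟩, hmin⟩ := Set.exists_min_image _ id hfin hne
      refine ⟨_, dist_pos.2 (fun h => hab (hs h)), fun a b hne => ?_⟩
      exact hmin _ ⟨⟨(a, b), hne⟩, rfl⟩
    obtain ⟨δ, hδ, hδs⟩ := hε
    obtain ⟨n, hn⟩ := exists_nat_one_div_lt hδ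
    have hz : ∀ a, (f (s a), g (s a)) = z := fun a => hS _ (e a).2
    obtain ⟨a, b, hab, hlt⟩ := Set.mem_iInter.1 hg n s
      (fun a => by have h1 := hz a; have h2 := hz 0; rw [← h2] at h1; exact (Prod.ext_iff.1 h1).1)
      (fun a => by have h1 := hz a; have h2 := hz 0; rw [← h2] at h1; exact (Prod.ext_iff.1 h1).2)
    exact absurd (hδs a b hab) (not_le.2 (hlt.trans hn))
end

section
/- Let f : X → Y be a perfect map between finite-dimensional metrizable spaces with dim f ≤ k and dim Y ≤ m, and let p ≥ 2k + m + 1. Then C*(X, ℝ^p), endowed with the source limitation topology, contains a dense G_δ-subset G such that for every g ∈ G the map f×g : X → Y × ℝ^p is injective, and hence an embedding. -/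
open Set Topology Metric BoundedContinuousFunction

theorem gen_pos {E P ι : Type*} [NormedAddCommGroup E] [NormedSpace ℝ E] [FiniteDimensional ℝ E]
    [NormedAddCommGroup P] [NormedSpace ℝ P] [FiniteDimensional ℝ P] [DecidableEq ι]
    (w : ι → E → P) (hw : ∀ i, ContDiff ℝ 1 (w i)) (r : ℕ)
    (hP : 1 ≤ Module.finrank ℝ P)
    (hr : r + Module.finrank ℝ E ≤ Module.finrank ℝ P + 1) (δ : ℝ) (hδ : 0 < δ) (B : Finset ι) :
    ∃ v : ι → P, (∀ i, ‖v i‖ < δ) ∧ ∀ (τ : E) (c : ι → ℝ), (∀ i, i ∉ B → c i = 0) →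
      (B.filter (fun i => c i ≠ 0)).card ≤ r → ∑ i ∈ B, c i = 0 →
      ∑ i ∈ B, c i • (w i τ + v i) = 0 → ∀ i, c i = 0 := by
  induction B using Finset.induction_on with
  | empty => exact ⟨fun _ => 0, by simp [hδ], fun τ c h _ _ _ i => h i (by simp)⟩
  | insert b0 B hb0 ih =>
    obtain ⟨v, hv, hvB⟩ := ih
    let F : (ι × Finset ι) → Set P := fun q =>
      range (fun z : E × (q.2 → ℝ) => (w q.1 z.1 + v q.1) +
        ∑ b : q.2, z.2 b • ((w b z.1 + v b) - (w q.1 z.1 + v q.1)) - w b0 z.1)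
    let I : Set (ι × Finset ι) := {q | q ∈ B ×ˢ B.powerset ∧ q.2.card + 2 ≤ r}
    have hI : I.Countable := by
      refine Set.Countable.mono (fun q hq => ?_) (B ×ˢ B.powerset).countable_toSet
      exact hq.1
    have hdim : dimH (⋃ q ∈ I, F q) < (Module.finrank ℝ P : ENNReal) := by
      rw [dimH_bUnion hI]
      have h1 : ((Module.finrank ℝ P - 1 : ℕ) : ENNReal) < (Module.finrank ℝ P : ENNReal) := by
        exact_mod_cast (by omega : Module.finrank ℝ P - 1 < Module.finrank ℝ P)
      refine lt_of_le_of_lt (iSup₂_le fun q hq => ?_) h1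
      have hcd : ContDiff ℝ 1 (fun z : E × (q.2 → ℝ) => (w q.1 z.1 + v q.1) +
        ∑ b : q.2, z.2 b • ((w b z.1 + v b) - (w q.1 z.1 + v q.1)) - w b0 z.1) := by
        have h2 : ∀ i, ContDiff ℝ 1 (fun z : E × (q.2 → ℝ) => w i z.1) := fun i =>
          (hw i).comp contDiff_fst
        have h3 : ∀ b : q.2, ContDiff ℝ 1 (fun z : E × (q.2 → ℝ) => z.2 b) := fun b =>
          (contDiff_apply ℝ ℝ b).comp contDiff_snd
        refine ((h2 _).add contDiff_const |>.add (ContDiff.sum fun b _ => ?_)).sub (h2 _)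
        exact (h3 b).smul (((h2 _).add contDiff_const).sub ((h2 _).add contDiff_const))
      refine hcd.dimH_range_le.trans ?_
      have := hq.2
      rw [Module.finrank_prod, Module.finrank_fintype_fun_eq_card, Fintype.card_coe]
      exact_mod_cast (by omega)
    obtain ⟨v0, hv0, hv0'⟩ := Metric.dense_iff.1 (dense_compl_of_dimH_lt_finrank hdim) 0 δ hδ
    refine ⟨Function.update v b0 v0, ?_, ?_⟩
    · intro i
      by_cases h : i = b0
      · subst h; simpa using hv0
      · simpa [Function.update_of_ne h] using hv i
    · intro τ c hc hcard hsum hlin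
      have hup : ∀ b ∈ B, Function.update v b0 v0 b = v b := fun b hb =>
        Function.update_of_ne (fun h : b = b0 => hb0 (h ▸ hb)) _ _
      rw [Finset.sum_insert hb0] at hsum hlin
      rw [Function.update_self] at hlin
      have hlin' : ∑ i ∈ B, c i • (w i τ + Function.update v b0 v0 i) =
          ∑ i ∈ B, c i • (w i τ + v i) :=
        Finset.sum_congr rfl fun i hi => by rw [hup i hi]
      rw [hlin'] at hlin
      by_cases h0 : c b0 = 0
      · refine hvB τ c (fun i hi => ?_) ?_ (by simpa [h0] using hsum) (by simpa [h0] using hlin)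
        · by_cases h : i = b0
          · rw [h, h0]
          · exact hc i (by simp [h, hi])
        · exact (Finset.card_le_card (Finset.filter_subset_filter _ (Finset.subset_insert _ _))).trans
            hcard
      · exfalso
        rw [Finset.filter_insert, if_pos h0, Finset.card_insert_of_notMem (by simp [hb0])] at hcard
        set S := B.filter (fun i => c i ≠ 0) with hS
        have e1 : ∑ i ∈ B, c i = ∑ i ∈ S, c i := by
          rw [hS, Finset.sum_filter_ne_zero]
        have e2 : ∑ i ∈ B, c i • (w i τ + v i) = ∑ i ∈ S, c i • (w i τ + v i) := by
          rw [hS, Finset.sum_filter]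
          refine Finset.sum_congr rfl fun i _ => ?_
          split_ifs with h
          · rfl
          · push Not at h; simp [h]
        have hne : S.Nonempty := by
          rw [Finset.nonempty_iff_ne_empty]
          intro h
          rw [e1, h] at hsum
          simp at hsum
          exact h0 hsum
        obtain ⟨b1, hb1⟩ := hne
        rw [e1, ← Finset.add_sum_erase S _ hb1] at hsum
        rw [e2, ← Finset.add_sum_erase S _ hb1] at hlin
        have hcardS := Finset.card_erase_of_mem hb1
        have hpos : 0 < S.card := Finset.card_pos.2 ⟨b1, hb1⟩
        refine hv0' (Set.mem_biUnion (x := (b1, S.erase b1)) ?_ ?_)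
        · refine ⟨?_, ?_⟩
          · simp only [Finset.mem_product, Finset.mem_powerset]
            exact ⟨(Finset.mem_filter.1 hb1).1, (Finset.erase_subset _ _).trans
              (Finset.filter_subset _ _)⟩
          · simp only [hcardS]; omega
        · refine ⟨(τ, fun b => -(c b / c b0)), ?_⟩
          simp only
          rw [Finset.sum_coe_sort (S.erase b1)
            (fun b => (-(c b / c b0)) • ((w b τ + v b) - (w b1 τ + v b1)))]
          have : c b0 • ((w b1 τ + v b1) + ∑ b ∈ S.erase b1, (-(c b / c b0)) •
              ((w b τ + v b) - (w b1 τ + v b1)) - w b0 τ) = c b0 • v0 := by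
            rw [smul_sub, smul_add, Finset.smul_sum]
            have e3 : ∀ b ∈ S.erase b1, c b0 • (-(c b / c b0)) •
              ((w b τ + v b) - (w b1 τ + v b1)) = c b • (w b1 τ + v b1) - c b • (w b τ + v b) := by
              intro b _
              rw [smul_smul, show c b0 * -(c b / c b0) = - c b by field_simp, smul_sub, neg_smul,
                neg_smul]
              abel
            rw [Finset.sum_congr rfl e3, Finset.sum_sub_distrib, ← Finset.sum_smul]
            have e4 : ∑ i ∈ S.erase b1, c i = - c b0 - c b1 := by linarith
            have e5 : ∑ b ∈ S.erase b1, c b • (w b τ + v b) =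
                - (c b0 • (w b0 τ + v0)) - c b1 • (w b1 τ + v b1) := by
              rw [eq_sub_iff_add_eq, eq_neg_iff_add_eq_zero, ← hlin]; abel
            rw [e4, e5]
            module
          exact smul_right_injective P h0 this

theorem exists_pu {C ι : Type*} [TopologicalSpace C] [NormalSpace C] [Fintype ι]
    (n : ℕ) (hC : CovDimLENat C n) (U : ι → Set C) (hU : ∀ i, IsOpen (U i))
    (hcov : ⋃ i, U i = univ) :
    ∃ ψ : ι → C(C, ℝ), (∀ i x, 0 ≤ ψ i x) ∧ (∀ x, ∑ i, ψ i x = 1) ∧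
      (∀ i x, ψ i x ≠ 0 → x ∈ U i) ∧
      ∀ x, (Finset.univ.filter (fun i => ψ i x ≠ 0)).card ≤ n + 1 := by
  classical
  obtain ⟨𝒱, hVo, hVc, hVr, hVn⟩ := hC (range U) (finite_range U)
    (by rintro _ ⟨i, rfl⟩; exact hU i) (by rw [sUnion_range, hcov])
  have : ∀ V : 𝒱, ∃ i, (V : Set C) ⊆ U i := fun V => by
    obtain ⟨_, ⟨i, rfl⟩, h⟩ := hVr V V.2
    exact ⟨i, h⟩
  choose a ha using this
  let W : ι → Set C := fun i => ⋃ V : {V : 𝒱 // a V = i}, (V.1 : Set C)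
  have hW : ∀ i, IsOpen (W i) := fun i => isOpen_iUnion fun V => hVo _ V.1.2
  have hWU : ∀ i, W i ⊆ U i := fun i => iUnion_subset fun V => by
    have := ha V.1
    rwa [V.2] at this
  have hWc : univ ⊆ ⋃ i, W i := by
    intro x _
    have : x ∈ ⋃₀ 𝒱 := hVc ▸ mem_univ x
    obtain ⟨V, hV, hx⟩ := this
    exact mem_iUnion.2 ⟨a ⟨V, hV⟩, mem_iUnion.2 ⟨⟨⟨V, hV⟩, rfl⟩, hx⟩⟩
  obtain ⟨φ, hφ⟩ := PartitionOfUnity.exists_isSubordinate_of_locallyFinite isClosed_univ W hW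
    (locallyFinite_of_finite W) hWc
  have hφW : ∀ i x, φ i x ≠ 0 → x ∈ W i := fun i x h => hφ i (subset_tsupport _ h)
  refine ⟨fun i => φ i, fun i x => φ.nonneg i x, fun x => ?_, fun i x h => hWU i (hφW i x h), ?_⟩
  · have := φ.sum_eq_one (mem_univ x)
    rwa [finsum_eq_sum_of_fintype] at this
  · intro x
    obtain ⟨hfin, hcard⟩ := hVn x
    refine le_trans ?_ hcard
    have : ∀ i : {i // φ i x ≠ 0}, ∃ V : 𝒱, a V = i ∧ x ∈ (V : Set C) := by
      intro i
      obtain ⟨V, hV⟩ := mem_iUnion.1 (hφW i x i.2)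
      exact ⟨V.1, V.2, hV⟩
    choose b hb hb' using this
    rw [Set.ncard_eq_toFinset_card _ hfin]
    refine Finset.card_le_card_of_injOn
      (fun i => if h : φ i x ≠ 0 then (b ⟨i, h⟩ : Set C) else ∅) ?_ ?_
    · intro i hi
      have hi' : φ i x ≠ 0 := by simpa using hi
      simp only [hi', dif_pos, Finset.mem_coe, Set.Finite.mem_toFinset, ne_eq, not_false_eq_true]
      exact ⟨Subtype.coe_prop _, hb' _⟩
    · intro i hi j hj hij
      have hi' : φ i x ≠ 0 := by simpa using hi
      have hj' : φ j x ≠ 0 := by simpa using hj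
      simp only [hi', hj', dif_pos, ne_eq, not_false_eq_true] at hij
      have := hb ⟨i, hi'⟩
      rw [Subtype.ext hij, hb ⟨j, hj'⟩] at this
      exact this.symm

theorem sigma_disjoint {Y : Type*} [MetricSpace Y] (r : ℝ) (hr : 0 < r) :
    ∃ W : ℕ → Finset Y → Set Y, (∀ l T, IsOpen (W l T)) ∧
      (∀ l T T', T ≠ T' → Disjoint (W l T) (W l T')) ∧
      (∀ l T, W l T = ∅ ∨ ∃ z, W l T ⊆ ball z r) ∧ ∀ y, ∃ l T, y ∈ W l T := by
  classical
  obtain ⟨ρ, hρ⟩ := PartitionOfUnity.exists_isSubordinate (X := Y) (ι := Y) isClosed_univ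
    (fun y => ball y r) (fun y => isOpen_ball) (fun y _ => mem_iUnion.2 ⟨y, mem_ball_self hr⟩)
  let W : ℕ → Finset Y → Set Y := fun l T =>
    {y | (T.card = l ∧ T.Nonempty) ∧ ∀ s ∈ T, 0 < ρ s y ∧ ∀ s', s' ∉ T → ρ s' y < ρ s y}
  refine ⟨W, ?_, ?_, ?_, ?_⟩
  · intro l T
    rw [isOpen_iff_mem_nhds]
    rintro y ⟨h1, h2⟩
    obtain ⟨t, ht, hfin⟩ := ρ.locallyFinite y
    have ev1 : ∀ s ∈ T, ∀ᶠ z in 𝓝 y, 0 < ρ s z := fun s hs =>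
      (ρ s).continuous.continuousAt.eventually (lt_mem_nhds (h2 s hs).1)
    have ev2 : ∀ s ∈ T, ∀ᶠ z in 𝓝 y, ∀ s' ∈ hfin.toFinset, s' ∉ T → ρ s' z < ρ s z := by
      intro s hs
      rw [Filter.eventually_all_finset]
      intro s' _
      by_cases h : s' ∈ T
      · exact Filter.Eventually.of_forall fun z hz => absurd h hz
      · filter_upwards [((ρ s').continuous.continuousAt (x := y)).eventually_lt
          (ρ s).continuous.continuousAt ((h2 s hs).2 s' h)] with z hz _ using hz
    filter_upwards [(Filter.eventually_all_finset T).2 ev1, (Filter.eventually_all_finset T).2 ev2, ht]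
      with z hz1 hz2 hz3
    refine ⟨h1, fun s hs => ⟨hz1 s hs, fun s' hs' => ?_⟩⟩
    by_cases h : s' ∈ hfin.toFinset
    · exact hz2 s hs s' h hs'
    · have : ρ s' z = 0 := by
        by_contra h0
        exact h (by simpa using ⟨z, h0, hz3⟩)
      rw [this]; exact hz1 s hs
  · intro l T T' hne
    rw [Set.disjoint_left]
    rintro y ⟨⟨h1, -⟩, h2⟩ ⟨⟨h3, -⟩, h4⟩
    obtain ⟨s, hs, hs'⟩ : ∃ s ∈ T, s ∉ T' := by
      by_contra h
      push Not at h
      exact hne (Finset.eq_of_subset_of_card_le h (by omega))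
    obtain ⟨t, ht, ht'⟩ : ∃ s ∈ T', s ∉ T := by
      by_contra h
      push Not at h
      exact hne (Finset.eq_of_subset_of_card_le h (by omega)).symm
    exact lt_asymm ((h2 s hs).2 t ht') ((h4 t ht).2 s hs')
  · intro l T
    by_cases hT : T.Nonempty
    · obtain ⟨s, hs⟩ := hT
      refine Or.inr ⟨s, fun y hy => hρ s (subset_tsupport _ ?_)⟩
      exact (hy.2 s hs).1.ne'
    · left
      ext y
      simp only [mem_empty_iff_false, iff_false]
      exact fun h => hT h.1.2
  · intro y
    obtain ⟨s0, hs0⟩ := ρ.exists_pos (mem_univ y)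
    have hfs : ∀ s, s ∈ ρ.finsupport y ↔ ρ s y ≠ 0 := fun s => by
      simp [PartitionOfUnity.mem_finsupport]
    obtain ⟨s1, hs1, hmax⟩ := (ρ.finsupport y).exists_max_image (fun s => ρ s y)
      ⟨s0, (hfs s0).2 hs0.ne'⟩
    have hmax' : ∀ s, ρ s y ≤ ρ s1 y := by
      intro s
      by_cases h : ρ s y = 0
      · rw [h]; exact ρ.nonneg _ _
      · exact hmax s ((hfs s).2 h)
    have hpos : 0 < ρ s1 y := hs0.trans_le (hmax' s0)
    let T := (ρ.finsupport y).filter (fun s => ρ s y = ρ s1 y)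
    refine ⟨T.card, T, ⟨rfl, s1, by simp [T, hs1]⟩, fun s hs => ?_⟩
    have hs' : ρ s y = ρ s1 y := (Finset.mem_filter.1 hs).2
    refine ⟨hs' ▸ hpos, fun s' hs' => ?_⟩
    rw [‹ρ s y = _›]
    refine lt_of_le_of_ne (hmax' s') fun h => hs' ?_
    exact Finset.mem_filter.2 ⟨(hfs s').2 (h ▸ hpos.ne'), h⟩

theorem base_seq {Y : Type*} [MetricSpace Y] :
    ∃ (W : ℕ → Finset Y → Set Y) (φ : ℕ → (Y →ᵇ ℝ)), (∀ n T, IsOpen (W n T)) ∧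
      (∀ n T T', T ≠ T' → Disjoint (W n T) (W n T')) ∧
      (∀ n y, (∀ T, y ∉ W n T) → φ n y = 1) ∧ (∀ n y, |φ n y| ≤ 1) ∧
      ∀ y, ∀ r > 0, ∃ n, φ n y = -1 ∧ ∀ T, W n T = ∅ ∨ ∃ z, W n T ⊆ ball z r := by
  choose W h1 h2 h3 h4 using fun N : ℕ => sigma_disjoint (Y := Y) (1 / ((N : ℝ) + 1)) (by positivity)
  let e : ℕ ≃ ℕ × ℕ × ℕ := (Denumerable.eqv (ℕ × ℕ × ℕ)).symm
  let O : ℕ × ℕ × ℕ → Set Y := fun q => ⋃ T, W q.1 q.2.1 T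
  let F : ℕ × ℕ × ℕ → Set Y := fun q => {y | ball y (1 / ((q.2.2 : ℝ) + 1)) ⊆ O q}
  have hO : ∀ q, IsOpen (O q) := fun q => isOpen_iUnion fun T => h1 _ _ _
  have hF : ∀ q, IsClosed (F q) := by
    intro q
    have : (F q)ᶜ = ⋃ z ∈ (O q)ᶜ, ball z (1 / ((q.2.2 : ℝ) + 1)) := by
      ext y
      simp only [F, mem_compl_iff, mem_setOf_eq, not_subset, mem_iUnion, mem_ball, exists_prop]
      constructor
      · rintro ⟨z, hz, hz'⟩; exact ⟨z, hz', by rwa [dist_comm]⟩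
      · rintro ⟨z, hz', hz⟩; exact ⟨z, by rwa [dist_comm], hz'⟩
    rw [← isOpen_compl_iff, this]
    exact isOpen_biUnion fun z _ => isOpen_ball
  have hd : ∀ q, Disjoint (F q) (O q)ᶜ := by
    intro q
    rw [Set.disjoint_compl_right_iff_subset]
    intro y hy
    exact hy (mem_ball_self (by positivity))
  choose φ hφ1 hφ2 hφ3 using fun q => exists_bounded_mem_Icc_of_closed_of_le (hF q)
    (hO q).isClosed_compl (hd q) (show (-1 : ℝ) ≤ 1 by norm_num)
  refine ⟨fun n => W (e n).1 (e n).2.1, fun n => φ (e n), fun n T => h1 _ _ _,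
    fun n => h2 _ _, ?_, fun n y => abs_le.2 (hφ3 _ _), ?_⟩
  · intro n y hy
    exact hφ2 (e n) (fun h => by
      obtain ⟨T, hT⟩ := mem_iUnion.1 h
      exact hy T hT)
  · intro y r hr
    obtain ⟨N, hN⟩ := exists_nat_one_div_lt hr
    obtain ⟨l, T, hy⟩ := h4 N y
    have : O (N, l, 0) ∈ 𝓝 y := (hO _).mem_nhds (mem_iUnion.2 ⟨T, hy⟩)
    obtain ⟨s, hs, hs'⟩ := Metric.mem_nhds_iff.1 this
    obtain ⟨c, hc⟩ := exists_nat_one_div_lt hs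
    refine ⟨e.symm (N, l, c), ?_, ?_⟩
    · apply hφ1
      simp only [Equiv.apply_symm_apply]
      exact (ball_subset_ball hc.le).trans hs'
    · simp only [Equiv.apply_symm_apply]
      intro T
      rcases h3 N l T with h | ⟨z, hz⟩
      · exact Or.inl h
      · exact Or.inr ⟨z, hz.trans (ball_subset_ball hN.le)⟩

theorem avoid_zero {Y : Type*} [TopologicalSpace Y] [NormalSpace Y] (m : ℕ)
    (hY : CovDimLENat Y m) (Φ : Fin (m + 1) → (Y →ᵇ ℝ)) (δ : ℝ) (hδ : 0 < δ) :
    ∃ Φ' : Fin (m + 1) → (Y →ᵇ ℝ), (∀ i, dist (Φ' i) (Φ i) ≤ δ) ∧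
      ∃ δ' > 0, ∀ y, ∃ i, δ' ≤ |Φ' i y| := by
  classical
  let P := Fin (m + 1) → ℝ
  let F : Y → P := fun y i => Φ i y
  have hFc : Continuous F := continuous_pi fun i => (Φ i).continuous
  have hFb : Bornology.IsBounded (range F) := by
    rw [isBounded_iff_forall_norm_le]
    refine ⟨∑ i, ‖Φ i‖, ?_⟩
    rintro _ ⟨y, rfl⟩
    rw [pi_norm_le_iff_of_nonneg (Finset.sum_nonneg fun i _ => norm_nonneg _)]
    intro i
    exact ((Φ i).norm_coe_le_norm y).trans
      (Finset.single_le_sum (f := fun i => ‖Φ i‖) (fun i _ => norm_nonneg _) (Finset.mem_univ i))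
  obtain ⟨t, htf, ht⟩ := Metric.totallyBounded_iff.1 (hFb.isCompact_closure.totallyBounded.subset subset_closure) (δ / 4) (by positivity)
  haveI : Fintype t := htf.fintype
  obtain ⟨ψ, hψ0, hψ1, hψU, hψn⟩ := exists_pu m hY (fun z : t => F ⁻¹' ball (z : P) (δ / 4))
    (fun z => isOpen_ball.preimage hFc) (by
      ext y
      simp only [mem_iUnion, mem_univ, iff_true]
      obtain ⟨z, hz, h⟩ := mem_iUnion₂.1 (ht (mem_range_self y))
      exact ⟨⟨z, hz⟩, h⟩)
  obtain ⟨v, hv, hvg⟩ := gen_pos (E := Fin 0 → ℝ) (P := P) (ι := Option t)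
    (fun o _ => o.elim 0 (fun z => (z : P))) (fun o => contDiff_const) (m + 2)
    (by simp [P]) (by simp [P]) (δ / 4) (by positivity) Finset.univ
  let w : t → P := fun z => (z : P) + v (some z) - v none
  let G : (t → ℝ) → P := fun a => ∑ z, a z • w z
  have hG : Continuous G := by
    refine continuous_finset_sum _ fun z _ => ?_
    exact (continuous_apply z).smul continuous_const
  let Sset : Finset t → Set (t → ℝ) := fun S => stdSimplex ℝ t ∩ {a | ∀ z, z ∉ S → a z = 0}
  let Kc : Set P := ⋃ S ∈ {S : Finset t | S.card ≤ m + 1}, G '' (Sset S)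
  have hKc : IsCompact Kc := by
    refine (Set.toFinite _).isCompact_biUnion fun S _ => IsCompact.image ?_ hG
    refine (isCompact_stdSimplex ℝ t).inter_right ?_
    simp only [setOf_forall]
    exact isClosed_iInter fun z => isClosed_iInter fun _ =>
      isClosed_eq (continuous_apply z) continuous_const
  have h0 : (0 : P) ∉ Kc := by
    intro h
    simp only [Kc, mem_iUnion, mem_setOf_eq] at h
    obtain ⟨S, hS, a, ⟨⟨ha0, ha1⟩, haS⟩, haG⟩ := h
    have := hvg 0 (fun o => o.elim (-1) a) (by simp) (by
      refine (Finset.card_le_card (t := insert none (S.image some)) ?_).trans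
        ((Finset.card_insert_le _ _).trans ?_)
      · intro o ho
        rcases o with _ | z
        · simp
        · simp only [Finset.mem_insert, reduceCtorEq, Finset.mem_image, Option.some.injEq,
            exists_eq_right, false_or]
          by_contra hz
          simp [haS z hz] at ho
      · have := Finset.card_image_le (s := S) (f := (some : t → Option t))
        omega) (by simp [Fintype.sum_option, ha1]) (by
        rw [Fintype.sum_option]
        simp only [Option.elim]
        have : G a = ∑ z, a z • ((z : P) + v (some z)) - v none := by
          simp only [G, w, smul_sub, Finset.sum_sub_distrib, ← Finset.sum_smul, ha1, one_smul]
        rw [haG] at this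
        simp only [zero_add, neg_smul, one_smul]
        rw [this]; abel) none
    simp at this
  obtain ⟨δ', hδ', hball⟩ := Metric.mem_nhds_iff.1 (hKc.isClosed.isOpen_compl.mem_nhds h0)
  have hψS : ∀ y, (fun z => ψ z y) ∈ Sset (Finset.univ.filter fun z => ψ z y ≠ 0) := by
    intro y
    refine ⟨⟨fun z => hψ0 z y, hψ1 y⟩, fun z hz => ?_⟩
    simpa using hz
  let H : Y → P := fun y => G (fun z => ψ z y)
  have hHc : Continuous H := hG.comp (continuous_pi fun z => (ψ z).continuous)
  have hHK : ∀ y, H y ∈ Kc := fun y =>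
    mem_biUnion (x := Finset.univ.filter fun z => ψ z y ≠ 0) (hψn y) ⟨_, hψS y, rfl⟩
  have hclose : ∀ y, ‖H y - F y‖ ≤ δ := by
    intro y
    have e : H y - F y = ∑ z, ψ z y • (w z - F y) := by
      simp only [H, G, smul_sub, Finset.sum_sub_distrib, ← Finset.sum_smul, hψ1, one_smul]
    rw [e]
    refine (norm_sum_le _ _).trans ?_
    calc ∑ z, ‖ψ z y • (w z - F y)‖ ≤ ∑ z, ψ z y * δ := by
          refine Finset.sum_le_sum fun z _ => ?_
          rw [norm_smul, Real.norm_of_nonneg (hψ0 z y)]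
          by_cases hz : ψ z y = 0
          · simp [hz]
          · refine mul_le_mul_of_nonneg_left ?_ (hψ0 z y)
            have h1 : ‖(z : P) - F y‖ < δ / 4 := by
              have := hψU z y hz
              rwa [mem_preimage, mem_ball, dist_comm, dist_eq_norm] at this
            have h2 := hv (some z)
            have h3 := hv none
            calc ‖w z - F y‖ = ‖((z : P) - F y) + v (some z) - v none‖ := by
                  congr 1; simp only [w]; abel
              _ ≤ ‖(z : P) - F y‖ + ‖v (some z)‖ + ‖v none‖ :=
                  (norm_sub_le _ _).trans (by gcongr; exact norm_add_le _ _)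
              _ ≤ δ := by linarith
      _ = δ := by rw [← Finset.sum_mul, hψ1, one_mul]
  obtain ⟨M, hM⟩ := isBounded_iff_forall_norm_le.1 hKc.isBounded
  refine ⟨fun i => BoundedContinuousFunction.ofNormedAddCommGroup (fun y => H y i)
    ((continuous_apply i).comp hHc) M (fun y => (norm_le_pi_norm (H y) i).trans (hM _ (hHK y))),
    ?_, δ', hδ', ?_⟩
  · intro i
    rw [BoundedContinuousFunction.dist_le hδ.le]
    intro y
    rw [dist_eq_norm]
    exact (norm_le_pi_norm (H y - F y) i).trans (hclose y)
  · intro y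
    by_contra hcon
    push Not at hcon
    have : H y ∈ ball (0 : P) δ' := by
      rw [mem_ball_zero_iff, pi_norm_lt_iff hδ']
      exact hcon
    exact hball this (hHK y)

theorem baire_seq {Y : Type*} [TopologicalSpace Y] [NormalSpace Y] (m : ℕ)
    (hY : CovDimLENat Y m) (φ0 : ℕ × Fin (m + 1) → (Y →ᵇ ℝ)) (hb : ∀ j y, |φ0 j y| ≤ 1) :
    ∃ φ' : ℕ × Fin (m + 1) → (Y →ᵇ ℝ), (∀ j, ∀ y, |φ' j y - φ0 j y| < 1) ∧
      ∀ n : Fin (m + 1) → ℕ, ∀ y, ∃ i, φ' (n i, i) y ≠ 0 := by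
  classical
  let S := (ℕ × Fin (m + 1)) →ᵇ (Y →ᵇ ℝ)
  let O : (Fin (m + 1) → ℕ) → Set S := fun n =>
    {φ | ∃ δ > 0, ∀ y, ∃ i, δ ≤ |φ (n i, i) y|}
  have hO : ∀ n, IsOpen (O n) := by
    intro n
    rw [Metric.isOpen_iff]
    rintro φ ⟨δ, hδ, h⟩
    refine ⟨δ / 2, by positivity, fun φ' h' => ?_⟩
    refine ⟨δ / 2, by positivity, fun y => ?_⟩
    obtain ⟨i, hi⟩ := h y
    refine ⟨i, ?_⟩
    have h1 := (dist_coe_le_dist (f := φ' (n i, i)) (g := φ (n i, i)) y).trans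
      ((dist_coe_le_dist (f := φ') (g := φ) (n i, i)).trans (mem_ball.1 h').le)
    rw [Real.dist_eq, abs_sub_comm] at h1
    have := abs_sub_abs_le_abs_sub (φ (n i, i) y) (φ' (n i, i) y)
    linarith
  have hD : ∀ n, Dense (O n) := by
    intro n
    rw [Metric.dense_iff]
    intro φ r hr
    obtain ⟨Ψ, h1, δ, hδ, h⟩ := avoid_zero m hY (fun i => φ (n i, i)) (r / 2) (by positivity)
    let q : ℕ × Fin (m + 1) → (Y →ᵇ ℝ) := fun j => if j.1 = n j.2 then Ψ j.2 else φ j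
    have hq : ∀ j, dist (q j) (φ j) ≤ r / 2 := by
      rintro ⟨a, i⟩
      by_cases h : a = n i
      · subst h
        simpa only [q, if_true] using h1 i
      · simp only [q, h, if_false, dist_self]; positivity
    have hqn : ∀ j, ‖q j‖ ≤ ‖φ‖ + r / 2 := fun j => by
      have h2 := hq j
      rw [dist_eq_norm] at h2
      have h3 := φ.norm_coe_le_norm j
      have := norm_sub_norm_le (q j) (φ j)
      linarith
    let q' : S := BoundedContinuousFunction.ofNormedAddCommGroup q
      continuous_of_discreteTopology _ hqn
    refine ⟨q', ?_, δ, hδ, fun y => ?_⟩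
    · rw [mem_ball]
      refine lt_of_le_of_lt ((BoundedContinuousFunction.dist_le (by positivity)).2 hq) (by linarith)
    · obtain ⟨i, hi⟩ := h y
      refine ⟨i, ?_⟩
      have e : q' (n i, i) = Ψ i := by
        change q (n i, i) = _
        simp [q]
      rw [e]; exact hi
  have hdense := dense_iInter_of_isOpen hO hD
  let φ : S := BoundedContinuousFunction.ofNormedAddCommGroup φ0
      continuous_of_discreteTopology 1
      (fun j => (BoundedContinuousFunction.norm_le zero_le_one).2 (hb j))
  obtain ⟨φ', h1, h2⟩ := Metric.dense_iff.1 hdense φ 1 one_pos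
  refine ⟨φ', fun j y => ?_, fun n y => ?_⟩
  · exact (dist_coe_le_dist (f := φ' j) (g := φ j) y).trans_lt
      ((dist_coe_le_dist (f := φ') (g := φ) j).trans_lt (mem_ball.1 h1))
  · obtain ⟨δ, hδ, h⟩ := mem_iInter.1 h2 n
    obtain ⟨i, hi⟩ := h y
    exact ⟨i, abs_pos.1 (hδ.trans_le hi)⟩

def ZD {Y : Type*} [TopologicalSpace Y] (Q : Set Y) : Prop :=
  ∀ V : Y → Set Y, (∀ y, IsOpen (V y)) → (∀ y, y ∈ V y) →
    ∃ W : Y → Set Y, (∀ y, IsOpen (W y)) ∧ LocallyFinite W ∧ Pairwise (Function.onFun Disjoint W) ∧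
      (∀ y, W y ⊆ V y) ∧ Q ⊆ ⋃ y, W y

theorem zd_of_seq {Y : Type*} [MetricSpace Y] (W : ℕ → Finset Y → Set Y) (φ : ℕ → (Y →ᵇ ℝ))
    (hW : ∀ n T, IsOpen (W n T)) (hWd : ∀ n T T', T ≠ T' → Disjoint (W n T) (W n T'))
    (hφ : ∀ n y, (∀ T, y ∉ W n T) → 0 < φ n y)
    (hb : ∀ y, ∀ r > 0, ∃ n, φ n y < 0 ∧ ∀ T, W n T = ∅ ∨ ∃ z, W n T ⊆ ball z r) :
    ZD {y | ∀ n, φ n y ≠ 0} := by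
  classical
  intro V hV hyV
  obtain ⟨U, hUo, hUc, hUl, hUV⟩ := precise_refinement V hV
    (eq_univ_of_forall fun y => mem_iUnion.2 ⟨y, hyV y⟩)
  let 𝓣 : ℕ → Set (Finset Y) := fun n => {T | ∃ s, W n T ⊆ U s}
  let Db : ℕ → Set Y := fun n => {y | φ n y ≤ 0 ∧ ∃ T ∈ 𝓣 n, y ∈ W n T}
  have hDb : ∀ n, IsClosed (Db n) := by
    intro n
    have : Db n = {y | φ n y ≤ 0} ∩ (⋃ T ∈ (𝓣 n)ᶜ, W n T)ᶜ := by
      ext y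
      constructor
      · rintro ⟨h1, T, hT, hy⟩
        refine ⟨h1, fun h => ?_⟩
        obtain ⟨T', hT', hy'⟩ := mem_iUnion₂.1 h
        have hne : T ≠ T' := fun h => hT' (h ▸ hT)
        exact Set.disjoint_left.1 (hWd n T T' hne) hy hy'
      · rintro ⟨h1, h2⟩
        refine ⟨h1, ?_⟩
        by_contra hcon
        push Not at hcon
        refine absurd (hφ n y fun T hT => ?_) (not_lt.2 h1)
        by_cases h : T ∈ 𝓣 n
        · exact hcon T h hT
        · exact h2 (mem_iUnion₂.2 ⟨T, h, hT⟩)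
    rw [this]
    exact (isClosed_le (φ n).continuous continuous_const).inter
      (isOpen_biUnion fun T _ => hW n T).isClosed_compl
  let En : ℕ → Finset Y → Set Y := fun n T =>
    {y | φ n y < 0 ∧ y ∈ W n T ∧ ∀ n' < n, y ∉ Db n'}
  have hEo : ∀ n T, IsOpen (En n T) := by
    intro n T
    have : En n T = {y | φ n y < 0} ∩ W n T ∩ ⋂ n' ∈ Finset.range n, (Db n')ᶜ := by
      ext y
      simp only [En, mem_setOf_eq, mem_inter_iff, mem_iInter, Finset.mem_range, mem_compl_iff,
        and_assoc]
    rw [this]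
    exact ((isOpen_lt (φ n).continuous continuous_const).inter (hW n T)).inter
      (isOpen_biInter_finset fun n' _ => (hDb n').isOpen_compl)
  have hEd : ∀ n T n' T', T ∈ 𝓣 n → T' ∈ 𝓣 n' → ∀ y, y ∈ En n T → y ∈ En n' T' →
      n = n' ∧ T = T' := by
    rintro n T n' T' hT hT' y ⟨h1, h2, h3⟩ ⟨h1', h2', h3'⟩
    have hn : n = n' := by
      rcases lt_trichotomy n n' with h | h | h
      · exact absurd ⟨h1.le, T, hT, h2⟩ (h3' n h)
      · exact h
      · exact absurd ⟨h1'.le, T', hT', h2'⟩ (h3 n' h)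
    subst hn
    refine ⟨rfl, ?_⟩
    by_contra hne
    exact Set.disjoint_left.1 (hWd n T T' hne) h2 h2'
  let Ws : Y → Set Y := fun s => ⋃ n, ⋃ T, ⋃ h : T ∈ 𝓣 n, ⋃ _ : Exists.choose h = s, En n T
  have hmem : ∀ s y, y ∈ Ws s ↔ ∃ n T, ∃ h : T ∈ 𝓣 n, Exists.choose h = s ∧ y ∈ En n T := by
    intro s y
    simp only [Ws, mem_iUnion, exists_prop]
  have hWsU : ∀ s, Ws s ⊆ U s := by
    intro s y hy
    obtain ⟨n, T, h, hs, hy⟩ := (hmem s y).1 hy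
    have := Exists.choose_spec h
    rw [hs] at this
    exact this hy.2.1
  refine ⟨Ws, ?_, hUl.subset hWsU, ?_, fun y => (hWsU y).trans (hUV y), ?_⟩
  · intro s
    exact isOpen_iUnion fun n => isOpen_iUnion fun T => isOpen_iUnion fun _ =>
      isOpen_iUnion fun _ => hEo n T
  · intro s s' hne
    rw [Function.onFun, Set.disjoint_left]
    intro y hy hy'
    obtain ⟨n, T, h, hs, hy⟩ := (hmem s y).1 hy
    obtain ⟨n', T', h', hs', hy'⟩ := (hmem s' y).1 hy'
    obtain ⟨h1, h2⟩ := hEd n T n' T' h h' y hy hy'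
    subst h1; subst h2
    exact hne (hs.symm.trans hs')
  · intro y hy
    have hex : ∃ n, y ∈ Db n := by
      obtain ⟨s, hs⟩ := mem_iUnion.1 (hUc.symm ▸ mem_univ y : y ∈ ⋃ i, U i)
      obtain ⟨r, hr, hrs⟩ := Metric.mem_nhds_iff.1 ((hUo s).mem_nhds hs)
      obtain ⟨n, hn, hnT⟩ := hb y (r / 2) (by positivity)
      refine ⟨n, hn.le, ?_⟩
      obtain ⟨T, hT⟩ : ∃ T, y ∈ W n T := by
        by_contra hcon
        push Not at hcon
        exact lt_asymm hn (hφ n y hcon)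
      refine ⟨T, ⟨s, ?_⟩, hT⟩
      rcases hnT T with h | ⟨z, hz⟩
      · rw [h] at hT; exact absurd hT (by simp)
      · intro x hx
        apply hrs
        have h1 := hz hx
        have h2 := hz hT
        rw [mem_ball] at *
        have := dist_triangle_right x y z
        linarith
    obtain ⟨h1, T, hT, h2⟩ := Nat.find_spec hex
    rw [mem_iUnion]
    refine ⟨_, (hmem _ y).2 ⟨_, T, hT, rfl, lt_of_le_of_ne h1 (hy _), h2, fun n' hn' => ?_⟩⟩
    exact Nat.find_min hex hn'

theorem zd_pieces {Y : Type*} [MetricSpace Y] (m : ℕ) (hY : CovDimLENat Y m) :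
    ∃ Q : Fin (m + 1) → Set Y, (∀ i, ZD (Q i)) ∧ ⋃ i, Q i = univ := by
  obtain ⟨W, φ, h1, h2, h3, h4, h5⟩ := base_seq (Y := Y)
  obtain ⟨φ', h6, h7⟩ := baire_seq m hY (fun j => φ j.1) (fun j => h4 j.1)
  refine ⟨fun i => {y | ∀ n, φ' (n, i) y ≠ 0}, fun i => ?_, ?_⟩
  · refine zd_of_seq W (fun n => φ' (n, i)) h1 h2 ?_ ?_
    · intro n y hy
      have := abs_lt.1 (h6 (n, i) y)
      rw [h3 n y hy] at this
      linarith [this.1]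
    · intro y r hr
      obtain ⟨n, hn, hnT⟩ := h5 y r hr
      refine ⟨n, ?_, hnT⟩
      have := abs_lt.1 (h6 (n, i) y)
      simp only [hn] at this
      linarith [this.2]
  · refine eq_univ_of_forall fun y => ?_
    by_contra hcon
    simp only [mem_iUnion, mem_setOf_eq, not_exists, not_forall, not_not] at hcon
    choose n hn using hcon
    obtain ⟨i, hi⟩ := h7 n y
    exact hi (hn i)

def GoodAt {X Y P : Type*} [MetricSpace X] (f : X → Y) (ε : ℝ) (v : X → P) (y : Y) : Prop :=
  ∀ x1 x2, f x1 = y → f x2 = y → ε ≤ dist x1 x2 → v x1 ≠ v x2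

theorem margin {X Y E P : Type*} [MetricSpace X] [MetricSpace Y] [MetricSpace E]
    [NormedAddCommGroup P] (f : X → Y) (hf : IsProperMap f) (ε : ℝ) (u : X × E → P)
    (hu : Continuous u) :
    ∃ η : Y × E → ℝ, Continuous η ∧
      (∀ y τ, GoodAt f ε (fun x => u (x, τ)) y → 0 < η (y, τ)) ∧
      ∀ y τ (v : X → P), (∀ x, f x = y → dist (v x) (u (x, τ)) < η (y, τ) / 2) →
        GoodAt f ε v y := by
  classical
  let Θ : X × X × E → (Y × Y × E) × P := fun q =>
    ((f q.1, f q.2.1, q.2.2), u (q.1, q.2.2) - u (q.2.1, q.2.2))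
  have hΘc : Continuous Θ := by
    have := hf.continuous
    fun_prop
  have hΘ : IsProperMap Θ := by
    refine isProperMap_of_comp_of_t2 hΘc continuous_fst ?_
    exact hf.prodMap (hf.prodMap isProperMap_id)
  let S : Set ((Y × Y × E) × P) := Θ '' {q | ε ≤ dist q.1 q.2.1}
  have hS : IsClosed S := hΘ.isClosedMap _
    (isClosed_le continuous_const (continuous_fst.dist (continuous_fst.comp continuous_snd)))
  have hmem : ∀ x1 x2 y τ, f x1 = y → f x2 = y → ε ≤ dist x1 x2 →
      ((y, y, τ), u (x1, τ) - u (x2, τ)) ∈ S := by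
    intro x1 x2 y τ h1 h2 h3
    refine ⟨(x1, x2, τ), h3, ?_⟩
    simp only [Θ, h1, h2]
  by_cases hSe : S = ∅
  · refine ⟨fun _ => 1, continuous_const, fun _ _ _ => one_pos, ?_⟩
    intro y τ v _ x1 x2 h1 h2 h3
    have := hmem x1 x2 y τ h1 h2 h3
    rw [hSe] at this
    exact absurd this (by simp)
  · have hSn : S.Nonempty := nonempty_iff_ne_empty.2 hSe
    refine ⟨fun q => infDist ((q.1, q.1, q.2), (0 : P)) S, ?_, ?_, ?_⟩
    · exact (continuous_infDist_pt S).comp (by fun_prop)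
    · intro y τ hg
      rw [← hS.notMem_iff_infDist_pos hSn]
      rintro ⟨⟨x1, x2, τ'⟩, h, h'⟩
      simp only [Θ, Prod.mk.injEq] at h'
      obtain ⟨⟨h1, h2, rfl⟩, h3⟩ := h'
      exact hg x1 x2 h1 h2 h (sub_eq_zero.1 h3)
    · intro y τ v hv x1 x2 h1 h2 h3 h4
      have := infDist_le_dist_of_mem (x := ((y, y, τ), (0 : P))) (hmem x1 x2 y τ h1 h2 h3)
      have e : dist ((y, y, τ), (0 : P)) ((y, y, τ), u (x1, τ) - u (x2, τ))
          = dist (u (x1, τ)) (u (x2, τ)) := by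
        rw [Prod.dist_eq, dist_self, dist_comm, dist_zero_right, ← dist_eq_norm]
        exact max_eq_right dist_nonneg
      rw [e] at this
      have a1 := hv x1 h1
      have a2 := hv x2 h2
      have a3 := dist_triangle4 (u (x1, τ)) (v x1) (v x2) (u (x2, τ))
      rw [h4, dist_self, dist_comm (u (x1, τ)) (v x2)] at a3
      rw [h4] at a1
      simp only at a1 a2
      linarith

theorem good_open {X Y E P : Type*} [MetricSpace X] [MetricSpace Y] [MetricSpace E]
    [NormedAddCommGroup P] (f : X → Y) (hf : IsProperMap f) (ε : ℝ) (u u' : X × E → P)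
    (α : X × E → ℝ) (hu : Continuous u) (hu' : Continuous u') (hα : Continuous α)
    (K : Set E) (hK : IsCompact K) :
    IsOpen {y | ∀ τ ∈ K, GoodAt f ε (fun x => u' (x, τ)) y ∧
      ∀ x, f x = y → dist (u' (x, τ)) (u (x, τ)) < α (x, τ)} := by
  obtain ⟨η, hη, h1, h2⟩ := margin f hf ε u' hu'
  have o1 : IsOpen {y | ∀ τ ∈ K, 0 < η (y, τ)} := by
    rw [isOpen_iff_eventually]
    intro y hy
    refine hK.eventually_forall_of_forall_eventually fun τ hτ => ?_
    exact hη.continuousAt.eventually (lt_mem_nhds (hy τ hτ))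
  have o2 : IsOpen {x | ∀ τ ∈ K, dist (u' (x, τ)) (u (x, τ)) < α (x, τ)} := by
    rw [isOpen_iff_eventually]
    intro y hy
    refine hK.eventually_forall_of_forall_eventually fun τ hτ => ?_
    exact (hu'.dist hu).continuousAt.eventually_lt hα.continuousAt (hy τ hτ)
  have o3 := (hf.isClosedMap _ o2.isClosed_compl).isOpen_compl
  convert o1.inter o3 using 1
  ext y
  constructor
  · intro h
    refine ⟨fun τ hτ => h1 y τ (h τ hτ).1, ?_⟩
    rintro ⟨x, hx, rfl⟩
    exact hx fun τ hτ => (h τ hτ).2 x rfl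
  · rintro ⟨h, h'⟩ τ hτ
    refine ⟨h2 y τ _ fun x _ => ?_, fun x hx => ?_⟩
    · rw [dist_self]; have := h τ hτ; linarith
    · by_contra hcon
      exact h' ⟨x, fun hx' => hcon (hx' τ hτ), hx⟩

theorem local_good {X E P : Type*} [MetricSpace X] [NormedAddCommGroup E] [NormedSpace ℝ E]
    [FiniteDimensional ℝ E] [NormedAddCommGroup P] [NormedSpace ℝ P] [FiniteDimensional ℝ P]
    (C : Set X) (hCc : IsCompact C) (k : ℕ) (hC : CovDimLE C k)
    (hd : 2 * k + 1 + Module.finrank ℝ E ≤ Module.finrank ℝ P) (ε : ℝ) (hε : 0 < ε)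
    (u : X × E → P) (hu : Continuous u) (α : X × E → ℝ) (hα : Continuous α)
    (K : Set E) (hK : IsCompact K) (hpos : ∀ x ∈ C, ∀ τ ∈ K, 0 < α (x, τ)) :
    ∃ u' : X × E → P, Continuous u' ∧ ∀ τ ∈ K,
      (∀ x1 ∈ C, ∀ x2 ∈ C, ε ≤ dist x1 x2 → u' (x1, τ) ≠ u' (x2, τ)) ∧
      ∀ x ∈ C, dist (u' (x, τ)) (u (x, τ)) < α (x, τ) := by
  classical
  rcases hC with hemp | ⟨k', hk', hC⟩
  · refine ⟨u, hu, fun τ _ => ⟨fun x hx => ?_, fun x hx => ?_⟩⟩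
    all_goals exact (hemp.false ⟨x, hx⟩).elim
  have hk : k' ≤ k := by exact_mod_cast hk'
  obtain ⟨δ, hδ, hδα⟩ := (hCc.prod hK).exists_forall_le' hα.continuousOn (a := 0)
    (fun q hq => hpos q.1 hq.1 q.2 hq.2)
  let U : X → Set X := fun z => {x | ∀ τ ∈ K, dist (u (x, τ)) (u (z, τ)) < δ / 4} ∩ ball z (ε / 2)
  have hU : ∀ z, IsOpen (U z) := by
    intro z
    refine IsOpen.inter ?_ isOpen_ball
    rw [isOpen_iff_eventually]
    intro x hx
    refine hK.eventually_forall_of_forall_eventually fun τ hτ => ?_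
    have hc : Continuous fun q : X × E => dist (u (q.1, q.2)) (u (z, q.2)) := by fun_prop
    exact hc.continuousAt.eventually (gt_mem_nhds (hx τ hτ))
  have hzU : ∀ z, z ∈ U z := fun z => ⟨fun τ _ => by rw [dist_self]; positivity,
    mem_ball_self (by positivity)⟩
  obtain ⟨t, htC, ht⟩ := hCc.elim_nhds_subcover U (fun x _ => (hU x).mem_nhds (hzU x))
  haveI : CompactSpace C := isCompact_iff_compactSpace.1 hCc
  obtain ⟨ψ, hψ0, hψ1, hψU, hψn⟩ := exists_pu k' hC (fun z : t => (Subtype.val ⁻¹' U z : Set C))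
    (fun z => (hU z).preimage continuous_subtype_val) (by
      ext x
      simp only [mem_iUnion, mem_univ, iff_true]
      obtain ⟨z, hz, h⟩ := mem_iUnion₂.1 (ht x.2)
      exact ⟨⟨z, hz⟩, h⟩)
  choose w hw hwu _ using fun z : t => Continuous.exists_contDiff_approx (E := E) (F := P) 1
    (f := fun τ => u ((z : X), τ)) (ε := fun _ => δ / 4) (by fun_prop) continuous_const
    (fun _ => by positivity)
  obtain ⟨v, hv, hvg⟩ := gen_pos w (fun z => hw z) (2 * k' + 2) (by omega) (by omega) (δ / 4)
    (by positivity) Finset.univ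
  choose ψ' hψ' using fun z : t => ContinuousMap.exists_restrict_eq hCc.isClosed (ψ z)
  have hψe : ∀ z (x : C), ψ' z x = ψ z x := fun z x => by rw [← hψ' z]; rfl
  let u' : X × E → P := fun q => ∑ z : t, ψ' z q.1 • (w z q.2 + v z)
  have hu'C : ∀ (x : C) τ, u' (x, τ) = ∑ z : t, ψ z x • (w z τ + v z) := by
    intro x τ
    simp only [u', hψe]
  refine ⟨u', ?_, fun τ hτ => ⟨?_, ?_⟩⟩
  · refine continuous_finset_sum _ fun z _ => ?_
    have := (hw z).continuous
    fun_prop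
  · intro x1 hx1 x2 hx2 hdist heq
    rw [hu'C ⟨x1, hx1⟩, hu'C ⟨x2, hx2⟩] at heq
    have hc := hvg τ (fun z => ψ z ⟨x1, hx1⟩ - ψ z ⟨x2, hx2⟩) (by simp) (by
      refine (Finset.card_le_card (t := Finset.univ.filter (fun z => ψ z ⟨x1, hx1⟩ ≠ 0) ∪
        Finset.univ.filter (fun z => ψ z ⟨x2, hx2⟩ ≠ 0)) ?_).trans
        ((Finset.card_union_le _ _).trans ?_)
      · intro z hz
        simp only [Finset.mem_union, Finset.mem_filter, Finset.mem_univ, true_and] at hz ⊢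
        by_contra hcon
        push Not at hcon
        exact hz (by rw [hcon.1, hcon.2, sub_zero])
      · have h1 := hψn ⟨x1, hx1⟩
        have h2 := hψn ⟨x2, hx2⟩
        omega) (by rw [Finset.sum_sub_distrib, hψ1, hψ1, sub_self]) (by
        simp only [sub_smul, Finset.sum_sub_distrib]
        rw [heq, sub_self])
    obtain ⟨z, hz⟩ : ∃ z, ψ z ⟨x1, hx1⟩ ≠ 0 := by
      by_contra hcon
      push Not at hcon
      have := hψ1 ⟨x1, hx1⟩
      simp [hcon] at this
    have h1 : x1 ∈ ball (z : X) (ε / 2) := (hψU z _ hz).2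
    have h2 : x2 ∈ ball (z : X) (ε / 2) := (hψU z ⟨x2, hx2⟩ (by
      have := hc z
      rwa [← sub_eq_zero.1 this])).2
    rw [mem_ball] at h1 h2
    have := dist_triangle_right x1 x2 (z : X)
    linarith
  · intro x hx
    refine lt_of_lt_of_le ?_ (hδα (x, τ) ⟨hx, hτ⟩)
    have e : u' (x, τ) - u (x, τ) = ∑ z, ψ z ⟨x, hx⟩ • (w z τ + v z - u (x, τ)) := by
      simp only [hu'C ⟨x, hx⟩, smul_sub, Finset.sum_sub_distrib, ← Finset.sum_smul, hψ1, one_smul]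
    rw [dist_eq_norm, e]
    refine lt_of_le_of_lt (norm_sum_le _ _) ?_
    calc ∑ z, ‖ψ z ⟨x, hx⟩ • (w z τ + v z - u (x, τ))‖ ≤ ∑ z, ψ z ⟨x, hx⟩ * (3 * δ / 4) := by
          refine Finset.sum_le_sum fun z _ => ?_
          rw [norm_smul, Real.norm_of_nonneg (hψ0 z _)]
          by_cases hz : ψ z ⟨x, hx⟩ = 0
          · simp [hz]
          · refine mul_le_mul_of_nonneg_left ?_ (hψ0 z _)
            have h1 : dist (u (x, τ)) (u (z, τ)) < δ / 4 := (hψU z _ hz).1 τ hτ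
            have h2 := hv z
            have h3 := hwu z τ
            rw [dist_comm, dist_eq_norm] at h1
            rw [dist_eq_norm] at h3
            calc ‖w z τ + v z - u (x, τ)‖
                = ‖(w z τ - u (z, τ)) + (u (z, τ) - u (x, τ)) + v z‖ := by congr 1; abel
              _ ≤ ‖w z τ - u (z, τ)‖ + ‖u (z, τ) - u (x, τ)‖ + ‖v z‖ := norm_add₃_le
              _ ≤ 3 * δ / 4 := by linarith
      _ = 3 * δ / 4 := by rw [← Finset.sum_mul, hψ1, one_mul]
      _ < δ := by linarith

def Apx {X Y E P : Type*} [MetricSpace X] [NormedAddCommGroup E] [NormedAddCommGroup P]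
    (f : X → Y) (ε : ℝ) (A : Set Y) (K : Set E) (u : X × E → P) (α : X × E → ℝ)
    (u' : X × E → P) : Prop :=
  ∀ y ∈ A, ∀ τ ∈ K, GoodAt f ε (fun x => u' (x, τ)) y ∧
      ∀ x, f x = y → dist (u' (x, τ)) (u (x, τ)) < α (x, τ)

def mixP {P : Type*} [NormedAddCommGroup P] [NormedSpace ℝ P] (s : ℝ) (p q : P) : P :=
  (1 - s) • p + s • q

theorem mixP_lt {P : Type*} [NormedAddCommGroup P] [NormedSpace ℝ P] (s : ℝ) (p q z : P) (r : ℝ)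
    (h0 : 0 ≤ s) (h1 : s ≤ 1) (hp : dist p z < r) (hq : dist q z < r) :
    dist (mixP s p q) z < r :=
  (convex_ball z r) (mem_ball.2 hp) (mem_ball.2 hq) (by linarith) h0 (by ring)

theorem homotopy_lemma {X Y E P : Type*} [MetricSpace X] [MetricSpace Y] [NormedAddCommGroup E]
    [NormedAddCommGroup P] [NormedSpace ℝ P] (f : X → Y) (hf : IsProperMap f) (ε : ℝ) (B : Set Y)
    (K : Set E)
    (IH : ∀ (u : X × (E × ℝ) → P) (α : X × (E × ℝ) → ℝ), Continuous u → Continuous α →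
      (∀ x, f x ∈ B → ∀ τ ∈ K ×ˢ Icc (0 : ℝ) 1, 0 < α (x, τ)) →
      ∃ u', Continuous u' ∧ Apx f ε B (K ×ˢ Icc (0 : ℝ) 1) u α u')
    (u a b : X × E → P) (α : X × E → ℝ) (hu : Continuous u) (ha : Continuous a)
    (hb : Continuous b) (hα : Continuous α) (hA : Apx f ε B K u α a) (hB : Apx f ε B K u α b) :
    ∃ H : X × (E × ℝ) → P, Continuous H ∧ (∀ x τ, H (x, τ, 0) = a (x, τ)) ∧
      (∀ x τ, H (x, τ, 1) = b (x, τ)) ∧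
      Apx f ε B (K ×ˢ Icc (0 : ℝ) 1) (fun q => u (q.1, q.2.1)) (fun q => α (q.1, q.2.1)) H := by
  obtain ⟨ηa, hηa, ha1, ha2⟩ := margin f hf ε a ha
  obtain ⟨ηb, hηb, hb1, hb2⟩ := margin f hf ε b hb
  have hfc := hf.continuous
  let cl : ℝ → ℝ := fun t => max 0 (min 1 t)
  have hcl : Continuous cl := by fun_prop
  have cl0 : ∀ t, 0 ≤ cl t := fun t => le_max_left _ _
  have cl1 : ∀ t, cl t ≤ 1 := fun t => max_le zero_le_one (min_le_left _ _)
  have clz : ∀ t ≤ 0, cl t = 0 := fun t ht => max_eq_left ((min_le_right _ _).trans ht)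
  have clo : ∀ t, 1 ≤ t → cl t = 1 := fun t ht => by simp [cl, min_eq_left ht]
  let L : X × (E × ℝ) → P := fun q =>
    mixP (cl (3 * q.2.2 - 1)) (a (q.1, q.2.1)) (b (q.1, q.2.1))
  have hL : Continuous L := by unfold L mixP; fun_prop
  let α' : X × (E × ℝ) → ℝ := fun q => min (α (q.1, q.2.1) - dist (L q) (u (q.1, q.2.1)))
    (min (ηa (f q.1, q.2.1) / 2) (ηb (f q.1, q.2.1) / 2))
  have hα' : Continuous α' := by unfold α'; fun_prop
  obtain ⟨L', hL'c, hL'⟩ := IH L α' hL hα' (by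
    rintro x hx ⟨τ, t⟩ ⟨hτ, ht⟩
    have hA' := hA _ hx τ hτ
    have hB' := hB _ hx τ hτ
    refine lt_min (sub_pos.2 ?_) (lt_min (half_pos (ha1 _ _ hA'.1)) (half_pos (hb1 _ _ hB'.1)))
    exact mixP_lt _ _ _ _ _ (cl0 _) (cl1 _) (hA'.2 x rfl) (hB'.2 x rfl))
  let H : X × (E × ℝ) → P := fun q =>
    mixP (cl (3 * q.2.2 - 2)) (mixP (cl (1 - 3 * q.2.2)) (L' q) (a (q.1, q.2.1))) (b (q.1, q.2.1))
  have mz : ∀ p q : P, mixP 0 p q = p := fun p q => by simp [mixP]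
  have mo : ∀ p q : P, mixP 1 p q = q := fun p q => by simp [mixP]
  refine ⟨H, by unfold H mixP; fun_prop, ?_, ?_, ?_⟩
  · intro x τ
    simp only [H]
    rw [clz _ (by norm_num), clo _ (by norm_num), mz, mo]
  · intro x τ
    simp only [H]
    rw [clo _ (by norm_num), mo]
  · rintro y hy ⟨τ, t⟩ ⟨hτ, ht⟩
    have hA' := hA _ hy τ hτ
    have hB' := hB _ hy τ hτ
    have hLL := hL' y hy (τ, t) ⟨hτ, ht⟩
    have hL'u : ∀ x, f x = y → dist (L' (x, τ, t)) (u (x, τ)) < α (x, τ) := by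
      intro x hx
      have h1 := (hLL.2 x hx).trans_le (min_le_left _ _)
      have h2 := dist_triangle (L' (x, τ, t)) (L (x, τ, t)) (u (x, τ))
      simp only at h1
      linarith
    constructor
    · rcases le_total t (1 / 3) with h | h
      · refine ha2 y τ _ fun x hx => ?_
        simp only [H]
        rw [clz (3 * t - 2) (by linarith), mz]
        have h1 := (hLL.2 x hx).trans_le ((min_le_right _ _).trans (min_le_left _ _))
        simp only [L] at h1
        rw [clz (3 * t - 1) (by linarith), mz, hx] at h1
        refine mixP_lt _ _ _ _ _ (cl0 _) (cl1 _) h1 ?_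
        rw [dist_self]; exact half_pos (ha1 _ _ hA'.1)
      rcases le_total t (2 / 3) with h' | h'
      · simp only [H]
        rw [clz (3 * t - 2) (by linarith), clz (1 - 3 * t) (by linarith)]
        simp only [mz]
        exact hLL.1
      · refine hb2 y τ _ fun x hx => ?_
        simp only [H]
        rw [clz (1 - 3 * t) (by linarith), mz]
        have h1 := (hLL.2 x hx).trans_le ((min_le_right _ _).trans (min_le_right _ _))
        simp only [L] at h1
        rw [clo (3 * t - 1) (by linarith), mo, hx] at h1
        refine mixP_lt _ _ _ _ _ (cl0 _) (cl1 _) h1 ?_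
        rw [dist_self]; exact half_pos (hb1 _ _ hB'.1)
    · intro x hx
      refine mixP_lt _ _ _ _ _ (cl0 _) (cl1 _) ?_ (hB'.2 x hx)
      exact mixP_lt _ _ _ _ _ (cl0 _) (cl1 _) (hL'u x hx) (hA'.2 x hx)

theorem main_ind {X Y P : Type*} [MetricSpace X] [MetricSpace Y]
    [NormedAddCommGroup P] [NormedSpace ℝ P] [FiniteDimensional ℝ P]
    (f : X → Y) (hf : IsProperMap f) (ε : ℝ) (hε : 0 < ε) (k : ℕ) (hdim : DimMapLE f k) (n : ℕ) :
    ∀ (A : Set Y), IsClosed A → ∀ (Q : Fin n → Set Y), (∀ i, ZD (Q i)) → A ⊆ ⋃ i, Q i →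
    ∀ (E : Type) [NormedAddCommGroup E] [NormedSpace ℝ E] [FiniteDimensional ℝ E]
      (K : Set E), IsCompact K → 2 * k + n + Module.finrank ℝ E ≤ Module.finrank ℝ P →
    ∀ (u : X × E → P) (α : X × E → ℝ), Continuous u → Continuous α →
      (∀ x, f x ∈ A → ∀ τ ∈ K, 0 < α (x, τ)) → ∃ u', Continuous u' ∧ Apx f ε A K u α u' := by
  classical
  induction n with
  | zero =>
    intro A hA Q hQ hAQ E _ _ _ K hK hd u α hu hα hpos
    refine ⟨u, hu, fun y hy => ?_⟩
    obtain ⟨i, _⟩ := mem_iUnion.1 (hAQ hy)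
    exact i.elim0
  | succ n IH =>
    intro A hA Q hQ hAQ E _ _ _ K hK hd u α hu hα hpos
    have hfc := hf.continuous
    have hloc : ∀ y, ∃ (v : X × E → P) (O : Set Y), Continuous v ∧ IsOpen O ∧ y ∈ O ∧
        Apx f ε (O ∩ A) K u α v := by
      intro y
      by_cases hy : y ∈ A
      · obtain ⟨v, hv, hv'⟩ := local_good (f ⁻¹' {y}) (hf.isCompact_preimage isCompact_singleton)
          k (hdim y) (by omega) ε hε u hu α hα K hK (fun x hx τ hτ => hpos x (by
            rw [show f x = y from hx]; exact hy) τ hτ)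
        refine ⟨v, _, hv, good_open f hf ε u v α hu hv hα K hK, ?_, fun y hy => hy.1⟩
        exact fun τ hτ => ⟨fun x1 x2 h1 h2 => (hv' τ hτ).1 x1 h1 x2 h2,
          fun x hx => (hv' τ hτ).2 x hx⟩
      · exact ⟨u, Aᶜ, hu, hA.isOpen_compl, hy, fun y' h => absurd h.2 h.1⟩
    choose v O hv hO hyO hvO using hloc
    have hr : ∀ y, ∃ r > 0, closedBall y r ⊆ O y := fun y =>
      Metric.nhds_basis_closedBall.mem_iff.1 ((hO y).mem_nhds (hyO y))
    choose r hr hrO using hr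
    obtain ⟨W, hWo, hWl, hWd, hWV, hQW⟩ := hQ 0 (fun y => ball y (r y)) (fun y => isOpen_ball)
      (fun y => mem_ball_self (hr y))
    have hWO : ∀ s, closure (W s) ⊆ O s := fun s =>
      (closure_mono (hWV s)).trans (closure_ball_subset_closedBall.trans (hrO s))
    let Z : Set Y := A \ ⋃ s, W s
    have hZ : IsClosed Z := hA.sdiff (isOpen_iUnion hWo)
    have hZQ : Z ⊆ ⋃ i : Fin n, Q i.succ := by
      rintro y ⟨hy, hy'⟩
      obtain ⟨i, hi⟩ := mem_iUnion.1 (hAQ hy)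
      rcases Fin.eq_zero_or_eq_succ i with h | ⟨j, h⟩
      · subst h; exact absurd (hQW hi) hy'
      · subst h; exact mem_iUnion.2 ⟨j, hi⟩
    obtain ⟨uz, huz, huz'⟩ := IH Z hZ (fun i => Q i.succ) (fun i => hQ _) hZQ E K hK (by omega)
      u α hu hα (fun x hx => hpos x hx.1)
    let Zs : Y → Set Y := fun s => closure (W s) ∩ Z
    have hZs : ∀ s, IsClosed (Zs s) := fun s => isClosed_closure.inter hZ
    have hH := fun s => homotopy_lemma f hf ε (Zs s) K
      (IH (Zs s) (hZs s) (fun i => Q i.succ) (fun i => hQ _) (inter_subset_right.trans hZQ) (E × ℝ)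
        (K ×ˢ Icc (0 : ℝ) 1) (hK.prod isCompact_Icc) (by
          rw [Module.finrank_prod, Module.finrank_self]; omega))
      u uz (v s) α hu huz (hv s) hα (fun y hy => huz' y hy.2)
      (fun y hy => hvO s y ⟨hWO s hy.1, hy.2.1⟩)
    choose H hHc hH0 hH1 hHg using hH
    have hOs := fun s => good_open f hf ε (fun q : X × (E × ℝ) => u (q.1, q.2.1)) (H s)
      (fun q => α (q.1, q.2.1)) (by fun_prop) (hHc s) (by fun_prop) (K ×ˢ Icc (0 : ℝ) 1)
      (hK.prod isCompact_Icc)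
    choose θ hθ0 hθ1 hθ using fun s => exists_continuous_zero_one_of_isClosed (hZs s)
      (hOs s).isClosed_compl (Set.disjoint_compl_right_iff_subset.2 (fun y hy => hHg s y hy))
    have huniq : ∀ s s' y, y ∈ closure (W s) → y ∈ W s' → s = s' := by
      intro s s' y hy hy'
      by_contra hne
      have : Disjoint (closure (W s)) (W s') := (hWd hne).closure_left (hWo s')
      exact Set.disjoint_left.1 this hy hy'
    let h : X × E → P := fun q => if hs : ∃ s, f q.1 ∈ W s then
      H hs.choose (q.1, q.2, θ hs.choose (f q.1)) else uz q
    have hhW : ∀ s x τ, f x ∈ W s → h (x, τ) = H s (x, τ, θ s (f x)) := by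
      intro s x τ hs
      have hex : ∃ s, f x ∈ W s := ⟨s, hs⟩
      have e : hex.choose = s := huniq _ _ _ (subset_closure hex.choose_spec) hs
      simp only [h, dif_pos hex]
      rw [e]
    have hhZ : ∀ x τ, f x ∈ Z → h (x, τ) = uz (x, τ) := by
      intro x τ hx
      have : ¬ ∃ s, f x ∈ W s := fun ⟨s, hs⟩ => hx.2 (mem_iUnion.2 ⟨s, hs⟩)
      simp only [h, dif_neg this]
    have hgood : Apx f ε A K u α h := by
      intro y hy τ hτ
      by_cases hs : ∃ s, y ∈ W s
      · obtain ⟨s, hs⟩ := hs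
        have e : ∀ x, f x = y → h (x, τ) = H s (x, τ, θ s y) := fun x hx => by
          subst hx; exact hhW s x τ hs
        have key : GoodAt f ε (fun x => H s (x, τ, θ s y)) y ∧
            ∀ x, f x = y → dist (H s (x, τ, θ s y)) (u (x, τ)) < α (x, τ) := by
          by_cases hyO : ∀ τ ∈ K ×ˢ Icc (0 : ℝ) 1, GoodAt f ε (fun x => H s (x, τ)) y ∧
              ∀ x, f x = y → dist (H s (x, τ)) (u (x, τ.1)) < α (x, τ.1)
          · exact hyO (τ, θ s y) ⟨hτ, hθ s y⟩
          · have : θ s y = 1 := hθ1 s hyO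
            simp only [this, hH1]
            exact hvO s y ⟨hWO s (subset_closure hs), hy⟩ τ hτ
        refine ⟨fun x1 x2 h1 h2 h3 => ?_, fun x hx => ?_⟩
        · simp only [e x1 h1, e x2 h2]
          exact key.1 x1 x2 h1 h2 h3
        · rw [e x hx]; exact key.2 x hx
      · have hyZ : y ∈ Z := ⟨hy, fun h => hs (mem_iUnion.1 h)⟩
        have e : ∀ x, f x = y → h (x, τ) = uz (x, τ) := fun x hx => hhZ x τ (hx ▸ hyZ)
        have key := huz' y hyZ τ hτ
        refine ⟨fun x1 x2 h1 h2 h3 => ?_, fun x hx => ?_⟩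
        · simp only [e x1 h1, e x2 h2]
          exact key.1 x1 x2 h1 h2 h3
        · rw [e x hx]; exact key.2 x hx
    let R : Option Y → Set Y := Option.elim' Z (fun s => A ∩ closure (W s))
    have hRl : LocallyFinite R := by
      have : LocallyFinite fun s => A ∩ closure (W s) :=
        hWl.closure.subset fun s => inter_subset_right
      exact this.option_elim' Z
    have hRc : ∀ o, IsClosed (R o) := by
      rintro (_ | s)
      · exact hZ
      · exact hA.inter isClosed_closure
    have hRA : ⋃ o, R o = A := by
      ext y
      rw [mem_iUnion]
      constructor
      · rintro ⟨_ | s, hs⟩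
        · exact hs.1
        · exact hs.1
      · intro hy
        by_cases hs : ∃ s, y ∈ W s
        · obtain ⟨s, hs⟩ := hs
          exact ⟨some s, hy, subset_closure hs⟩
        · exact ⟨none, hy, fun h => hs (mem_iUnion.1 h)⟩
    have hg : Continuous (fun q : X × E => f q.1) := by fun_prop
    have hcont : ContinuousOn h ((fun q : X × E => f q.1) ⁻¹' A) := by
      rw [← hRA, preimage_iUnion]
      refine (hRl.preimage_continuous hg).continuousOn_iUnion (fun o => (hRc o).preimage hg) ?_
      rintro (_ | s)
      · exact huz.continuousOn.congr fun q hq => hhZ q.1 q.2 hq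
      · have hc : Continuous fun q : X × E => H s (q.1, q.2, θ s (f q.1)) := by fun_prop
        refine hc.continuousOn.congr fun q hq => ?_
        obtain ⟨hqA, hqW⟩ : f q.1 ∈ A ∩ closure (W s) := hq
        by_cases hs : f q.1 ∈ W s
        · exact hhW s q.1 q.2 hs
        · have hqZ : f q.1 ∈ Z := by
            refine ⟨hqA, fun h => ?_⟩
            obtain ⟨s', hs'⟩ := mem_iUnion.1 h
            have := huniq s s' _ hqW hs'
            exact hs (this ▸ hs')
          have : θ s (f q.1) = 0 := hθ0 s ⟨hqW, hqZ⟩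
          simp only [this, hH0]
          exact hhZ q.1 q.2 hqZ
    haveI : TietzeExtension P := TietzeExtension.of_tvs ℝ
    obtain ⟨g, hgr⟩ := ContinuousMap.exists_restrict_eq (hA.preimage hg)
      ⟨_, continuousOn_iff_continuous_restrict.1 hcont⟩
    have hge : ∀ x τ, f x ∈ A → g (x, τ) = h (x, τ) := fun x τ hx =>
      DFunLike.congr_fun hgr ⟨(x, τ), hx⟩
    refine ⟨g, g.continuous, fun y hy τ hτ => ?_⟩
    have key := hgood y hy τ hτ
    refine ⟨fun x1 x2 h1 h2 h3 => ?_, fun x hx => ?_⟩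
    · simp only [hge x1 τ (h1 ▸ hy), hge x2 τ (h2 ▸ hy)]
      exact key.1 x1 x2 h1 h2 h3
    · rw [hge x τ (hx ▸ hy)]; exact key.2 x hx

theorem sl_baire {X P : Type*} [TopologicalSpace X] [NormedAddCommGroup P] [CompleteSpace P]
    (G : ℕ → Set (X →ᵇ P)) (hG : ∀ n, @IsOpen _ (sourceLimitation X P) (G n))
    (hd : ∀ n (g : X →ᵇ P) (α : X → ℝ), Continuous α → (∀ x, 0 < α x) →
      ∃ g' ∈ G n, ∀ x, dist (g' x) (g x) ≤ α x) :
    @Dense _ (sourceLimitation X P) (⋂ n, G n) := by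
  letI := sourceLimitation X P
  rw [dense_iff_inter_open]
  intro U hU ⟨g0, hg0⟩
  obtain ⟨β, hβc, hβp, hβ⟩ := hU g0 hg0
  let S := {q : (X →ᵇ P) × (X → ℝ) // Continuous q.2 ∧ ∀ x, 0 < q.2 x}
  have hstep : ∀ (n : ℕ) (q : S), ∃ q' : S, (∀ x, q'.1.2 x ≤ q.1.2 x / 2) ∧
      (∀ x, dist (q'.1.1 x) (q.1.1 x) ≤ q.1.2 x / 2) ∧
      ∀ h : X →ᵇ P, (∀ x, dist (h x) (q'.1.1 x) ≤ q'.1.2 x) → h ∈ G n := by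
    rintro n ⟨⟨g, α⟩, hα, hp⟩
    obtain ⟨g', hg', hgg⟩ := hd n g (fun x => α x / 2) (by fun_prop) (fun x => half_pos (hp x))
    obtain ⟨γ, hγc, hγp, hγ⟩ := hG n g' hg'
    refine ⟨⟨(g', fun x => min (α x / 2) (γ x)), by fun_prop,
      fun x => lt_min (half_pos (hp x)) (hγp x)⟩, fun x => min_le_left _ _, hgg, ?_⟩
    exact fun h hh => hγ h fun x => (hh x).trans (min_le_right _ _)
  choose st h1 h2 h3 using hstep
  let q0 : S := ⟨(g0, fun x => min (β x) 1), by fun_prop, fun x => lt_min (hβp x) one_pos⟩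
  let q : ℕ → S := fun n => Nat.rec q0 (fun n q => st n q) n
  have hq : ∀ n, q (n + 1) = st n (q n) := fun n => rfl
  have a1 : ∀ n x, (q (n + 1)).1.2 x ≤ (q n).1.2 x / 2 := fun n x => h1 n (q n) x
  have a2 : ∀ n x, dist ((q (n + 1)).1.1 x) ((q n).1.1 x) ≤ (q n).1.2 x / 2 :=
    fun n x => h2 n (q n) x
  have a0 : ∀ n x, 0 < (q n).1.2 x := fun n x => (q n).2.2 x
  have a3 : ∀ n x, (q n).1.2 x ≤ 1 / 2 ^ n := by
    intro n x
    induction n with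
    | zero => exact (min_le_right _ _).trans (by norm_num)
    | succ n ih =>
      refine (a1 n x).trans ?_
      rw [pow_succ, ← div_div]
      linarith
  have hcau : CauchySeq (fun n => (q n).1.1) := by
    refine cauchySeq_of_le_geometric_two (C := 1) fun n => ?_
    rw [BoundedContinuousFunction.dist_le (by positivity)]
    intro x
    rw [dist_comm]
    refine (a2 n x).trans ?_
    have := a3 n x
    rw [div_right_comm]
    linarith
  obtain ⟨g, hg⟩ := @cauchySeq_tendsto_of_complete (X →ᵇ P) ℕ _ _ _ _ hcau
  have hgx : ∀ x, Filter.Tendsto (fun n => (q n).1.1 x) Filter.atTop (𝓝 (g x)) := by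
    intro x
    rw [tendsto_iff_dist_tendsto_zero]
    exact squeeze_zero (fun _ => dist_nonneg)
      (fun n => dist_coe_le_dist (f := (q n).1.1) (g := g) x) (tendsto_iff_dist_tendsto_zero.1 hg)
  have a4 : ∀ n j x, dist ((q (n + j)).1.1 x) ((q n).1.1 x) ≤ (q n).1.2 x - (q (n + j)).1.2 x := by
    intro n j x
    induction j with
    | zero => simp
    | succ j ih =>
      have b1 := a1 (n + j) x
      have b2 := a2 (n + j) x
      have := dist_triangle ((q (n + j + 1)).1.1 x) ((q (n + j)).1.1 x) ((q n).1.1 x)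
      rw [← add_assoc]
      linarith
  have a5 : ∀ n x, dist (g x) ((q n).1.1 x) ≤ (q n).1.2 x := by
    intro n x
    refine le_of_tendsto ((hgx x).dist tendsto_const_nhds) ?_
    filter_upwards [Filter.eventually_ge_atTop n] with j hj
    obtain ⟨i, rfl⟩ := Nat.exists_eq_add_of_le hj
    exact (a4 n i x).trans (by linarith [a0 (n + i) x])
  refine ⟨g, hβ g fun x => (a5 0 x).trans (min_le_left _ _), mem_iInter.2 fun n => ?_⟩
  exact h3 n (q n) g fun x => a5 (n + 1) x

theorem final_metric {X Y : Type*} [MetricSpace X] [MetricSpace Y]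
    (k m p : ℕ) (hp : 2 * k + m + 1 ≤ p)
    (f : X → Y) (hf : IsPerfectMap f) (hdimf : DimMapLE f k) (hdimY : CovDimLE Y m) :
    ∃ G : Set (X →ᵇ EuclideanSpace ℝ (Fin p)),
      @Dense _ (sourceLimitation X (EuclideanSpace ℝ (Fin p))) G ∧
      @IsGδ _ (sourceLimitation X (EuclideanSpace ℝ (Fin p))) G ∧
      ∀ g ∈ G, Function.Injective (fun x => (f x, g x)) ∧
        IsEmbedding (fun x => (f x, g x)) := by
  have hfp : IsProperMap f := isProperMap_iff_isClosedMap_and_compact_fibers.2 hf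
  obtain ⟨n, hn, Q, hQ, hQu⟩ : ∃ n, n ≤ m + 1 ∧ ∃ Q : Fin n → Set Y, (∀ i, ZD (Q i)) ∧
      univ ⊆ ⋃ i, Q i := by
    rcases hdimY with h | ⟨m', hm', h⟩
    · exact ⟨0, by omega, fun _ => ∅, fun i => i.elim0, fun y => (h.false y).elim⟩
    · obtain ⟨Q, h1, h2⟩ := zd_pieces m' h
      exact ⟨m' + 1, by omega, Q, h1, h2.ge⟩
  let G : ℕ → Set (X →ᵇ EuclideanSpace ℝ (Fin p)) := fun n =>
    {g | ∀ y, GoodAt f (1 / ((n : ℝ) + 1)) g y}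
  have hG : ∀ n, @IsOpen _ (sourceLimitation X (EuclideanSpace ℝ (Fin p))) (G n) := by
    intro n g hg
    obtain ⟨η, hη, h1, h2⟩ := margin (E := Fin 0 → ℝ) f hfp (1 / ((n : ℝ) + 1))
      (fun q => g q.1) (by fun_prop)
    have hpos : ∀ y, 0 < η (y, 0) := fun y => h1 y 0 (hg y)
    refine ⟨fun x => η (f x, 0) / 3, ?_, fun x => by have := hpos (f x); positivity, ?_⟩
    · have := hf.1
      fun_prop
    · intro h hh y
      refine h2 y 0 h fun x hx => (hh x).trans_lt ?_
      have := hpos y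
      simp only [hx]; linarith
  refine ⟨⋂ n, G n, sl_baire G hG ?_, ?_, ?_⟩
  · intro j g α hα hpos
    obtain ⟨u', hu', hA⟩ := main_ind f hfp (1 / ((j : ℝ) + 1)) (by positivity) k hdimf n univ
      isClosed_univ Q hQ hQu (Fin 0 → ℝ) {0} isCompact_singleton (by
        simp only [Module.finrank_fin_fun, finrank_euclideanSpace, Fintype.card_fin]; omega)
      (fun q => g q.1) (fun q => min (α q.1) 1) (by fun_prop) (by fun_prop)
      (fun x _ τ _ => lt_min (hpos x) one_pos)
    have hcl : ∀ x, dist (u' (x, 0)) (g x) < min (α x) 1 := fun x =>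
      (hA (f x) (mem_univ _) 0 rfl).2 x rfl
    refine ⟨BoundedContinuousFunction.ofNormedAddCommGroup (fun x => u' (x, 0)) (by fun_prop)
      (‖g‖ + 1) ?_, ?_, ?_⟩
    · intro x
      have h1 := (hcl x).trans_le (min_le_right _ _)
      rw [dist_eq_norm] at h1
      have h2 := norm_sub_norm_le (u' (x, 0)) (g x)
      have h3 := g.norm_coe_le_norm x
      linarith
    · exact fun y => (hA y (mem_univ _) 0 rfl).1
    · exact fun x => (hcl x).le.trans (min_le_left _ _)
  · exact @IsGδ.iInter_of_isOpen _ _ (sourceLimitation X (EuclideanSpace ℝ (Fin p))) _ _ hG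
  · intro g hg
    have hinj : Function.Injective (fun x => (f x, g x)) := by
      intro x1 x2 h
      obtain ⟨h1, h2⟩ := Prod.mk.inj h
      by_contra hne
      obtain ⟨j, hj⟩ := exists_nat_one_div_lt (dist_pos.2 hne)
      exact mem_iInter.1 hg j (f x2) x1 x2 h1 rfl hj.le h2
    have hc : Continuous (fun x => (f x, g x)) := hf.1.prodMk g.continuous
    have hpr : IsProperMap (fun x => (f x, g x)) :=
      isProperMap_of_comp_of_t2 hc continuous_fst hfp
    exact ⟨hinj, (IsClosedEmbedding.of_continuous_injective_isClosedMap hc hinj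
      hpr.isClosedMap).isEmbedding⟩

/-- Parametric Nöbeling–Pontryagin theorem: for a perfect map `f`
between finite-dimensional metrizable spaces with `dim f ≤ k`, `dim Y ≤ m` and
`p ≥ 2k + m + 1`, almost all bounded maps `g : X → ℝ^p` are such that `f × g` is
injective, hence an embedding. -/
theorem statement16 {X Y : Type*} [TopologicalSpace X] [TopologicalSpace.MetrizableSpace X]
    [TopologicalSpace Y] [TopologicalSpace.MetrizableSpace Y]
    (hX : FiniteDimSpace X) (hY : FiniteDimSpace Y)
    (k m p : ℕ) (hp : 2 * k + m + 1 ≤ p)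
    (f : X → Y) (hf : IsPerfectMap f) (hdimf : DimMapLE f k) (hdimY : CovDimLE Y m) :
    ∃ G : Set (X →ᵇ EuclideanSpace ℝ (Fin p)),
      @Dense _ (sourceLimitation X (EuclideanSpace ℝ (Fin p))) G ∧
      @IsGδ _ (sourceLimitation X (EuclideanSpace ℝ (Fin p))) G ∧
      ∀ g ∈ G, Function.Injective (fun x => (f x, g x)) ∧
        IsEmbedding (fun x => (f x, g x)) := by
  letI := TopologicalSpace.metrizableSpaceMetric X
  letI := TopologicalSpace.metrizableSpaceMetric Y
  exact final_metric k m p hp f hf hdimf hdimY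
end

section
/- Let f : X → Y be a perfect 0-dimensional surjective map between metrizable spaces with dim Y = m and let p ≥ 1. Suppose g ∈ C*(X, ℝ^p) is such that g(f⁻¹(y)) is 0-dimensional for every y ∈ Y and, for a fixed chain of F_σ-subsets Y₀ ⊆ Y₁ ⊆ … ⊆ Y_m of Y with dim Y_i ≤ i and dim(Y ∖ Y_i) ≤ m − i − 1, the map f×g is at most (⌊i/p⌋ + 1)-to-1 on f⁻¹(Y_i) for every 0 ≤ i ≤ m. Then for every n ≥ 1, dim B_n(f×g) ≤ m − (n−1)·p; that is, g is f-regularly branched. -/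
open Set Topology Metric BoundedContinuousFunction

namespace S19

lemma finite_ncard_of_finset {α : Type*} {s : Set α} {N : ℕ}
    (h : ∀ T : Finset α, (∀ a ∈ T, a ∈ s) → T.card ≤ N) : s.Finite ∧ s.ncard ≤ N := by
  have hfin : s.Finite := by
    by_contra hinf
    obtain ⟨T, hT, hc⟩ := (show s.Infinite from hinf).exists_subset_card_eq (N + 1)
    have := h T (fun a ha => hT ha)
    omega
  refine ⟨hfin, ?_⟩
  rw [Set.ncard_eq_toFinset_card s hfin]
  exact h _ (fun a ha => by simpa using ha)

lemma finset_card_le {α : Type*} {s : Set α} {N : ℕ} (hs : s.Finite) (hN : s.ncard ≤ N)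
    (T : Finset α) (hT : ∀ a ∈ T, a ∈ s) : T.card ≤ N := by
  rw [← Set.ncard_coe_finset]
  exact (Set.ncard_le_ncard (fun a ha => hT a ha) hs).trans hN

/-- Dimension bound passes along closed embeddings. -/
lemma covDim_closedEmbedding {X Y : Type*} [TopologicalSpace X] [TopologicalSpace Y] {n : ℕ}
    (e : X → Y) (he : IsClosedEmbedding e) (h : CovDimLENat Y n) : CovDimLENat X n := by
  intro 𝒰 hfin hop hcov
  have hW : ∀ U ∈ 𝒰, ∃ W : Set Y, IsOpen W ∧ e ⁻¹' W = U := fun U hU =>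
    he.isInducing.isOpen_iff.1 (hop U hU)
  choose! W hWo hWe using hW
  obtain ⟨𝒱, hVo, hVc, hVr, hVn⟩ := h (insert (range e)ᶜ (W '' 𝒰)) ((hfin.image W).insert _)
    (by
      rintro V (rfl | ⟨U, hU, rfl⟩)
      · exact he.isClosed_range.isOpen_compl
      · exact hWo U hU)
    (by
      rw [eq_univ_iff_forall]
      intro y
      by_cases hy : y ∈ range e
      · obtain ⟨x, rfl⟩ := hy
        have : x ∈ ⋃₀ 𝒰 := hcov ▸ mem_univ x
        obtain ⟨U, hU, hx⟩ := this
        refine ⟨W U, Or.inr ⟨U, hU, rfl⟩, ?_⟩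
        rw [← hWe U hU] at hx
        exact hx
      · exact ⟨_, Or.inl rfl, hy⟩)
  refine ⟨{S | ∃ V ∈ 𝒱, e ⁻¹' V = S ∧ S.Nonempty}, ?_, ?_, ?_, ?_⟩
  · rintro _ ⟨V, hV, rfl, -⟩
    exact (hVo V hV).preimage he.continuous
  · rw [eq_univ_iff_forall]
    intro x
    have : e x ∈ ⋃₀ 𝒱 := hVc ▸ mem_univ _
    obtain ⟨V, hV, hx⟩ := this
    exact ⟨e ⁻¹' V, ⟨V, hV, rfl, ⟨x, hx⟩⟩, hx⟩
  · rintro _ ⟨V, hV, rfl, ⟨x, hx⟩⟩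
    obtain ⟨U', hU', hVU⟩ := hVr V hV
    rcases hU' with rfl | ⟨U, hU, rfl⟩
    · exact absurd (mem_range_self x) (hVU hx)
    · refine ⟨U, hU, ?_⟩
      conv_rhs => rw [← hWe U hU]
      exact preimage_mono hVU
  · intro x
    apply finite_ncard_of_finset
    classical
    intro T hT
    have h1 : ∀ S ∈ T, ∃ V ∈ 𝒱, e ⁻¹' V = S := fun S hS => by
      obtain ⟨⟨V, hV, h1, -⟩, -⟩ := hT S hS
      exact ⟨V, hV, h1⟩
    choose! φ hφ hφe using h1
    have hinj : Set.InjOn φ T := fun a ha b hb hab => by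
      rw [← hφe a ha, ← hφe b hb, hab]
    rw [← Finset.card_image_of_injOn hinj]
    refine finset_card_le (hVn (e x)).1 (hVn (e x)).2 _ ?_
    intro V hV
    obtain ⟨S, hS, rfl⟩ := Finset.mem_image.1 hV
    refine ⟨hφ S hS, ?_⟩
    have := (hT S hS).2
    rw [← hφe S hS] at this
    exact this

/-- Swelling of a locally finite closed family in a metric space. -/
lemma swelling {X ι : Type*} [MetricSpace X] {n : ℕ} (A U : ι → Set X)
    (hA : ∀ i, IsClosed (A i)) (hU : ∀ i, IsOpen (U i)) (hAU : ∀ i, A i ⊆ U i)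
    (hlf : LocallyFinite A)
    (hord : ∀ x, ∀ T : Finset ι, (∀ i ∈ T, x ∈ A i) → T.card ≤ n) :
    ∃ W : ι → Set X, (∀ i, IsOpen (W i)) ∧ (∀ i, W i ⊆ U i) ∧ (∀ i, A i ⊆ W i) ∧
      ∀ x, ∀ T : Finset ι, (∀ i ∈ T, x ∈ W i) → T.card ≤ n := by
  classical
  let D : ι → Set X := fun i => {x | ∀ T : Finset ι, T.card = n + 1 →
    ∃ j ∈ T, infEDist x (A i) < infEDist x (A j)}
  refine ⟨fun i => U i ∩ interior (D i), fun i => (hU i).inter isOpen_interior,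
    fun i => inter_subset_left, ?_, ?_⟩
  · intro i x hx
    refine ⟨hAU i hx, ?_⟩
    have hcl : IsClosed (⋃ j : {j // x ∉ A j}, A j) :=
      (hlf.comp_injective Subtype.val_injective).isClosed_iUnion (fun j => hA j)
    have hxn : x ∈ (⋃ j : {j // x ∉ A j}, A j)ᶜ := by
      simp only [mem_compl_iff, mem_iUnion, not_exists]
      rintro ⟨j, hj⟩ h
      exact hj h
    obtain ⟨ε, hε, hball⟩ := EMetric.isOpen_iff.1 hcl.isOpen_compl x hxn
    obtain ⟨δ, hδ, hδε⟩ : ∃ δ : ENNReal, 0 < δ ∧ δ + δ ≤ ε :=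
      ⟨ε / 2, ENNReal.half_pos hε.ne', (ENNReal.add_halves ε).le⟩
    rw [mem_interior]
    refine ⟨eball x δ, ?_, isOpen_eball, mem_eball_self hδ⟩
    intro y hy T hT
    have hy' : edist y x < δ := hy
    have : ∃ j ∈ T, x ∉ A j := by
      by_contra hcon
      push Not at hcon
      have := hord x T hcon
      omega
    obtain ⟨j, hjT, hj⟩ := this
    refine ⟨j, hjT, ?_⟩
    have h1 : infEDist y (A i) < δ := (infEDist_le_edist_of_mem hx).trans_lt hy'
    refine h1.trans_le ?_
    rw [le_infEDist]
    intro z hz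
    by_contra hcon
    push Not at hcon
    have h2 : z ∈ eball x ε := by
      have : edist z x ≤ edist y z + edist y x := edist_triangle_left z x y
      exact (this.trans_lt (ENNReal.add_lt_add hcon hy')).trans_le hδε
    exact hball h2 (mem_iUnion.2 ⟨⟨j, hj⟩, hz⟩)
  · intro x T hT
    by_contra hcon
    push Not at hcon
    obtain ⟨T', hT', hc⟩ := Finset.exists_subset_card_eq (show n + 1 ≤ T.card from hcon)
    have hne : T'.Nonempty := Finset.card_pos.1 (by omega)
    obtain ⟨i, hi, hmax⟩ := T'.exists_max_image (fun i => infEDist x (A i)) hne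
    obtain ⟨j, hj, hlt⟩ := interior_subset (hT i (hT' hi)).2 T' hc
    exact absurd (hmax j hj) (not_le.2 hlt)

/-- One shrinking step. -/
lemma step {X ι : Type*} [TopologicalSpace X] [NormalSpace X] {n : ℕ} (V : ι → Set X) (F : Set X)
    (hV : ∀ i, IsOpen (V i)) (hpf : ∀ x, {i | x ∈ V i}.Finite) (hcov : ⋃ i, V i = univ)
    (hF : IsClosed F) (hFd : CovDimLENat F n) (hFf : {i | (V i ∩ F).Nonempty}.Finite) :
    ∃ V' : ι → Set X, (∀ i, IsOpen (V' i)) ∧ (∀ i, closure (V' i) ⊆ V i) ∧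
      (⋃ i, V' i = univ) ∧
      ∀ x ∈ F, ∀ T : Finset ι, (∀ i ∈ T, x ∈ closure (V' i)) → T.card ≤ n + 1 := by
  classical
  obtain ⟨𝒱, hVo, hVc, hVr, hVn⟩ := hFd (range fun i => ((↑) : F → X) ⁻¹' (V i))
    (by
      refine ((hFf.image fun i => ((↑) : F → X) ⁻¹' (V i)).insert ∅).subset ?_
      rintro _ ⟨i, rfl⟩
      by_cases hi : (V i ∩ F).Nonempty
      · exact Or.inr ⟨i, hi, rfl⟩
      · refine Or.inl ?_
        ext ⟨x, hx⟩
        simp only [mem_preimage, mem_empty_iff_false, iff_false]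
        exact fun h => hi ⟨x, h, hx⟩)
    (by
      rintro _ ⟨i, rfl⟩
      exact (hV i).preimage continuous_subtype_val)
    (by
      rw [eq_univ_iff_forall]
      intro x
      obtain ⟨i, hi⟩ := mem_iUnion.1 (hcov ▸ mem_univ (x : X) : (x : X) ∈ ⋃ i, V i)
      exact ⟨_, ⟨i, rfl⟩, hi⟩)
  have hch : ∀ S ∈ 𝒱, ∃ i, S ⊆ ((↑) : F → X) ⁻¹' (V i) := fun S hS => by
    obtain ⟨_, ⟨i, rfl⟩, h⟩ := hVr S hS
    exact ⟨i, h⟩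
  let O : ι → Set F := fun i => ⋃₀ {S ∈ 𝒱 | ∃ h : S ∈ 𝒱, (hch S h).choose = i}
  have hOo : ∀ i, IsOpen (O i) := fun i => isOpen_sUnion fun S hS => hVo S hS.1
  have hOV : ∀ i, O i ⊆ ((↑) : F → X) ⁻¹' (V i) := by
    rintro i x ⟨S, ⟨hS, h, rfl⟩, hx⟩
    exact (hch S h).choose_spec hx
  have hOc : ∀ x : F, ∃ i, x ∈ O i := fun x => by
    obtain ⟨S, hS, hx⟩ := (hVc ▸ mem_univ x : x ∈ ⋃₀ 𝒱)
    exact ⟨_, S, ⟨hS, hS, rfl⟩, hx⟩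
  have hOn : ∀ x : F, ∀ T : Finset ι, (∀ i ∈ T, x ∈ O i) → T.card ≤ n + 1 := by
    intro x T hT
    have h1 : ∀ i ∈ T, ∃ S, ∃ h : S ∈ 𝒱, (hch S h).choose = i ∧ x ∈ S := fun i hi => by
      obtain ⟨S, ⟨_, h, h'⟩, hx⟩ := hT i hi
      exact ⟨S, h, h', hx⟩
    choose! φ hφ using h1
    have hinj : Set.InjOn φ T := fun a ha b hb hab => by
      obtain ⟨h1, h2, -⟩ := hφ a ha
      obtain ⟨h3, h4, -⟩ := hφ b hb
      rw [← h2, ← h4]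
      congr 1
      simp only [hab]
    rw [← Finset.card_image_of_injOn hinj]
    refine finset_card_le (hVn x).1 (hVn x).2 _ ?_
    intro S hS
    obtain ⟨i, hi, rfl⟩ := Finset.mem_image.1 hS
    obtain ⟨h1, h2, h3⟩ := hφ i hi
    exact ⟨h1, h3⟩
  let V2 : ι → Set X := fun i => V i \ (((↑) : F → X) '' (O i)ᶜ)
  have hV2o : ∀ i, IsOpen (V2 i) := fun i =>
    (hV i).sdiff (hF.isClosedEmbedding_subtypeVal.isClosedMap _ (hOo i).isClosed_compl)
  have hV2c : ⋃ i, V2 i = univ := by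
    rw [eq_univ_iff_forall]
    intro x
    rw [mem_iUnion]
    by_cases hx : x ∈ F
    · obtain ⟨i, hi⟩ := hOc ⟨x, hx⟩
      refine ⟨i, hOV i hi, ?_⟩
      rintro ⟨y, hy, rfl⟩
      exact hy hi
    · obtain ⟨i, hi⟩ := mem_iUnion.1 (hcov ▸ mem_univ x : x ∈ ⋃ i, V i)
      refine ⟨i, hi, ?_⟩
      rintro ⟨y, hy, rfl⟩
      exact hx y.2
  obtain ⟨V', h1, h2, h3⟩ := exists_iUnion_eq_closure_subset hV2o
    (fun x => (hpf x).subset fun i hi => hi.1) hV2c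
  refine ⟨V', h2, fun i => (h3 i).trans sdiff_subset, h1, ?_⟩
  intro x hx T hT
  refine hOn ⟨x, hx⟩ T fun i hi => ?_
  by_contra hcon
  exact (h3 i (hT i hi)).2 ⟨⟨x, hx⟩, hcon, rfl⟩

lemma lemmaA {X ι : Type*} [MetricSpace X] {n : ℕ} (U : ι → Set X) (F : ℕ → Set X)
    (hU : ∀ i, IsOpen (U i)) (hlf : LocallyFinite U) (hcov : ⋃ i, U i = univ)
    (hF : ∀ k, IsClosed (F k)) (hFc : ∀ x, ∃ k, x ∈ F k) (hFd : ∀ k, CovDimLENat (F k) n)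
    (hFf : ∀ k, {i | (U i ∩ F k).Nonempty}.Finite) :
    ∃ W : ι → Set X, (∀ i, IsOpen (W i)) ∧ (∀ i, W i ⊆ U i) ∧ (⋃ i, W i = univ) ∧
      ∀ x, ∀ T : Finset ι, (∀ i ∈ T, x ∈ W i) → T.card ≤ n + 1 := by
  classical
  let P : Type _ := {V : ι → Set X // (∀ i, IsOpen (V i)) ∧ (∀ i, V i ⊆ U i) ∧ ⋃ i, V i = univ}
  have hstep : ∀ (k : ℕ) (V : P), ∃ V' : P, (∀ i, closure (V'.1 i) ⊆ V.1 i) ∧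
      ∀ x ∈ F k, ∀ T : Finset ι, (∀ i ∈ T, x ∈ closure (V'.1 i)) → T.card ≤ n + 1 := by
    rintro k ⟨V, hVo, hVU, hVc⟩
    obtain ⟨V', h1, h2, h3, h4⟩ := step V (F k) hVo
      (fun x => (hlf.point_finite x).subset fun i hi => hVU i hi) hVc (hF k) (hFd k)
      ((hFf k).subset fun i hi => hi.mono (inter_subset_inter_left _ (hVU i)))
    exact ⟨⟨V', h1, fun i => (subset_closure.trans (h2 i)).trans (hVU i), h3⟩, h2, h4⟩
  choose nxt hn1 hn2 using hstep
  let V : ℕ → P := fun k => Nat.rec ⟨U, hU, fun i => Subset.rfl, hcov⟩ (fun k v => nxt k v) k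
  have hVs : ∀ k, V (k + 1) = nxt k (V k) := fun k => rfl
  have hanti : ∀ i, Antitone fun k => (V k).1 i := fun i =>
    antitone_nat_of_succ_le fun k => by
      rw [hVs]
      exact subset_closure.trans (hn1 k (V k) i)
  let A : ι → Set X := fun i => ⋂ k, closure ((V (k + 1)).1 i)
  have hAU : ∀ i, A i ⊆ U i := fun i x hx => by
    have := mem_iInter.1 hx 0
    exact hn1 0 (V 0) i this
  obtain ⟨W, hW1, hW2, hW3, hW4⟩ := swelling (n := n + 1) A U
    (fun i => isClosed_iInter fun k => isClosed_closure) hU hAU (hlf.subset hAU) (by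
      intro x T hT
      obtain ⟨k, hk⟩ := hFc x
      exact hn2 k (V k) x hk T fun i hi => mem_iInter.1 (hT i hi) k)
  refine ⟨W, hW1, hW2, ?_, hW4⟩
  rw [eq_univ_iff_forall]
  intro x
  have h1 : ∀ k, ∃ i, x ∈ (V k).1 i := fun k =>
    mem_iUnion.1 (show x ∈ ⋃ i, (V k).1 i by rw [(V k).2.2.2]; exact mem_univ x)
  choose φ hφ using h1
  have hfin : Finite {i | x ∈ U i} := hlf.point_finite x
  obtain ⟨⟨i, hi0⟩, hi⟩ := Finite.exists_infinite_fiber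
    (fun k : ℕ => (⟨φ k, (V k).2.2.1 _ (hφ k)⟩ : {i | x ∈ U i}))
  rw [mem_iUnion]
  refine ⟨i, hW3 i ?_⟩
  refine mem_iInter.2 fun k => subset_closure ?_
  obtain ⟨l, hl, hkl⟩ := (Set.infinite_coe_iff.1 hi).exists_gt (k + 1)
  have hl' : φ l = i := by simpa using hl
  exact hanti i hkl.le (show x ∈ (V l).1 i by rw [← hl']; exact hφ l)

/-- Countable sum theorem. -/
lemma sum_theorem {X : Type*} [TopologicalSpace X] [TopologicalSpace.MetrizableSpace X] {n : ℕ}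
    (F : ℕ → Set X) (hF : ∀ k, IsClosed (F k)) (hFc : ∀ x, ∃ k, x ∈ F k)
    (hFd : ∀ k, CovDimLENat (F k) n) : CovDimLENat X n := by
  let _ := TopologicalSpace.metrizableSpaceMetric X
  intro 𝒰 hfin hop hcov
  have : Finite 𝒰 := hfin
  obtain ⟨W, h1, h2, h3, h4⟩ := lemmaA (fun i : 𝒰 => (i : Set X)) F (fun i => hop i i.2)
    (locallyFinite_of_finite _) (by rw [← sUnion_eq_iUnion]; exact hcov) hF hFc hFd
    (fun k => Set.toFinite _)
  refine ⟨range W, ?_, ?_, ?_, ?_⟩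
  · rintro _ ⟨i, rfl⟩
    exact h1 i
  · rw [sUnion_range]
    exact h3
  · rintro _ ⟨i, rfl⟩
    exact ⟨i, i.2, h2 i⟩
  · intro x
    apply finite_ncard_of_finset
    classical
    intro T hT
    have h1 : ∀ S : T, ∃ i, W i = S.1 := fun S => (hT S.1 S.2).1
    choose φ hφe using h1
    have hinj : Function.Injective φ := fun a b hab => by
      apply Subtype.ext
      rw [← hφe a, ← hφe b, hab]
    have := h4 x (T.attach.image φ) (by
      intro i hi
      obtain ⟨S, -, rfl⟩ := Finset.mem_image.1 hi
      rw [hφe]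
      exact (hT S.1 S.2).2)
    rwa [Finset.card_image_of_injective _ hinj, Finset.card_attach] at this

/-- Arbitrary open covers of a metrizable space of dimension at most `n`. -/
lemma dowker {Y S : Type*} [TopologicalSpace Y] [TopologicalSpace.MetrizableSpace Y] {n : ℕ}
    (hY : CovDimLENat Y n) (N : S → Set Y) (hN : ∀ s, IsOpen (N s)) (hcov : ∀ y, ∃ s, y ∈ N s) :
    ∃ M : ℕ × S → Set Y, (∀ κ, IsOpen (M κ)) ∧ (∀ κ, M κ ⊆ N κ.2) ∧ (∀ y, ∃ κ, y ∈ M κ) ∧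
      ∀ y, ∀ T : Finset (ℕ × S), (∀ κ ∈ T, y ∈ M κ) → T.card ≤ n + 1 := by
  classical
  let _ := TopologicalSpace.metrizableSpaceMetric Y
  have hwf : WellFounded (WellOrderingRel : S → S → Prop) := WellOrderingRel.isWellOrder.wf
  let r : ℕ → ENNReal := fun j => ((j : ENNReal) + 1)⁻¹
  have hr : ∀ j, 0 < r j := fun j => ENNReal.inv_pos.2 (by finiteness)
  have hrlim : ∀ ε : ENNReal, 0 < ε → ∀ k : ℕ, ∃ j, k ≤ j ∧ r j + r j < ε := by
    intro ε hε k
    obtain ⟨j, hj⟩ := ENNReal.exists_inv_nat_lt (ENNReal.half_pos hε.ne').ne'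
    refine ⟨max j k, le_max_right _ _, ?_⟩
    have h1 : r (max j k) < ε / 2 := by
      refine lt_of_le_of_lt ?_ hj
      refine ENNReal.inv_le_inv.2 ?_
      have : j ≤ max j k + 1 := by omega
      exact_mod_cast this
    calc r (max j k) + r (max j k) < ε / 2 + ε / 2 := ENNReal.add_lt_add h1 h1
      _ = ε := ENNReal.add_halves ε
  let E : ℕ → S → Set Y := fun j s =>
    {x | eball x (r j + r j) ⊆ N s ∧ ∀ t, WellOrderingRel t s → x ∉ N t}
  let O : ℕ → S → Set Y := fun j s => ⋃ x ∈ E j s, eball x (r j)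
  have hOo : ∀ j s, IsOpen (O j s) := fun j s => isOpen_biUnion fun x _ => isOpen_eball
  have hON : ∀ j s, O j s ⊆ N s := by
    intro j s y hy
    obtain ⟨x, hx, hyx⟩ := mem_iUnion₂.1 hy
    exact hx.1 (eball_subset_eball le_self_add hyx)
  have hdis0 : ∀ j s t y, WellOrderingRel t s → y ∈ O j s → y ∈ O j t → False := by
    intro j s t y hts hys hyt
    obtain ⟨a, ha, hya⟩ := mem_iUnion₂.1 hys
    obtain ⟨b, hb, hyb⟩ := mem_iUnion₂.1 hyt
    refine ha.2 t hts (hb.1 ?_)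
    have : edist a b ≤ edist y a + edist y b := edist_triangle_left a b y
    exact this.trans_lt (ENNReal.add_lt_add hya hyb)
  have hdis : ∀ j s t y, y ∈ O j s → y ∈ O j t → s = t := by
    intro j s t y hs ht
    rcases trichotomous_of WellOrderingRel s t with h | h | h
    · exact (hdis0 j t s y h ht hs).elim
    · exact h
    · exact (hdis0 j s t y h hs ht).elim
  have hOc : ∀ y, ∃ j s, y ∈ O j s := by
    intro y
    let s := hwf.min {s | y ∈ N s} (hcov y)
    have hs : y ∈ N s := hwf.min_mem {s | y ∈ N s} (hcov y)
    obtain ⟨ε, hε, hball⟩ := EMetric.isOpen_iff.1 (hN s) y hs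
    obtain ⟨j, -, hj⟩ := hrlim ε hε 0
    refine ⟨j, s, mem_iUnion₂.2 ⟨y, ⟨(eball_subset_eball hj.le).trans hball, ?_⟩,
      mem_eball_self (hr j)⟩⟩
    intro t hts hyt
    exact hwf.not_lt_min {s | y ∈ N s} hyt hts
  let Q : ℕ → Set Y := fun j => ⋃ s, O j s
  have hQo : ∀ j, IsOpen (Q j) := fun j => isOpen_iUnion fun s => hOo j s
  let P : ℕ → Set Y := fun j => ⋃ i ≤ j, Q i
  have hPo : ∀ j, IsOpen (P j) := fun j => isOpen_biUnion fun i _ => hQo i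
  have hPm : ∀ i j, i ≤ j → P i ⊆ P j := fun i j hij =>
    biUnion_subset_biUnion_left fun l hl => le_trans hl hij
  let F : ℕ → Set Y := fun j => {x | r j ≤ infEDist x (P j)ᶜ}
  have hFcl : ∀ j, IsClosed (F j) := fun j => isClosed_le continuous_const continuous_infEDist
  have hFP : ∀ j, F j ⊆ P j := by
    intro j x hx
    by_contra hcon
    have h0 : infEDist x (P j)ᶜ = 0 := infEDist_zero_of_mem hcon
    have hx' : r j ≤ infEDist x (P j)ᶜ := hx
    rw [h0] at hx'
    exact absurd hx' (not_le.2 (hr j))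
  have hFi : ∀ y, ∃ j, ∃ G, IsOpen G ∧ y ∈ G ∧ G ⊆ F j := by
    intro y
    obtain ⟨k, s, hk⟩ := hOc y
    have hyP : y ∈ P k := mem_iUnion₂.2 ⟨k, le_rfl, mem_iUnion.2 ⟨s, hk⟩⟩
    have hpos : 0 < infEDist y (P k)ᶜ := by
      rw [pos_iff_ne_zero]
      intro h0
      exact ((mem_iff_infEDist_zero_of_closed (hPo k).isClosed_compl).2 h0) hyP
    obtain ⟨j, hkj, hj⟩ := hrlim _ hpos k
    refine ⟨j, {x | r j < infEDist x (P j)ᶜ}, isOpen_lt continuous_const continuous_infEDist,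
      ?_, fun x (hx : r j < infEDist x (P j)ᶜ) => hx.le⟩
    have h1 : infEDist y (P k)ᶜ ≤ infEDist y (P j)ᶜ :=
      infEDist_anti (compl_subset_compl.2 (hPm k j hkj))
    exact (le_self_add.trans_lt hj).trans_le h1
  let U : ℕ → Set Y := fun j => Q j \ ⋃ i ∈ Finset.range j, F i
  have hUF : ∀ l k, (U l ∩ F k).Nonempty → l ≤ k := by
    rintro l k ⟨x, hx, hxF⟩
    by_contra hcon
    push Not at hcon
    exact hx.2 (mem_iUnion₂.2 ⟨k, Finset.mem_range.2 hcon, hxF⟩)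
  have hUo : ∀ j, IsOpen (U j) := fun j =>
    (hQo j).sdiff ((Finset.range j).finite_toSet.isClosed_biUnion fun i _ => hFcl i)
  obtain ⟨W, hW1, hW2, hW3, hW4⟩ := lemmaA (n := n) U F hUo
    (by
      intro y
      obtain ⟨j, G, hG, hyG, hGF⟩ := hFi y
      refine ⟨G, hG.mem_nhds hyG, (Set.finite_le_nat j).subset ?_⟩
      intro l hl
      exact hUF l j (hl.mono (inter_subset_inter_right _ hGF)))
    (by
      rw [eq_univ_iff_forall]
      intro y
      have hex : ∃ j, y ∈ Q j := by
        obtain ⟨k, s, hk⟩ := hOc y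
        exact ⟨k, mem_iUnion.2 ⟨s, hk⟩⟩
      refine mem_iUnion.2 ⟨Nat.find hex, Nat.find_spec hex, ?_⟩
      intro hcon
      obtain ⟨i, hi, hyF⟩ := mem_iUnion₂.1 hcon
      obtain ⟨l, hl, hyl⟩ := mem_iUnion₂.1 (hFP i hyF)
      exact Nat.find_min hex (lt_of_le_of_lt hl (Finset.mem_range.1 hi)) hyl)
    hFcl
    (fun y => by
      obtain ⟨j, G, -, hyG, hGF⟩ := hFi y
      exact ⟨j, hGF hyG⟩)
    (fun k => covDim_closedEmbedding _ (hFcl k).isClosedEmbedding_subtypeVal hY)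
    (fun k => (Set.finite_le_nat k).subset fun l hl => hUF l k hl)
  refine ⟨fun κ => W κ.1 ∩ O κ.1 κ.2, fun κ => (hW1 _).inter (hOo _ _),
    fun κ => inter_subset_right.trans (hON _ _), ?_, ?_⟩
  · intro y
    obtain ⟨j, hj⟩ := mem_iUnion.1 (hW3 ▸ mem_univ y : y ∈ ⋃ j, W j)
    obtain ⟨s, hs⟩ := mem_iUnion.1 (hW2 j hj).1
    exact ⟨(j, s), hj, hs⟩
  · intro y T hT
    have hinj : Set.InjOn Prod.fst (T : Set (ℕ × S)) := by
      rintro ⟨j, s⟩ hs ⟨j', t⟩ ht hab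
      obtain rfl : j = j' := hab
      rw [hdis j s t y (hT _ hs).2 (hT _ ht).2]
    rw [← Finset.card_image_of_injOn hinj]
    refine hW4 y _ ?_
    intro j hj
    obtain ⟨κ, hκ, rfl⟩ := Finset.mem_image.1 hj
    exact (hT κ hκ).1

/-- Closed maps with compact zero-dimensional fibers do not raise dimension of the domain. -/
lemma perfect_dim {E Y : Type*} [TopologicalSpace E] [TopologicalSpace.MetrizableSpace E]
    [TopologicalSpace Y] [TopologicalSpace.MetrizableSpace Y] {n : ℕ} (hY : CovDimLENat Y n)
    (q : E → Y) (hq : IsProperMap q) (hd : ∀ y, CovDimLE (q ⁻¹' {y}) 0) : CovDimLENat E n := by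
  classical
  let _ := TopologicalSpace.metrizableSpaceMetric E
  intro 𝒰 hfin hop hcov
  have key : ∀ y, ∃ (Ny : Set Y) (G : Set E → Set E), IsOpen Ny ∧ y ∈ Ny ∧
      (∀ U ∈ 𝒰, IsOpen (G U) ∧ G U ⊆ U) ∧
      (∀ U ∈ 𝒰, ∀ V ∈ 𝒰, ∀ x, x ∈ G U → x ∈ G V → U = V) ∧
      ∀ x, q x ∈ Ny → ∃ U ∈ 𝒰, x ∈ G U := by
    intro y
    have hK : ∃ K : Set E → Set E, (∀ U ∈ 𝒰, IsClosed (K U) ∧ K U ⊆ U) ∧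
        (∀ U ∈ 𝒰, ∀ V ∈ 𝒰, ∀ x, x ∈ K U → x ∈ K V → U = V) ∧
        ∀ x, q x = y → ∃ U ∈ 𝒰, x ∈ K U := by
      rcases hd y with hemp | ⟨k, hk, hk0⟩
      · exact ⟨fun _ => ∅, by simp, by simp, fun x hx => (hemp.false ⟨x, hx⟩).elim⟩
      obtain rfl : k = 0 := by omega
      obtain ⟨𝒱, hVo, hVc, hVr, hVn⟩ :=
        hk0 ((fun U => ((↑) : (q ⁻¹' {y}) → E) ⁻¹' U) '' 𝒰) (hfin.image _)
        (by
          rintro _ ⟨U, hU, rfl⟩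
          exact (hop U hU).preimage continuous_subtype_val)
        (by
          rw [eq_univ_iff_forall]
          intro x
          obtain ⟨U, hU, hx⟩ := (hcov ▸ mem_univ (x : E) : (x : E) ∈ ⋃₀ 𝒰)
          exact ⟨_, ⟨U, hU, rfl⟩, hx⟩)
      have hch : ∀ S ∈ 𝒱, ∃ U ∈ 𝒰, S ⊆ ((↑) : (q ⁻¹' {y}) → E) ⁻¹' U := fun S hS => by
        obtain ⟨_, ⟨U, hU, rfl⟩, h⟩ := hVr S hS
        exact ⟨U, hU, h⟩
      choose! φ hφ1 hφ2 using hch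
      have huniq : ∀ S ∈ 𝒱, ∀ S' ∈ 𝒱, ∀ x, x ∈ S → x ∈ S' → S = S' := by
        intro S hS S' hS' x hx hx'
        by_contra hne
        have := finset_card_le (hVn x).1 (hVn x).2 {S, S'} (by
          intro a ha
          rcases Finset.mem_insert.1 ha with rfl | ha
          · exact ⟨hS, hx⟩
          · rw [Finset.mem_singleton.1 ha]
            exact ⟨hS', hx'⟩)
        rw [Finset.card_pair hne] at this
        omega
      let L : Set E → Set (q ⁻¹' {y}) := fun U => ⋃₀ {S ∈ 𝒱 | φ S = U}
      have hLo : ∀ U, IsOpen (L U) := fun U => isOpen_sUnion fun S hS => hVo S hS.1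
      have hLu : ∀ U V x, x ∈ L U → x ∈ L V → U = V := by
        rintro U V x ⟨S, ⟨hS, rfl⟩, hx⟩ ⟨S', ⟨hS', rfl⟩, hx'⟩
        rw [huniq S hS S' hS' x hx hx']
      have hLc : ∀ x, ∃ U ∈ 𝒰, x ∈ L U := fun x => by
        obtain ⟨S, hS, hx⟩ := (hVc ▸ mem_univ x : x ∈ ⋃₀ 𝒱)
        exact ⟨φ S, hφ1 S hS, S, ⟨hS, rfl⟩, hx⟩
      have hLcl : ∀ U, IsClosed (L U) := by
        intro U
        have : L U = (⋃ V ∈ {V | V ≠ U}, L V)ᶜ := by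
          ext x
          simp only [mem_compl_iff, mem_iUnion, not_exists]
          constructor
          · intro hx V hV hxV
            exact hV (hLu V U x hxV hx)
          · intro h
            obtain ⟨V, -, hxV⟩ := hLc x
            by_cases hVU : V = U
            · exact hVU ▸ hxV
            · exact (h V hVU hxV).elim
        rw [this]
        exact (isOpen_biUnion fun V _ => hLo V).isClosed_compl
      have hfc : IsClosed (q ⁻¹' {y}) := isClosed_singleton.preimage hq.continuous
      refine ⟨fun U => ((↑) : (q ⁻¹' {y}) → E) '' (L U), ?_, ?_, ?_⟩
      · intro U hU
        refine ⟨hfc.isClosedEmbedding_subtypeVal.isClosedMap _ (hLcl U), ?_⟩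
        rintro _ ⟨x, ⟨S, ⟨hS, rfl⟩, hx⟩, rfl⟩
        exact hφ2 S hS hx
      · rintro U - V - _ ⟨x, hx, rfl⟩ ⟨x', hx', h⟩
        obtain rfl : x' = x := Subtype.ext h
        exact hLu U V x' hx hx'
      · intro x hx
        obtain ⟨U, hU, h⟩ := hLc ⟨x, hx⟩
        exact ⟨U, hU, ⟨x, hx⟩, h, rfl⟩
    obtain ⟨K, hK1, hK2, hK3⟩ := hK
    let G : Set E → Set E := fun U =>
      U ∩ ⋂ V ∈ {V ∈ 𝒰 | V ≠ U}, {x | infEDist x (K U) < infEDist x (K V)}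
    have hGo : ∀ U ∈ 𝒰, IsOpen (G U) := fun U hU =>
      (hop U hU).inter ((hfin.subset fun V hV => hV.1).isOpen_biInter fun V _ =>
        isOpen_lt continuous_infEDist continuous_infEDist)
    refine ⟨(q '' (⋃ U ∈ 𝒰, G U)ᶜ)ᶜ, G, ?_, ?_, ?_, ?_, ?_⟩
    · exact (hq.isClosedMap _ (isOpen_biUnion hGo).isClosed_compl).isOpen_compl
    · rintro ⟨x, hx, hxy⟩
      obtain ⟨U, hU, hxU⟩ := hK3 x hxy
      refine hx (mem_iUnion₂.2 ⟨U, hU, (hK1 U hU).2 hxU, mem_iInter₂.2 ?_⟩)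
      rintro V ⟨hV, hVU⟩
      change infEDist x (K U) < infEDist x (K V)
      rw [infEDist_zero_of_mem hxU, pos_iff_ne_zero]
      intro h0
      exact hVU (hK2 V hV U hU x ((mem_iff_infEDist_zero_of_closed (hK1 V hV).1).2 h0) hxU)
    · exact fun U hU => ⟨hGo U hU, inter_subset_left⟩
    · intro U hU V hV x hx hx'
      by_contra hne
      have h1 : infEDist x (K U) < infEDist x (K V) := mem_iInter₂.1 hx.2 V ⟨hV, Ne.symm hne⟩
      have h2 : infEDist x (K V) < infEDist x (K U) := mem_iInter₂.1 hx'.2 U ⟨hU, hne⟩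
      exact lt_asymm h1 h2
    · intro x hx
      by_contra hcon
      refine hx ⟨x, ?_, rfl⟩
      intro h
      obtain ⟨U, hU, hxU⟩ := mem_iUnion₂.1 h
      exact hcon ⟨U, hU, hxU⟩
  choose N G hNo hyN hG1 hG2 hG3 using key
  obtain ⟨M, hM1, hM2, hM3, hM4⟩ := dowker hY N hNo (fun y => ⟨y, hyN y⟩)
  refine ⟨{S | ∃ κ, ∃ U ∈ 𝒰, S = q ⁻¹' (M κ) ∩ G κ.2 U}, ?_, ?_, ?_, ?_⟩
  · rintro _ ⟨κ, U, hU, rfl⟩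
    exact ((hM1 κ).preimage hq.continuous).inter (hG1 _ U hU).1
  · rw [eq_univ_iff_forall]
    intro x
    obtain ⟨κ, hκ⟩ := hM3 (q x)
    obtain ⟨U, hU, hx⟩ := hG3 κ.2 x (hM2 κ hκ)
    exact ⟨_, ⟨κ, U, hU, rfl⟩, hκ, hx⟩
  · rintro _ ⟨κ, U, hU, rfl⟩
    exact ⟨U, hU, inter_subset_right.trans (hG1 _ U hU).2⟩
  · intro x
    apply finite_ncard_of_finset
    intro T hT
    have h1 : ∀ S : T, ∃ κ, ∃ U ∈ 𝒰, S.1 = q ⁻¹' (M κ) ∩ G κ.2 U := fun S => (hT S.1 S.2).1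
    choose κ U hU hS using h1
    have hmem : ∀ S : T, q x ∈ M (κ S) ∧ x ∈ G (κ S).2 (U S) := fun S => by
      have := (hT S.1 S.2).2
      rw [hS S] at this
      exact this
    have hinj : Function.Injective κ := by
      intro S S' h
      have h1 := (hmem S).2
      have h2 := (hmem S').2
      rw [h] at h1
      have h3 := hG2 _ _ (hU S) _ (hU S') x h1 h2
      apply Subtype.ext
      rw [hS S, hS S', h, h3]
    have := hM4 (q x) (T.attach.image κ) (by
      intro i hi
      obtain ⟨S, -, rfl⟩ := Finset.mem_image.1 hi
      exact (hmem S).1)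
    rwa [Finset.card_image_of_injective _ hinj, Finset.card_attach] at this

/-- The branch set lying over a set `Y'` has dimension at most that of `Y'`. -/
lemma branch_dim {X Y G : Type*} [TopologicalSpace X] [TopologicalSpace.MetrizableSpace X]
    [TopologicalSpace Y] [TopologicalSpace.MetrizableSpace Y]
    [TopologicalSpace G] [TopologicalSpace.MetrizableSpace G]
    (f : X → Y) (hf : IsPerfectMap f) (g : X → G) (hgc : Continuous g)
    (hg0 : ∀ y : Y, CovDimLE (g '' (f ⁻¹' {y})) 0) (n k : ℕ) (hn : 1 ≤ n) (Y' : Set Y)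
    (hsub : ∀ z ∈ BranchSet (fun x => (f x, g x)) n, z.1 ∈ Y') (hY : CovDimLENat Y' k) :
    CovDimLENat (BranchSet (fun x => (f x, g x)) n) k := by
  classical
  let _ := TopologicalSpace.metrizableSpaceMetric X
  have hfp : IsProperMap f := isProperMap_iff_isClosedMap_and_compact_fibers.2 hf
  let h : X → Y × G := fun x => (f x, g x)
  have hhc : Continuous h := hf.1.prodMk hgc
  have hhp : IsProperMap h := isProperMap_of_comp_of_t2 hhc continuous_fst hfp
  -- the closed pieces
  let D : ℕ → Set (Fin n → X) := fun j =>
    {x | ∀ a b, a ≠ b → ((j : ℝ) + 1)⁻¹ ≤ dist (x a) (x b)}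
  have hD : ∀ j, IsClosed (D j) := by
    intro j
    simp only [D, ofPred_forall]
    refine isClosed_iInter fun a => isClosed_iInter fun b => isClosed_iInter fun _ => ?_
    exact isClosed_le continuous_const ((continuous_apply a).dist (continuous_apply b))
  let C : ℕ → Set (Y × G) := fun j => {z | ∃ x ∈ D j, ∀ a, h (x a) = z}
  have hC : ∀ j, IsClosed (C j) := by
    intro j
    have h1 : IsClosed ((fun (x : Fin n → X) a => h (x a)) '' D j) :=
      (IsProperMap.pi_map (fun _ : Fin n => hhp)).isClosedMap _ (hD j)
    have h2 : Continuous (fun (z : Y × G) (_ : Fin n) => z) :=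
      continuous_pi fun _ => continuous_id
    have h3 : C j = (fun (z : Y × G) (_ : Fin n) => z) ⁻¹'
        ((fun (x : Fin n → X) a => h (x a)) '' D j) := by
      ext z
      constructor
      · rintro ⟨x, hx, hz⟩
        exact ⟨x, hx, funext hz⟩
      · rintro ⟨x, hx, hz⟩
        exact ⟨x, hx, fun a => congrFun hz a⟩
    rw [h3]
    exact h1.preimage h2
  have hCB : ∀ j, C j ⊆ BranchSet h n := by
    rintro j z ⟨x, hx, hz⟩
    have hinj : Function.Injective x := by
      intro a b hab
      by_contra hne
      have h1 := hx a b hne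
      rw [hab, dist_self] at h1
      have : (0 : ℝ) < ((j : ℝ) + 1)⁻¹ := by positivity
      linarith
    refine ⟨Finset.univ.image x, ?_, ?_⟩
    · rw [Finset.card_image_of_injective _ hinj, Finset.card_univ, Fintype.card_fin]
    · intro y hy
      obtain ⟨a, -, rfl⟩ := Finset.mem_image.1 hy
      exact hz a
  have hBC : ∀ z ∈ BranchSet h n, ∃ j, z ∈ C j := by
    rintro z ⟨S, hS, hz⟩
    obtain ⟨S', hS', hc⟩ := Finset.exists_subset_card_eq hS
    let e : Fin n ≃ S' := (Fintype.equivFinOfCardEq (by simpa using hc)).symm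
    let x : Fin n → X := fun a => (e a : X)
    have hinj : Function.Injective x := Subtype.val_injective.comp e.injective
    have hpos : ∃ ε : ℝ, 0 < ε ∧ ∀ a b, a ≠ b → ε ≤ dist (x a) (x b) := by
      have h1 : ∀ p : Fin n × Fin n, ∃ ε : ℝ, 0 < ε ∧ (p.1 ≠ p.2 → ε ≤ dist (x p.1) (x p.2)) := by
        intro p
        by_cases hp : p.1 = p.2
        · exact ⟨1, one_pos, fun h => absurd hp h⟩
        · exact ⟨_, dist_pos.2 fun h => hp (hinj h), fun _ => le_rfl⟩
      choose ε hε hε' using h1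
      have hne : (Finset.univ : Finset (Fin n × Fin n)).Nonempty :=
        ⟨(⟨0, hn⟩, ⟨0, hn⟩), Finset.mem_univ _⟩
      obtain ⟨p, -, hp⟩ := Finset.univ.exists_min_image ε hne
      exact ⟨ε p, hε p, fun a b hab => (hp (a, b) (Finset.mem_univ _)).trans (hε' (a, b) hab)⟩
    obtain ⟨ε, hε, hε'⟩ := hpos
    obtain ⟨j, hj⟩ := exists_nat_one_div_lt hε
    refine ⟨j, x, fun a b hab => ?_, fun a => hz _ (hS' (e a).2)⟩
    rw [one_div] at hj
    exact hj.le.trans (hε' a b hab)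
  have hCp : ∀ j, IsProperMap (fun z : C j => z.1.1) := by
    intro j
    have hcl : IsClosed (h ⁻¹' C j) := (hC j).preimage hhc
    let ψ : h ⁻¹' C j → C j := fun x => ⟨h x.1, x.2⟩
    refine isProperMap_of_comp_of_surj (f := ψ) ?_ ?_ ?_ ?_
    · exact (hhc.comp continuous_subtype_val).subtype_mk _
    · exact continuous_fst.comp continuous_subtype_val
    · exact hfp.comp hcl.isProperMap_subtypeVal
    · rintro ⟨z, hz⟩
      obtain ⟨x, hx, hxz⟩ := id hz
      have := hxz ⟨0, hn⟩
      refine ⟨⟨x ⟨0, hn⟩, ?_⟩, Subtype.ext this⟩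
      rw [mem_preimage, this]
      exact hz
  refine sum_theorem (fun j => ((↑) : BranchSet h n → Y × G) ⁻¹' (C j))
    (fun j => (hC j).preimage continuous_subtype_val) (fun z => hBC z.1 z.2) ?_
  intro j
  let q : (((↑) : BranchSet h n → Y × G) ⁻¹' (C j)) → Y' := fun z => ⟨z.1.1.1, hsub _ z.1.2⟩
  have hqc : Continuous q :=
    (continuous_fst.comp (continuous_subtype_val.comp continuous_subtype_val)).subtype_mk _
  have hq : IsProperMap q := by
    rw [isProperMap_iff_ultrafilter]
    refine ⟨hqc, ?_⟩
    intro 𝒰 y hy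
    let i : (((↑) : BranchSet h n → Y × G) ⁻¹' (C j)) → C j := fun z => ⟨z.1.1, z.2⟩
    have h1 := (isProperMap_iff_ultrafilter.1 (hCp j)).2 (𝒰 := 𝒰.map i) (y := y.1)
      ((continuous_subtype_val.tendsto y).comp hy)
    obtain ⟨c, hc, hlim⟩ := h1
    refine ⟨⟨⟨c.1, hCB j c.2⟩, c.2⟩, Subtype.ext hc, ?_⟩
    rw [nhds_subtype_eq_comap, nhds_subtype_eq_comap, Filter.comap_comap,
      ← Filter.map_le_iff_le_comap]
    exact ((continuous_subtype_val.tendsto c).comp hlim)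
  refine perfect_dim hY q hq ?_
  intro y
  have hcomp : CompactSpace (q ⁻¹' {y}) := isCompact_iff_compactSpace.1
    ((isProperMap_iff_isClosedMap_and_compact_fibers.1 hq).2.2 y)
  have hmem : ∀ z : q ⁻¹' {y}, z.1.1.1.2 ∈ g '' (f ⁻¹' {y.1}) := by
    rintro ⟨⟨⟨z, hzB⟩, hz⟩, hzy⟩
    obtain ⟨x, hx, hxz⟩ := hz
    have h1 : h (x ⟨0, hn⟩) = z := hxz ⟨0, hn⟩
    have h2 : z.1 = y.1 := congrArg Subtype.val hzy
    refine ⟨x ⟨0, hn⟩, ?_, congrArg Prod.snd h1⟩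
    have h3 : f (x ⟨0, hn⟩) = z.1 := congrArg Prod.fst h1
    exact h3.trans h2
  let θ : q ⁻¹' {y} → g '' (f ⁻¹' {y.1}) := fun z => ⟨z.1.1.1.2, hmem z⟩
  have hθc : Continuous θ := (continuous_snd.comp (continuous_subtype_val.comp
    (continuous_subtype_val.comp continuous_subtype_val))).subtype_mk _
  have hθi : Function.Injective θ := by
    intro a b hab
    have h2 : a.1.1.1.2 = b.1.1.1.2 := congrArg Subtype.val hab
    have ha : a.1.1.1.1 = y.1 := congrArg Subtype.val a.2
    have hb : b.1.1.1.1 = y.1 := congrArg Subtype.val b.2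
    exact Subtype.ext (Subtype.ext (Subtype.ext (Prod.ext (ha.trans hb.symm) h2)))
  have hθ : IsClosedEmbedding θ := hθc.isClosedEmbedding hθi
  rcases hg0 y.1 with hemp | ⟨l, hl, hd⟩
  · exact Or.inl ⟨fun z => hemp.false (θ z)⟩
  · exact Or.inr ⟨l, hl, covDim_closedEmbedding θ hθ hd⟩

lemma branch_dim' {X Y G : Type*} [TopologicalSpace X] [TopologicalSpace.MetrizableSpace X]
    [TopologicalSpace Y] [TopologicalSpace.MetrizableSpace Y]
    [TopologicalSpace G] [TopologicalSpace.MetrizableSpace G]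
    (f : X → Y) (hf : IsPerfectMap f) (g : X → G) (hgc : Continuous g)
    (hg0 : ∀ y : Y, CovDimLE (g '' (f ⁻¹' {y})) 0) (n : ℕ) (k : ℤ) (hn : 1 ≤ n) (Y' : Set Y)
    (hsub : ∀ z ∈ BranchSet (fun x => (f x, g x)) n, z.1 ∈ Y') (hY : CovDimLE Y' k) :
    CovDimLE (BranchSet (fun x => (f x, g x)) n) k := by
  rcases hY with hemp | ⟨l, hl, hd⟩
  · exact Or.inl ⟨fun z => hemp.false ⟨z.1.1, hsub _ z.2⟩⟩
  · exact Or.inr ⟨l, hl, branch_dim f hf g hgc hg0 n l hn Y' hsub hd⟩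

end S19

/-- Let `f : X → Y` be a perfect 0-dimensional surjective map with
`dim Y = m`, `p ≥ 1`, and let `g ∈ C*(X, ℝ^p)` be such that each `g(f⁻¹(y))` is
0-dimensional and, for a fixed chain of `F_σ`-sets `Y₀ ⊆ … ⊆ Y_m` with `dim Y_i ≤ i` and
`dim (Y ∖ Y_i) ≤ m - i - 1`, the map `f × g` is at most `(⌊i/p⌋ + 1)`-to-one on
`f⁻¹(Y_i)`. Then `dim B_n(f × g) ≤ m - (n-1)p` for every `n ≥ 1`, i.e. `g` is
`f`-regularly branched. -/
theorem statement19 {X Y : Type*} [TopologicalSpace X] [TopologicalSpace.MetrizableSpace X]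
    [TopologicalSpace Y] [TopologicalSpace.MetrizableSpace Y]
    (m p : ℕ) (hp : 1 ≤ p) (f : X → Y) (hf : IsPerfectMap f)
    (hfsurj : Function.Surjective f) (hfdim : DimMapLE f 0)
    (hdimY : CovDimLE Y m) (hdimY' : ¬ CovDimLE Y ((m : ℤ) - 1))
    (g : X →ᵇ EuclideanSpace ℝ (Fin p))
    (hg0 : ∀ y : Y, CovDimLE ((⇑g) '' (f ⁻¹' {y})) 0)
    (Yi : ℕ → Set Y)
    (hchain : ∀ i j, i ≤ j → j ≤ m → Yi i ⊆ Yi j)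
    (hFsigma : ∀ i ≤ m, ∃ C : ℕ → Set Y, (∀ j, IsClosed (C j)) ∧ Yi i = ⋃ j, C j)
    (hdimYi : ∀ i ≤ m, CovDimLE (Yi i) i)
    (hdimcompl : ∀ i ≤ m, CovDimLE ↥((Set.univ : Set Y) \ Yi i) ((m : ℤ) - i - 1))
    (hto1 : ∀ i ≤ m, ∀ z : Y × EuclideanSpace ℝ (Fin p), ∀ S : Finset X,
      ↑S ⊆ f ⁻¹' (Yi i) → (∀ x ∈ S, (f x, g x) = z) → S.card ≤ i / p + 1) :
    ∀ n : ℕ, 1 ≤ n →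
      CovDimLE (BranchSet (fun x => (f x, g x)) n)
        ((m : ℤ) - ((n : ℤ) - 1) * p) := by
  intro n hn
  have hsub : ∀ i ≤ m, i < (n - 1) * p →
      ∀ z ∈ BranchSet (fun x => (f x, g x)) n, z.1 ∈ (Set.univ : Set Y) \ Yi i := by
    rintro i him hi z ⟨S, hS, hz⟩
    refine ⟨mem_univ _, fun hzY => ?_⟩
    have h1 := hto1 i him z S (fun x hx => by
      have h2 : f x = z.1 := congrArg Prod.fst (hz x hx)
      rw [mem_preimage, h2]
      exact hzY) hz
    have h3 : i / p < n - 1 := Nat.div_lt_of_lt_mul (by rwa [mul_comm] at hi)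
    omega
  have hcast : ((n : ℤ) - 1) * p = (((n - 1) * p : ℕ) : ℤ) := by
    push_cast [Nat.cast_sub hn]
    ring
  rw [hcast]
  obtain h1 | h1 := Nat.eq_zero_or_pos ((n - 1) * p)
  · refine S19.branch_dim' f hf g g.continuous hg0 n _ hn univ (fun z _ => mem_univ _) ?_
    rw [h1]
    rcases hdimY with hemp | ⟨l, hl, hd⟩
    · exact Or.inl ⟨fun z => hemp.false z.1⟩
    · exact Or.inr ⟨l, by simpa using hl,
        S19.covDim_closedEmbedding _ isClosed_univ.isClosedEmbedding_subtypeVal hd⟩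
  · by_cases h2 : (n - 1) * p - 1 ≤ m
    · refine S19.branch_dim' f hf g g.continuous hg0 n _ hn _ (hsub _ h2 (by omega)) ?_
      have := hdimcompl _ h2
      convert this using 1
      omega
    · rcases hdimcompl m le_rfl with hemp | ⟨l, hl, -⟩
      · exact Or.inl ⟨fun z => hemp.false ⟨z.1.1, hsub m le_rfl (by omega) _ z.2⟩⟩
      · omega
end
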